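/- (Trudgian) For every integer n ≥ 229, |π(n) − n/log(n) − n/(log n)²| ≤ 184·n/(log n)³. -/

import Mathlib

open Real

/-- `primePi x` is the number of primes `p ≤ x`. -/
noncomputable def primePi (x : ℕ) : ℕ :=
  (Finset.filter Nat.Prime (Finset.Icc 1 x)).card

namespace PrimeBound

open Filter Topology MeasureTheory Set
open scoped ComplexConjugate

/-- The Riemann xi function, normalised by `xi 0 = 1`. -/
noncomputable def xi (s : ℂ) : ℂ := s * (s - 1) * completedRiemannZeta₀ s + 1

lemma differentiable_xi : Differentiable ℂ xi := by
  unfold xi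
  have := differentiable_completedZeta₀
  fun_prop

lemma xi_one : xi 1 = 1 := by simp [xi]

lemma xi_one_sub (s : ℂ) : xi (1 - s) = xi s := by
  unfold xi
  rw [completedRiemannZeta₀_one_sub]
  ring

lemma xi_eq {s : ℂ} (h0 : s ≠ 0) (h1 : s ≠ 1) :
    xi s = s * (s - 1) * completedRiemannZeta s := by
  have h1' : (1 : ℂ) - s ≠ 0 := sub_ne_zero.mpr h1.symm
  rw [xi, completedRiemannZeta_eq]
  field_simp
  ring

lemma xi_eq_riemannZeta {s : ℂ} (h : 0 < s.re) (h1 : s ≠ 1) :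
    xi s = s * (s - 1) * (Complex.Gammaℝ s * riemannZeta s) := by
  have h0 : s ≠ 0 := by rintro rfl; simp at h
  rw [xi_eq h0 h1, riemannZeta_def_of_ne_zero h0,
    mul_div_cancel₀ _ (Complex.Gammaℝ_ne_zero_of_re_pos h)]

lemma xi_ne_zero_of_one_le_re {s : ℂ} (h : 1 ≤ s.re) : xi s ≠ 0 := by
  by_cases h1 : s = 1
  · simp [h1, xi_one]
  have h0 : s ≠ 0 := by rintro rfl; norm_num at h
  rw [xi_eq_riemannZeta (by linarith) h1]
  exact mul_ne_zero (mul_ne_zero h0 (sub_ne_zero.mpr h1))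
    (mul_ne_zero (Complex.Gammaℝ_ne_zero_of_re_pos (by linarith))
      (riemannZeta_ne_zero_of_one_le_re h))

lemma re_lt_one_of_xi_eq_zero {s : ℂ} (h : xi s = 0) : s.re < 1 := by
  by_contra! h1
  exact xi_ne_zero_of_one_le_re h1 h

lemma re_pos_of_xi_eq_zero {s : ℂ} (h : xi s = 0) : 0 < s.re := by
  have := re_lt_one_of_xi_eq_zero (s := 1 - s) (by rwa [xi_one_sub])
  simp at this
  exact this

lemma xi_conj (s : ℂ) : xi (conj s) = conj (xi s) := by
  have hd : Differentiable ℂ (fun z ↦ conj (xi (conj z))) := fun z ↦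
    differentiableAt_conj_conj_iff.mpr (differentiable_xi _)
  have hgz (z : ℂ) (hz : 1 < z.re) : conj (xi (conj z)) = xi z := by
    have h1 : z ≠ 1 := by rintro rfl; simp at hz
    have h1' : conj z ≠ 1 := (map_ne_one_iff _ (starRingEnd ℂ).injective).mpr h1
    rw [xi_eq_riemannZeta (by simp; linarith) h1', xi_eq_riemannZeta (by linarith) h1]
    simp only [map_mul, map_sub, map_one, Complex.conj_conj, riemannZeta_conj, Complex.Gammaℝ_def]
    have h2 : conj z / 2 = conj (z / 2) := by rw [map_div₀, map_ofNat]
    have h3 : -conj z / 2 = conj (-z / 2) := by rw [map_div₀, map_ofNat, map_neg]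
    rw [h2, h3, Complex.Gamma_conj, Complex.cpow_conj _ _ (by
      rw [Complex.arg_ofReal_of_nonneg pi_pos.le]; exact pi_pos.ne)]
    simp
  have := (Complex.analyticOnNhd_univ_iff_differentiable.mpr hd).eq_of_eventuallyEq
    (Complex.analyticOnNhd_univ_iff_differentiable.mpr differentiable_xi) (z₀ := 2)
    (eventuallyEq_of_mem
      ((isOpen_lt continuous_const Complex.continuous_re).mem_nhds (by norm_num)) hgz)
  have h := congrFun this (conj s)
  simp only [Complex.conj_conj] at h
  exact h.symm

/-- The completed zeta function is bounded on vertical strips. -/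
lemma exists_norm_completedRiemannZeta₀_le (a b : ℝ) :
    ∃ C, ∀ s : ℂ, a ≤ s.re → s.re ≤ b → ‖completedRiemannZeta₀ s‖ ≤ C := by
  set P := HurwitzZeta.hurwitzEvenFEPair 0
  have hconv (σ : ℂ) : IntegrableOn (fun t : ℝ => ‖(t : ℂ) ^ (σ - 1) • P.f_modif t‖) (Ioi 0) :=
    (P.isStrongFEPair_toStrongFEPair.hasMellin σ).1.norm
  refine ⟨(∫ t in Ioi (0 : ℝ), (‖(t : ℂ) ^ (((a / 2 : ℝ) : ℂ) - 1) • P.f_modif t‖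
    + ‖(t : ℂ) ^ (((b / 2 : ℝ) : ℂ) - 1) • P.f_modif t‖)) / 2, fun s ha hb ↦ ?_⟩
  have h1 : completedRiemannZeta₀ s = mellin P.f_modif (s / 2) / 2 := rfl
  rw [h1, norm_div, Complex.norm_ofNat]
  gcongr
  rw [mellin]
  refine (norm_integral_le_integral_norm _).trans ?_
  refine setIntegral_mono_on (hconv _) ((hconv _).add (hconv _)) measurableSet_Ioi fun t ht ↦ ?_
  have ht' : (0 : ℝ) < t := ht
  simp only [norm_smul, ← add_mul]
  gcongr
  simp only [Complex.norm_cpow_eq_rpow_re_of_pos ht']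
  simp only [Complex.sub_re, Complex.one_re, Complex.ofReal_re, Complex.div_ofNat_re]
  rcases le_total 1 t with h | h
  · have := rpow_le_rpow_of_exponent_le h (show s.re / 2 - 1 ≤ b / 2 - 1 by linarith)
    have := rpow_nonneg ht'.le (a / 2 - 1)
    linarith
  · have := rpow_le_rpow_of_exponent_ge ht' h (show a / 2 - 1 ≤ s.re / 2 - 1 by linarith)
    have := rpow_nonneg ht'.le (b / 2 - 1)
    linarith

lemma norm_Gamma_le_Gamma_re {s : ℂ} (hs : 0 < s.re) : ‖Complex.Gamma s‖ ≤ Gamma s.re := by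
  rw [Complex.Gamma_eq_integral hs, Gamma_eq_integral hs, Complex.GammaIntegral]
  refine (norm_integral_le_integral_norm _).trans (le_of_eq ?_)
  refine setIntegral_congr_fun measurableSet_Ioi fun t ht ↦ ?_
  have ht' : (0 : ℝ) < t := ht
  simp [Complex.norm_cpow_eq_rpow_re_of_pos ht', Complex.norm_exp]

lemma Gamma_le_exp {x : ℝ} (hx : 1 ≤ x) : Gamma x ≤ exp (2 * (x + 2) * √(x + 2)) := by
  set n := ⌊x⌋₊ + 1
  have hn1 : (n : ℝ) ≤ x + 1 := by
    have := Nat.floor_le (show 0 ≤ x by linarith)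
    push_cast [n]; linarith
  have hn2 : x ≤ n := by
    have := Nat.lt_floor_add_one x
    push_cast [n]; linarith
  have h1 : Gamma x ≤ n.factorial := by
    rw [← Gamma_nat_eq_factorial]
    rcases le_total 2 x with h | h
    · exact Gamma_strictMonoOn_Ici.monotoneOn h (show (2 : ℝ) ≤ _ by linarith) (by linarith)
    · have h2 : Gamma x ≤ 1 := by
        have := convexOn_Gamma.2 (show (0 : ℝ) < 1 by norm_num) (show (0 : ℝ) < 2 by norm_num)
          (show 0 ≤ 2 - x by linarith) (show 0 ≤ x - 1 by linarith) (by ring)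
        simp only [smul_eq_mul, Gamma_one, Gamma_two] at this
        ring_nf at this ⊢
        linarith
      rw [Gamma_nat_eq_factorial]
      exact h2.trans (by exact_mod_cast Nat.succ_le_of_lt (Nat.factorial_pos _))
  have hnpos : (0 : ℝ) < n := by positivity
  have h2 : (n.factorial : ℝ) ≤ (n : ℝ) ^ n := by exact_mod_cast Nat.factorial_le_pow n
  refine h1.trans (h2.trans ?_)
  have h6 : (n : ℝ) ^ n = exp (n * Real.log n) := by rw [Real.exp_nat_mul, Real.exp_log hnpos]
  rw [h6]
  apply exp_le_exp.mpr
  have h3 : Real.log n ≤ 2 * √n := by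
    have h := Real.log_le_sub_one_of_pos (Real.sqrt_pos.mpr hnpos)
    rw [Real.log_sqrt hnpos.le] at h
    linarith
  have h4 : √(n : ℝ) ≤ √(x + 2) := Real.sqrt_le_sqrt (by linarith)
  have h5 := Real.sqrt_nonneg (n : ℝ)
  calc (n : ℝ) * Real.log n ≤ n * (2 * √n) := by gcongr
    _ ≤ (x + 2) * (2 * √(x + 2)) := by gcongr; linarith
    _ = _ := by ring

lemma exists_norm_riemannZeta_le : ∃ C, ∀ s : ℂ, 2 ≤ s.re → ‖riemannZeta s‖ ≤ C := by
  refine ⟨∑' n : ℕ, 1 / (n : ℝ) ^ 2, fun s hs ↦ ?_⟩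
  rw [zeta_eq_tsum_one_div_nat_cpow (by linarith)]
  refine tsum_of_norm_bounded (Real.summable_one_div_nat_pow.mpr one_lt_two).hasSum fun n ↦ ?_
  rcases Nat.eq_zero_or_pos n with rfl | hn
  · simp [Complex.zero_cpow (show s ≠ 0 by rintro rfl; norm_num at hs)]
  · rw [norm_div, norm_one, Complex.norm_natCast_cpow_of_pos hn, ← Real.rpow_natCast (n : ℝ) 2]
    gcongr
    · exact_mod_cast hn
    · exact_mod_cast hs

lemma exists_norm_completedRiemannZeta₀_le_exp :
    ∃ C, 0 ≤ C ∧ ∀ s : ℂ, 1 / 2 ≤ s.re →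
      ‖s * (s - 1) * completedRiemannZeta₀ s‖ ≤
        (1 + ‖s‖) ^ 2 * (C * exp (2 * (‖s‖ + 4) * √(‖s‖ + 4))) + 1 := by
  obtain ⟨A, hA⟩ := exists_norm_completedRiemannZeta₀_le (1 / 2) 2
  obtain ⟨B, hB⟩ := exists_norm_riemannZeta_le
  have hA0 : 0 ≤ A := (norm_nonneg _).trans (hA 1 (by norm_num) (by norm_num))
  have hB0 : 0 ≤ B := (norm_nonneg _).trans (hB 2 (by norm_num))
  refine ⟨A + B, by positivity, fun s hs ↦ ?_⟩
  have hr := norm_nonneg s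
  have hs1 : ‖s * (s - 1)‖ ≤ (1 + ‖s‖) ^ 2 := by
    rw [norm_mul, sq]
    have := norm_sub_le s 1
    rw [norm_one] at this
    gcongr <;> linarith
  rcases le_total s.re 2 with h | h
  · have h1 : (1 : ℝ) ≤ exp (2 * (‖s‖ + 4) * √(‖s‖ + 4)) := one_le_exp (by positivity)
    rw [norm_mul]
    calc ‖s * (s - 1)‖ * ‖completedRiemannZeta₀ s‖ ≤ (1 + ‖s‖) ^ 2 * ((A + B) * 1) := by
          gcongr
          linarith [hA s hs h]
      _ ≤ (1 + ‖s‖) ^ 2 * ((A + B) * exp (2 * (‖s‖ + 4) * √(‖s‖ + 4))) := by gcongr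
      _ ≤ _ := by linarith
  · have hx : xi s = s * (s - 1) * completedRiemannZeta₀ s + 1 := rfl
    have h1 : s ≠ 1 := by rintro rfl; norm_num at h
    rw [xi_eq_riemannZeta (by linarith) h1] at hx
    rw [eq_sub_of_add_eq hx.symm]
    refine (norm_sub_le _ _).trans ?_
    rw [norm_one, norm_mul]
    gcongr
    rw [norm_mul, Complex.Gammaℝ_def, norm_mul]
    have h2 : ‖(π : ℂ) ^ (-s / 2)‖ ≤ 1 := by
      rw [Complex.norm_cpow_eq_rpow_re_of_pos pi_pos]
      apply Real.rpow_le_one_of_one_le_of_nonpos (by linarith [pi_gt_three])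
      simp; linarith
    have h3 : ‖Complex.Gamma (s / 2)‖ ≤ exp (2 * (‖s‖ + 4) * √(‖s‖ + 4)) := by
      refine (norm_Gamma_le_Gamma_re (by simp; linarith)).trans ?_
      refine (Gamma_le_exp (by simp; linarith)).trans ?_
      have h4 := Complex.re_le_norm s
      have h5 : (s / 2).re + 2 ≤ ‖s‖ + 4 := by simp; linarith
      have h6 := Real.sqrt_le_sqrt h5
      gcongr
    calc ‖(π : ℂ) ^ (-s / 2)‖ * ‖Complex.Gamma (s / 2)‖ * ‖riemannZeta s‖
        ≤ 1 * exp (2 * (‖s‖ + 4) * √(‖s‖ + 4)) * (A + B) := by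
          gcongr
          linarith [hB s h]
      _ = _ := by ring

/-- The xi function has order of growth at most `3 / 2`. -/
lemma exists_norm_xi_le :
    ∃ C, 0 ≤ C ∧ ∀ s : ℂ, ‖xi s‖ ≤ exp (C * ((‖s‖ + 5) * √(‖s‖ + 5))) := by
  obtain ⟨C, hC0, hC⟩ := exists_norm_completedRiemannZeta₀_le_exp
  have key (s : ℂ) (hs : 1 / 2 ≤ s.re) :
      ‖xi s‖ ≤ exp ((C + 6) * ((‖s‖ + 4) * √(‖s‖ + 4))) := by
    have hr := norm_nonneg s
    set Y := (‖s‖ + 4) * √(‖s‖ + 4)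
    have hY : ‖s‖ + 4 ≤ Y := by
      have : 1 ≤ √(‖s‖ + 4) := Real.one_le_sqrt.mpr (by linarith)
      exact le_mul_of_one_le_right (by linarith) this
    have h1 : (1 + ‖s‖) ^ 2 ≤ exp (2 * Y) := by
      rw [mul_comm, exp_mul]
      have := add_one_le_exp Y
      rw [Real.rpow_ofNat]
      gcongr
      linarith
    have h2 : C + 2 ≤ exp (C + 1) := by linarith [add_one_le_exp (C + 1)]
    have h3 : exp (C + 1) ≤ exp ((C + 1) * Y) := by
      gcongr
      exact le_mul_of_one_le_right (by linarith) (by linarith)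
    have h4 : (2 : ℝ) * (‖s‖ + 4) * √(‖s‖ + 4) = 2 * Y := by rw [mul_assoc]
    have h5 : (1 : ℝ) ≤ exp (2 * Y) := one_le_exp (by linarith)
    calc ‖xi s‖ ≤ ‖s * (s - 1) * completedRiemannZeta₀ s‖ + 1 := by
          unfold xi
          exact (norm_add_le _ _).trans (by simp)
      _ ≤ (1 + ‖s‖) ^ 2 * (C * exp (2 * Y)) + 1 + 1 := by
          have := hC s hs
          rw [h4] at this
          linarith
      _ ≤ exp (2 * Y) * (C * exp (2 * Y)) + exp (2 * Y) * exp (2 * Y) + exp (2 * Y) * exp (2 * Y) := by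
          have : 1 ≤ exp (2 * Y) * exp (2 * Y) := one_le_mul_of_one_le_of_one_le h5 h5
          gcongr
      _ = exp (2 * Y) * exp (2 * Y) * (C + 2) := by ring
      _ ≤ exp (2 * Y) * exp (2 * Y) * exp ((C + 1) * Y) := by gcongr; exact h2.trans h3
      _ = exp ((C + 5) * Y) := by rw [← exp_add, ← exp_add]; ring_nf
      _ ≤ _ := by gcongr; linarith
  refine ⟨C + 6, by linarith, fun s ↦ ?_⟩
  rcases le_total (1 / 2) s.re with h | h
  · refine (key s h).trans ?_
    gcongr <;> linarith
  · rw [← xi_one_sub]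
    refine (key (1 - s) (by simp; linarith)).trans ?_
    have h1 : ‖1 - s‖ ≤ 1 + ‖s‖ := (norm_sub_le _ _).trans (by simp)
    have h2 : ‖1 - s‖ + 4 ≤ ‖s‖ + 5 := by linarith
    have h3 := Real.sqrt_le_sqrt h2
    gcongr

end PrimeBound

namespace PrimeBound

open Filter Topology MeasureTheory Set Metric
open scoped ComplexConjugate

lemma exists_entire_factor {f : ℂ → ℂ} (hf : Differentiable ℂ f) {a : ℂ}
    (ha : analyticOrderAt f a ≠ ⊤) :
    ∃ g : ℂ → ℂ, Differentiable ℂ g ∧ g a ≠ 0 ∧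
      ∀ z, f z = (z - a) ^ analyticOrderNatAt f a * g z := by
  set n := analyticOrderNatAt f a
  obtain ⟨g, hg, hga, hfg⟩ := ((hf.analyticAt a).analyticOrderNatAt_eq_iff ha).mp (rfl : _ = n)
  set G : ℂ → ℂ := Function.update (fun z ↦ f z / (z - a) ^ n) a (g a)
  have hGa : G =ᶠ[𝓝 a] g := by
    filter_upwards [hfg] with z hz
    by_cases h : z = a
    · simp [G, h]
    · have : (z - a) ^ n ≠ 0 := pow_ne_zero _ (sub_ne_zero.mpr h)
      simp only [G, Function.update_of_ne h, hz, smul_eq_mul]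
      field_simp
  refine ⟨G, fun z ↦ ?_, by simpa [G] using hga, fun z ↦ ?_⟩
  · by_cases h : z = a
    · rw [h]
      exact hg.differentiableAt.congr_of_eventuallyEq hGa
    · have h1 : (z - a) ^ n ≠ 0 := pow_ne_zero _ (sub_ne_zero.mpr h)
      have h2 : G =ᶠ[𝓝 z] fun z ↦ f z / (z - a) ^ n := by
        filter_upwards [isOpen_ne.mem_nhds h] with y hy
        simp [G, Function.update_of_ne hy]
      refine DifferentiableAt.congr_of_eventuallyEq ?_ h2
      have := hf z
      fun_prop (disch := exact h1)
  · by_cases h : z = a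
    · rw [h]
      have := hfg.self_of_nhds
      simpa [G] using this
    · have h1 : (z - a) ^ n ≠ 0 := pow_ne_zero _ (sub_ne_zero.mpr h)
      simp only [G, Function.update_of_ne h]
      field_simp

lemma analyticOrderAt_ne_top_of_ne_zero {f : ℂ → ℂ} (hf : Differentiable ℂ f) {w₀ : ℂ}
    (h0 : f w₀ ≠ 0) (a : ℂ) : analyticOrderAt f a ≠ ⊤ := by
  intro h
  rw [analyticOrderAt_eq_top] at h
  have := (Complex.analyticOnNhd_univ_iff_differentiable.mpr hf).eq_of_eventuallyEq
    (g := fun _ ↦ 0) (fun x _ ↦ analyticAt_const) (z₀ := a) h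
  exact h0 (congrFun this w₀)

lemma exists_entire_factor_finset {f : ℂ → ℂ} (hf : Differentiable ℂ f) {w₀ : ℂ}
    (h0 : f w₀ ≠ 0) (S : Finset ℂ) :
    ∃ h : ℂ → ℂ, Differentiable ℂ h ∧ (∀ a ∈ S, h a ≠ 0) ∧
      ∀ z, f z = (∏ a ∈ S, (z - a) ^ analyticOrderNatAt f a) * h z := by
  classical
  induction S using Finset.induction_on with
  | empty => exact ⟨f, hf, by simp, by simp⟩
  | insert a S ha ih =>
    obtain ⟨h, hd, hS, hfac⟩ := ih
    have hh0 : h w₀ ≠ 0 := fun h' ↦ h0 (by rw [hfac, h', mul_zero])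
    obtain ⟨g, hg, hga, hgfac⟩ := exists_entire_factor hd
      (analyticOrderAt_ne_top_of_ne_zero hd hh0 a)
    have hord : analyticOrderNatAt h a = analyticOrderNatAt f a := by
      set P : ℂ → ℂ := fun z ↦ ∏ a ∈ S, (z - a) ^ analyticOrderNatAt f a
      have hP : Differentiable ℂ P := by fun_prop
      have hPa : P a ≠ 0 := Finset.prod_ne_zero_iff.mpr fun b hb ↦
        pow_ne_zero _ (sub_ne_zero.mpr (by rintro rfl; exact ha hb))
      have hfP : f = P * h := funext hfac
      have h1 : analyticOrderAt f a = analyticOrderAt h a := by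
        rw [hfP, analyticOrderAt_mul (hP.analyticAt a) (hd.analyticAt a),
          (hP.analyticAt a).analyticOrderAt_eq_zero.mpr hPa, zero_add]
      rw [analyticOrderNatAt, analyticOrderNatAt, h1]
    refine ⟨g, hg, fun b hb ↦ ?_, fun z ↦ ?_⟩
    · rcases Finset.mem_insert.mp hb with rfl | hb
      · exact hga
      · have := hS b hb
        rw [hgfac] at this
        exact right_ne_zero_of_mul this
    · rw [Finset.prod_insert ha, hfac, hgfac, hord]
      ring

lemma logDeriv_eq_sum_add {f h : ℂ → ℂ} (hd : Differentiable ℂ h) (S : Finset ℂ) (m : ℂ → ℕ)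
    (hfac : ∀ z, f z = (∏ a ∈ S, (z - a) ^ m a) * h z) {z : ℂ} (hz : f z ≠ 0)
    (hS : ∀ a ∈ S, z ≠ a) :
    logDeriv f z = ∑ a ∈ S, (m a : ℂ) / (z - a) + logDeriv h z := by
  have hf : f = fun z ↦ (∏ a ∈ S, (z - a) ^ m a) * h z := funext hfac
  rw [hfac] at hz
  rw [hf, logDeriv_mul z (left_ne_zero_of_mul hz) (right_ne_zero_of_mul hz) (by fun_prop)
    (hd z)]
  congr 1
  rw [logDeriv_prod (f := fun a z ↦ (z - a) ^ m a) (fun a ha ↦ pow_ne_zero _ (sub_ne_zero.mpr (hS a ha)))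
    (fun a _ ↦ by fun_prop)]
  refine Finset.sum_congr rfl fun a ha ↦ ?_
  rw [logDeriv_fun_pow (f := fun z ↦ z - a) (by fun_prop)]
  simp [logDeriv_apply, div_eq_mul_inv]

/-- A zero-free holomorphic function on a disc whose modulus is bounded by `exp M` times the
modulus at the centre has slowly varying logarithmic derivative near the centre. -/
lemma norm_logDeriv_sub_le {h : ℂ → ℂ} (hd : Differentiable ℂ h) {w₀ : ℂ} {r M : ℝ} (hr : 0 < r)
    (hM : 0 < M) (hne : ∀ z ∈ ball w₀ r, h z ≠ 0)
    (hb : ∀ z ∈ ball w₀ r, ‖h z‖ ≤ exp M * ‖h w₀‖) {w w' : ℂ}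
    (hw : w ∈ ball w₀ (r / 8)) (hw' : w' ∈ ball w₀ (r / 8)) :
    ‖logDeriv h w - logDeriv h w'‖ ≤ 64 * M / r ^ 2 * ‖w - w'‖ := by
  have hk : DifferentiableOn ℂ (logDeriv h) (ball w₀ r) := by
    have : logDeriv h = fun z ↦ deriv h z / h z := rfl
    rw [this]
    exact (hd.deriv.differentiableOn).div hd.differentiableOn hne
  obtain ⟨g, hg0, hg⟩ := (hk.isExactOn_ball).with_val_at w₀ 0
  have hw₀ : w₀ ∈ ball w₀ r := mem_ball_self hr
  have hgd : DifferentiableOn ℂ g (ball w₀ r) := fun z hz ↦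
    (hg z hz).differentiableAt.differentiableWithinAt
  have heq : ∀ z ∈ ball w₀ r, h z = h w₀ * Complex.exp (g z) := by
    have h1 : EqOn (logDeriv h) (logDeriv (fun z ↦ Complex.exp (g z))) (ball w₀ r) := by
      intro z hz
      have := (hg z hz).cexp
      simp only [logDeriv_apply (fun z ↦ Complex.exp (g z)), this.deriv]
      field_simp [Complex.exp_ne_zero]
    obtain ⟨c, hc, hc'⟩ := (logDeriv_eqOn_iff hd.differentiableOn
      (fun z hz ↦ ((hg z hz).cexp).differentiableAt.differentiableWithinAt) isOpen_ball
      (convex_ball w₀ r).isPreconnected (fun z _ ↦ Complex.exp_ne_zero _) hne).mp h1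
    have h2 := hc' hw₀
    simp [hg0] at h2
    intro z hz
    have := hc' hz
    simpa [h2] using this
  have hre : ∀ z ∈ ball w₀ r, (g z).re ≤ M := by
    intro z hz
    have h1 := hb z hz
    rw [heq z hz, norm_mul, Complex.norm_exp, mul_comm] at h1
    have := le_of_mul_le_mul_right h1 (norm_pos_iff.mpr (hne w₀ hw₀))
    exact exp_le_exp.mp this
  have hgb : ∀ z ∈ ball w₀ (r / 2), ‖g z‖ ≤ 2 * M := by
    intro z hz
    have hmaps : MapsTo (fun x ↦ w₀ + x) (ball 0 r) (ball w₀ r) := by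
      intro x hx
      simpa using hx
    have h1 := Complex.borelCaratheodory_zero (f := fun x ↦ g (w₀ + x)) (R := r) (z := z - w₀) hM
      (hgd.comp (by fun_prop) hmaps) (fun x hx ↦ hre _ (hmaps hx)) hr
      (by
        rw [mem_ball_zero_iff, ← dist_eq_norm]
        rw [mem_ball] at hz
        linarith) (by simpa using hg0)
    simp only [add_sub_cancel] at h1
    rw [mem_ball, dist_eq_norm] at hz
    refine h1.trans ?_
    rw [div_le_iff₀ (by linarith)]
    nlinarith
  have hkb : ∀ z ∈ ball w₀ (r / 4), ‖logDeriv h z‖ ≤ 8 * M / r := by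
    intro z hz
    have hsub : closedBall z (r / 4) ⊆ ball w₀ (r / 2) := by
      intro y hy
      have := dist_triangle y z w₀
      simp only [mem_ball, mem_closedBall] at *
      linarith
    have h1 := Complex.norm_deriv_le_of_forall_mem_sphere_norm_le (f := g) (c := z) (R := r / 4)
      (C := 2 * M) (by positivity)
      (hgd.diffContOnCl_ball (hsub.trans (ball_subset_ball (by linarith))))
      (fun y hy ↦ hgb y (hsub (sphere_subset_closedBall hy)))
    rw [(hg z (ball_subset_ball (by linarith) hz)).deriv] at h1
    refine h1.trans (le_of_eq ?_)
    field_simp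
    norm_num
  have hk' : ∀ z ∈ ball w₀ (r / 8), ‖deriv (logDeriv h) z‖ ≤ 64 * M / r ^ 2 := by
    intro z hz
    have hsub : closedBall z (r / 8) ⊆ ball w₀ (r / 4) := by
      intro y hy
      have := dist_triangle y z w₀
      simp only [mem_ball, mem_closedBall] at *
      linarith
    have h1 := Complex.norm_deriv_le_of_forall_mem_sphere_norm_le (f := logDeriv h) (c := z)
      (R := r / 8) (C := 8 * M / r) (by positivity)
      (hk.diffContOnCl_ball (hsub.trans (ball_subset_ball (by linarith))))
      (fun y hy ↦ hkb y (hsub (sphere_subset_closedBall hy)))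
    refine h1.trans (le_of_eq ?_)
    field_simp
    norm_num
  exact (convex_ball w₀ (r / 8)).norm_image_sub_le_of_norm_deriv_le
    (fun z hz ↦ (hk.differentiableAt (isOpen_ball.mem_nhds (ball_subset_ball (by linarith) hz))))
    hk' hw' hw

lemma xi_two_ne_zero : xi 2 ≠ 0 := xi_ne_zero_of_one_le_re (by norm_num)

lemma norm_logDeriv_xi_sub_le : ∃ K, 0 ≤ K ∧ ∀ R, 3 ≤ R → ∀ S : Finset ℂ,
    (∀ a, a ∈ S ↔ xi a = 0 ∧ dist a (1 / 2) ≤ R) →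
    ∀ w ∈ ball (2 : ℂ) (R / 16), ∀ w' ∈ ball (2 : ℂ) (R / 16), xi w ≠ 0 → xi w' ≠ 0 →
    ‖(logDeriv xi w - ∑ a ∈ S, (analyticOrderNatAt xi a : ℂ) / (w - a)) -
      (logDeriv xi w' - ∑ a ∈ S, (analyticOrderNatAt xi a : ℂ) / (w' - a))‖ ≤
    K * ((4 * R + 6) * √(4 * R + 6)) / R ^ 2 * ‖w - w'‖ := by
  obtain ⟨C, hC0, hC⟩ := exists_norm_xi_le
  set A := |Real.log ‖xi 2‖|
  refine ⟨256 * (C + A + 1), by positivity, fun R hR S hS w hw w' hw' hxw hxw' ↦ ?_⟩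
  obtain ⟨h, hd, hhS, hfac⟩ := exists_entire_factor_finset differentiable_xi xi_two_ne_zero S
  have hR0 : 0 < R := by linarith
  set Y := (4 * R + 6) * √(4 * R + 6)
  have hY1 : 1 ≤ Y := by
    have : 1 ≤ √(4 * R + 6) := Real.one_le_sqrt.mpr (by linarith)
    exact one_le_mul_of_one_le_of_one_le (by linarith) this
  set M := C * Y + A + 1
  have hxi2 : 0 < ‖xi 2‖ := norm_pos_iff.mpr xi_two_ne_zero
  have hdist2 : dist (2 : ℂ) (1 / 2) = 3 / 2 := by
    rw [Complex.dist_eq, show (2 : ℂ) - 1 / 2 = ((3 / 2 : ℝ) : ℂ) by push_cast; norm_num,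
      Complex.norm_real]
    norm_num
  have hbase (z : ℂ) (hz : dist z (1 / 2) = 4 * R) : ‖xi z‖ ≤ exp M * ‖xi 2‖ := by
    have h1 : ‖z‖ ≤ 4 * R + 1 / 2 := by
      have := dist_triangle z (1 / 2) 0
      rw [dist_zero_right, hz, dist_zero_right] at this
      norm_num at this ⊢
      exact this
    have h2 : exp (-A) ≤ ‖xi 2‖ := by
      conv_rhs => rw [← Real.exp_log hxi2]
      exact exp_le_exp.mpr (neg_abs_le _)
    calc ‖xi z‖ ≤ exp (C * ((‖z‖ + 5) * √(‖z‖ + 5))) := hC z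
      _ ≤ exp (C * Y) := by
        have h3 : ‖z‖ + 5 ≤ 4 * R + 6 := by linarith
        have h4 := Real.sqrt_le_sqrt h3
        gcongr
        exact mul_le_mul h3 h4 (by positivity) (by linarith)
      _ ≤ exp M * exp (-A) := by rw [← exp_add]; apply exp_le_exp.mpr; simp [M]
      _ ≤ _ := by gcongr
  have hP (z : ℂ) (hz : dist z (1 / 2) = 4 * R) : ‖h z‖ ≤ exp M * ‖h 2‖ := by
    have h1 := hbase z hz
    rw [hfac z, hfac 2, norm_mul, norm_mul, norm_prod, norm_prod] at h1
    have h2 : ∏ a ∈ S, ‖((2 : ℂ) - a) ^ analyticOrderNatAt xi a‖ ≤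
        ∏ a ∈ S, ‖(z - a) ^ analyticOrderNatAt xi a‖ := by
      refine Finset.prod_le_prod (fun _ _ ↦ norm_nonneg _) fun a ha ↦ ?_
      rw [norm_pow, norm_pow]
      gcongr
      have h3 := ((hS a).mp ha).2
      have h4 := dist_triangle z a (1 / 2)
      have h5 := dist_triangle (2 : ℂ) (1 / 2) a
      rw [dist_comm (1 / 2) a] at h5
      rw [← dist_eq_norm, ← dist_eq_norm]
      linarith
    have h6 : 0 < ∏ a ∈ S, ‖(z - a) ^ analyticOrderNatAt xi a‖ := by
      refine Finset.prod_pos fun a ha ↦ norm_pos_iff.mpr (pow_ne_zero _ (sub_ne_zero.mpr ?_))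
      rintro rfl
      linarith [((hS z).mp ha).2]
    refine le_of_mul_le_mul_left ?_ h6
    calc _ ≤ _ := h1
      _ ≤ exp M * ((∏ a ∈ S, ‖(z - a) ^ analyticOrderNatAt xi a‖) * ‖h 2‖) := by gcongr
      _ = _ := by ring
  have hne (z : ℂ) (hz : z ∈ ball (2 : ℂ) (R / 2)) : h z ≠ 0 := by
    by_cases hzS : z ∈ S
    · exact hhS z hzS
    · intro h0
      apply hzS
      rw [hS, hfac, h0, mul_zero]
      refine ⟨rfl, ?_⟩
      have := dist_triangle z 2 (1 / 2)
      rw [mem_ball] at hz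
      linarith
  have hb (z : ℂ) (hz : z ∈ ball (2 : ℂ) (R / 2)) : ‖h z‖ ≤ exp M * ‖h 2‖ := by
    refine Complex.norm_le_of_forall_mem_frontier_norm_le (U := ball (1 / 2) (4 * R))
      isBounded_ball (hd.diffContOnCl) (fun y hy ↦ ?_) (subset_closure ?_)
    · rw [frontier_ball _ (by linarith)] at hy
      exact hP y hy
    · have := dist_triangle z 2 (1 / 2)
      rw [mem_ball] at hz ⊢
      linarith
  have hsub (z : ℂ) (hz : xi z ≠ 0) :
      logDeriv xi z - ∑ a ∈ S, (analyticOrderNatAt xi a : ℂ) / (z - a) = logDeriv h z := by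
    rw [logDeriv_eq_sum_add hd S _ hfac hz, add_sub_cancel_left]
    rintro a ha rfl
    exact hz ((hS z).mp ha).1
  rw [hsub w hxw, hsub w' hxw']
  have := norm_logDeriv_sub_le hd (w₀ := 2) (r := R / 2) (M := M) (by positivity) (by positivity)
    hne hb (w := w) (w' := w') (by convert hw using 2; ring) (by convert hw' using 2; ring)
  refine this.trans (mul_le_mul_of_nonneg_right ?_ (norm_nonneg _))
  rw [div_le_div_iff₀ (by positivity) (by positivity)]
  have hA : 0 ≤ A := abs_nonneg _
  have : M ≤ (C + A + 1) * Y := by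
    have : (A + 1) * 1 ≤ (A + 1) * Y := by gcongr
    simp only [M]; linarith
  calc 64 * M * R ^ 2 ≤ 64 * ((C + A + 1) * Y) * R ^ 2 := by gcongr
    _ = _ := by ring

/-- The type of zeros of the xi function. -/
abbrev XiZero := {ρ : ℂ // xi ρ = 0}

/-- The multiplicity of a zero of the xi function. -/
noncomputable def mult (ρ : XiZero) : ℝ := analyticOrderNatAt xi ρ

lemma mult_nonneg (ρ : XiZero) : 0 ≤ mult ρ := Nat.cast_nonneg _

lemma one_le_mult (ρ : XiZero) : 1 ≤ mult ρ := by
  have h : analyticOrderNatAt xi ρ ≠ 0 := by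
    intro h0
    have h1 := Nat.cast_analyticOrderNatAt
      (analyticOrderAt_ne_top_of_ne_zero differentiable_xi xi_two_ne_zero (ρ : ℂ))
    rw [h0] at h1
    exact ((differentiable_xi.analyticAt _).analyticOrderAt_eq_zero.mp h1.symm) ρ.2
  unfold mult
  exact_mod_cast Nat.one_le_iff_ne_zero.mpr h

lemma finite_xiZero_dist_le (R : ℝ) : {ρ : XiZero | dist (ρ : ℂ) (1 / 2) ≤ R}.Finite := by
  have h1 : (xi ⁻¹' {0})ᶜ ∈ codiscrete ℂ :=
    (Complex.analyticOnNhd_univ_iff_differentiable.mpr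
      differentiable_xi).preimage_zero_mem_codiscrete xi_two_ne_zero
  rw [mem_codiscrete', compl_compl] at h1
  have h2 : IsClosed (xi ⁻¹' {0}) := by simpa using h1.1
  have h3 : (closedBall (1 / 2 : ℂ) R ∩ xi ⁻¹' {0}).Finite :=
    ((isCompact_closedBall _ _).inter_right h2).finite (h1.2.mono inter_subset_right)
  refine Finite.of_finite_image (f := Subtype.val) (h3.subset ?_) Subtype.val_injective.injOn
  rintro _ ⟨ρ, hρ, rfl⟩
  exact ⟨hρ, ρ.2⟩

end PrimeBound

namespace PrimeBound

open Filter Topology MeasureTheory Set Metric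
open scoped ComplexConjugate

/-- The zeros within distance `R` of `1 / 2`. -/
noncomputable def zerosIn (R : ℝ) : Finset XiZero := (finite_xiZero_dist_le R).toFinset

lemma mem_zerosIn {R : ℝ} {ρ : XiZero} : ρ ∈ zerosIn R ↔ dist (ρ : ℂ) (1 / 2) ≤ R := by
  simp [zerosIn]

lemma tendsto_zerosIn : Tendsto (fun N : ℕ ↦ zerosIn N) atTop atTop := by
  refine tendsto_atTop_finset_of_monotone (fun a b hab ρ h ↦ ?_) fun ρ ↦ ?_
  · rw [mem_zerosIn] at *
    exact h.trans (by exact_mod_cast hab)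
  · obtain ⟨n, hn⟩ := exists_nat_ge (dist (ρ : ℂ) (1 / 2))
    exact ⟨n, mem_zerosIn.mpr hn⟩

lemma analyticOrderNatAt_xi_eq_of_factor {a : ℂ} {n : ℕ} {g : ℂ → ℂ} (hg : Differentiable ℂ g)
    (hga : g a ≠ 0) (h : ∀ z, xi z = (z - a) ^ n * g z) : analyticOrderNatAt xi a = n :=
  ((differentiable_xi.analyticAt a).analyticOrderNatAt_eq_iff
    (analyticOrderAt_ne_top_of_ne_zero differentiable_xi xi_two_ne_zero a)).mpr
    ⟨g, hg.analyticAt a, hga, .of_forall h⟩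

lemma analyticOrderNatAt_xi_one_sub (a : ℂ) :
    analyticOrderNatAt xi (1 - a) = analyticOrderNatAt xi a := by
  obtain ⟨g, hg, hga, hfac⟩ := exists_entire_factor differentiable_xi
    (analyticOrderAt_ne_top_of_ne_zero differentiable_xi xi_two_ne_zero a)
  refine analyticOrderNatAt_xi_eq_of_factor
    (g := fun z ↦ (-1) ^ analyticOrderNatAt xi a * g (1 - z)) (by fun_prop) (by simpa) fun z ↦ ?_
  rw [← xi_one_sub, hfac, ← mul_assoc, ← mul_pow]
  ring

lemma analyticOrderNatAt_xi_conj (a : ℂ) :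
    analyticOrderNatAt xi (conj a) = analyticOrderNatAt xi a := by
  obtain ⟨g, hg, hga, hfac⟩ := exists_entire_factor differentiable_xi
    (analyticOrderAt_ne_top_of_ne_zero differentiable_xi xi_two_ne_zero a)
  refine analyticOrderNatAt_xi_eq_of_factor
    (g := fun z ↦ conj (g (conj z))) (fun z ↦ differentiableAt_conj_conj_iff.mpr (hg _))
    (by simpa) fun z ↦ ?_
  have := congrArg conj (xi_conj z)
  rw [Complex.conj_conj] at this
  rw [← this, hfac]
  simp

/-- The reflection `ρ ↦ 1 - ρ` on zeros. -/
noncomputable def reflZero : XiZero ≃ XiZero where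
  toFun ρ := ⟨1 - ρ, by rw [xi_one_sub]; exact ρ.2⟩
  invFun ρ := ⟨1 - ρ, by rw [xi_one_sub]; exact ρ.2⟩
  left_inv ρ := by simp
  right_inv ρ := by simp

/-- Complex conjugation on zeros. -/
noncomputable def conjZero : XiZero ≃ XiZero where
  toFun ρ := ⟨conj (ρ : ℂ), by rw [xi_conj, ρ.2, map_zero]⟩
  invFun ρ := ⟨conj (ρ : ℂ), by rw [xi_conj, ρ.2, map_zero]⟩
  left_inv ρ := by simp
  right_inv ρ := by simp

@[simp] lemma coe_reflZero (ρ : XiZero) : (reflZero ρ : ℂ) = 1 - ρ := rfl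

@[simp] lemma coe_conjZero (ρ : XiZero) : (conjZero ρ : ℂ) = conj (ρ : ℂ) := rfl

@[simp] lemma mult_reflZero (ρ : XiZero) : mult (reflZero ρ) = mult ρ := by
  simp [mult, analyticOrderNatAt_xi_one_sub]

@[simp] lemma mult_conjZero (ρ : XiZero) : mult (conjZero ρ) = mult ρ := by
  simp [mult, analyticOrderNatAt_xi_conj]

lemma XiZero.re_pos (ρ : XiZero) : 0 < (ρ : ℂ).re := re_pos_of_xi_eq_zero ρ.2

lemma XiZero.re_lt_one (ρ : XiZero) : (ρ : ℂ).re < 1 := re_lt_one_of_xi_eq_zero ρ.2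

lemma sum_zerosIn_reflZero {E : Type*} [AddCommMonoid E] (R : ℝ) (F : XiZero → E) :
    ∑ ρ ∈ zerosIn R, F (reflZero ρ) = ∑ ρ ∈ zerosIn R, F ρ := by
  refine Finset.sum_equiv reflZero (fun ρ ↦ ?_) fun _ _ ↦ rfl
  rw [mem_zerosIn, mem_zerosIn, coe_reflZero, dist_comm, dist_eq_norm, dist_eq_norm]
  ring_nf

lemma logDeriv_xi_one_sub (s : ℂ) : logDeriv xi (1 - s) = -logDeriv xi s := by
  have h : deriv xi (1 - s) = -deriv xi s := by
    have h1 : xi = fun z ↦ xi (1 - z) := funext fun z ↦ (xi_one_sub z).symm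
    conv_rhs => rw [h1]
    rw [deriv_comp_const_sub, neg_neg]
  rw [logDeriv_apply, logDeriv_apply, h, xi_one_sub, neg_div]

lemma tendsto_sum_zerosIn {s : ℂ} (hs : xi s ≠ 0) :
    Tendsto (fun N : ℕ ↦ ∑ ρ ∈ zerosIn N, (mult ρ : ℂ) / (s - ρ)) atTop
      (𝓝 (logDeriv xi s)) := by
  obtain ⟨K, hK0, hK⟩ := norm_logDeriv_xi_sub_le
  have hlim : Tendsto (fun N : ℕ ↦ K * ((4 * (N : ℝ) + 6) * √(4 * N + 6)) / (N : ℝ) ^ 2 *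
      ‖s - (1 - s)‖) atTop (𝓝 0) := by
    have h1 : Tendsto (fun N : ℕ ↦ K * (100 * (√(N : ℝ))⁻¹) * ‖s - (1 - s)‖) atTop (𝓝 0) := by
      have h2 : Tendsto (fun N : ℕ ↦ (√(N : ℝ))⁻¹) atTop (𝓝 0) :=
        tendsto_inv_atTop_zero.comp (Real.tendsto_sqrt_atTop.comp tendsto_natCast_atTop_atTop)
      simpa using ((h2.const_mul 100).const_mul K).mul_const ‖s - (1 - s)‖
    refine squeeze_zero' (.of_forall fun N ↦ by positivity) ?_ h1
    filter_upwards [eventually_ge_atTop 6] with N hN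
    have hN' : (6 : ℝ) ≤ N := by exact_mod_cast hN
    have h3 : √(4 * (N : ℝ) + 6) ≤ 3 * √N := by
      rw [Real.sqrt_le_left (by positivity), mul_pow, Real.sq_sqrt (by positivity)]
      linarith
    have h4 : 0 < √(N : ℝ) := Real.sqrt_pos.mpr (by linarith)
    have h5 : (N : ℝ) = √N * √N := (Real.mul_self_sqrt (by positivity)).symm
    rw [mul_div_assoc]
    gcongr
    rw [div_le_iff₀ (by positivity)]
    calc (4 * (N : ℝ) + 6) * √(4 * N + 6) ≤ (5 * N) * (3 * √N) := by gcongr; linarith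
      _ ≤ 100 * N * √N := by nlinarith
      _ = 100 * (√(N : ℝ))⁻¹ * N ^ 2 := by
        have : (√(N : ℝ))⁻¹ * N = √N := by
          nth_rewrite 2 [h5]
          field_simp
        calc 100 * N * √N = 100 * N * ((√(N : ℝ))⁻¹ * N) := by rw [this]
          _ = _ := by ring
  rw [tendsto_iff_norm_sub_tendsto_zero]
  refine squeeze_zero' (.of_forall fun N ↦ norm_nonneg _) ?_ hlim
  obtain ⟨n0, hn0⟩ := exists_nat_ge (16 * (dist s 2 + dist (1 - s) 2 + 3))
  filter_upwards [eventually_ge_atTop n0] with N hN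
  have hN' : 16 * (dist s 2 + dist (1 - s) 2 + 3) ≤ N := hn0.trans (by exact_mod_cast hN)
  have hd1 : 0 ≤ dist s 2 := dist_nonneg
  have hd2 : 0 ≤ dist (1 - s) 2 := dist_nonneg
  have h1 := hK N (by linarith) ((zerosIn N).map ⟨Subtype.val, Subtype.val_injective⟩)
    (fun a ↦ by
      simp only [Finset.mem_map, mem_zerosIn, Function.Embedding.coeFn_mk]
      constructor
      · rintro ⟨ρ, h, rfl⟩
        exact ⟨ρ.2, h⟩
      · rintro ⟨h, h'⟩
        exact ⟨⟨a, h⟩, h', rfl⟩)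
    s (by rw [mem_ball]; linarith) (1 - s) (by rw [mem_ball]; linarith) hs
    (by rwa [xi_one_sub])
  simp only [Finset.sum_map, Function.Embedding.coeFn_mk] at h1
  have hm (ρ : XiZero) : (analyticOrderNatAt xi ρ : ℂ) = (mult ρ : ℂ) := by simp [mult]
  simp only [hm, logDeriv_xi_one_sub] at h1
  have h2 : ∑ ρ ∈ zerosIn N, (mult ρ : ℂ) / (1 - s - ρ) =
      -∑ ρ ∈ zerosIn N, (mult ρ : ℂ) / (s - ρ) := by
    rw [← sum_zerosIn_reflZero, ← Finset.sum_neg_distrib]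
    refine Finset.sum_congr rfl fun ρ _ ↦ ?_
    rw [mult_reflZero, coe_reflZero, ← div_neg]
    congr 1
    ring
  rw [h2] at h1
  set D := logDeriv xi s
  set T := ∑ ρ ∈ zerosIn N, (mult ρ : ℂ) / (s - ρ)
  have h3 : D - T - (-D - -T) = -(2 * (T - D)) := by ring
  rw [h3, norm_neg, norm_mul, Complex.norm_ofNat] at h1
  have := norm_nonneg (T - D)
  linarith

lemma hasSum_of_nonneg_of_tendsto_zerosIn {F : XiZero → ℝ} (hF : ∀ ρ, 0 ≤ F ρ) {a : ℝ}
    (h : Tendsto (fun N : ℕ ↦ ∑ ρ ∈ zerosIn N, F ρ) atTop (𝓝 a)) : HasSum F a := by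
  have hsum : Summable F := by
    refine summable_of_sum_le hF (c := a) fun u ↦ ?_
    refine ge_of_tendsto h ?_
    filter_upwards [tendsto_zerosIn.eventually_ge_atTop u] with N hN
    exact Finset.sum_le_sum_of_subset_of_nonneg hN fun _ _ _ ↦ hF _
  have := hsum.hasSum.comp tendsto_zerosIn
  rw [tendsto_nhds_unique h this]
  exact hsum.hasSum

lemma re_one_div_sub (s ρ : ℂ) :
    (1 / (s - ρ)).re = (s.re - ρ.re) / ((s.re - ρ.re) ^ 2 + (s.im - ρ.im) ^ 2) := by
  rw [one_div, Complex.inv_re, Complex.normSq_apply]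
  simp [sq]

lemma re_mult_div (ρ : XiZero) (z : ℂ) : ((mult ρ : ℂ) / z).re = mult ρ * (1 / z).re := by
  rw [← mul_one_div, Complex.re_ofReal_mul]

/-- Real part of the partial fraction expansion of `xi' / xi`. -/
lemma hasSum_re_one_div_sub {s : ℂ} (hs : 1 ≤ s.re) :
    HasSum (fun ρ : XiZero ↦ mult ρ * (1 / (s - ρ)).re) (logDeriv xi s).re := by
  refine hasSum_of_nonneg_of_tendsto_zerosIn (fun ρ ↦ mul_nonneg (mult_nonneg ρ) ?_) ?_
  · rw [re_one_div_sub]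
    have := ρ.re_lt_one
    exact div_nonneg (by linarith) (by positivity)
  · have := (Complex.continuous_re.tendsto _).comp
      (tendsto_sum_zerosIn (xi_ne_zero_of_one_le_re hs))
    refine this.congr fun N ↦ ?_
    simp only [Function.comp_apply, Complex.re_sum, re_mult_div]

lemma summable_mult_div : Summable (fun ρ : XiZero ↦ mult ρ / (4 + (ρ : ℂ).im ^ 2)) := by
  refine Summable.of_nonneg_of_le (fun ρ ↦ div_nonneg (mult_nonneg ρ) (by positivity)) (fun ρ ↦ ?_)
    (hasSum_re_one_div_sub (s := 2) (by norm_num)).summable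
  rw [div_eq_mul_one_div, re_one_div_sub]
  refine mul_le_mul_of_nonneg_left ?_ (mult_nonneg ρ)
  have h1 := ρ.re_pos
  have h2 := ρ.re_lt_one
  simp only [Complex.re_ofNat, Complex.im_ofNat, zero_sub, neg_sq]
  rw [div_le_div_iff₀ (by positivity) (by nlinarith [sq_nonneg (ρ : ℂ).im])]
  nlinarith [sq_nonneg (ρ : ℂ).im]

/-- The symmetrised term attached to a zero in the partial fraction expansion. -/
noncomputable def pairTerm (s : ℂ) (ρ : XiZero) : ℂ :=
  mult ρ * ((1 / 2) * (1 / (s - ρ) + 1 / (s - 1 + ρ)))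

lemma sub_ne_zero_of_one_lt_re {s : ℂ} (hs : 1 < s.re) (ρ : XiZero) : s - (ρ : ℂ) ≠ 0 := by
  intro h
  have := congrArg Complex.re h
  simp at this
  linarith [ρ.re_lt_one]

lemma sub_add_ne_zero_of_one_lt_re {s : ℂ} (hs : 1 < s.re) (ρ : XiZero) :
    s - 1 + (ρ : ℂ) ≠ 0 := by
  intro h
  have := congrArg Complex.re h
  simp at this
  linarith [ρ.re_pos]

lemma norm_pairTerm_le {s : ℂ} (hs : 1 < s.re) (ρ : XiZero) :
    ‖pairTerm s ρ‖ ≤ (‖2 * s - 1‖ * ((4 + 2 * s.im ^ 2) / (s.re - 1) ^ 2 + 2)) *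
      (mult ρ / (4 + (ρ : ℂ).im ^ 2)) := by
  have h1 := sub_ne_zero_of_one_lt_re hs ρ
  have h2 := sub_add_ne_zero_of_one_lt_re hs ρ
  set K := (4 + 2 * s.im ^ 2) / (s.re - 1) ^ 2 + 2
  have hs1 : 0 < s.re - 1 := by linarith
  have hK : 0 < K := by positivity
  have key (x y : ℝ) (hx : s.re - 1 ≤ x) (hy : (ρ : ℂ).im ^ 2 ≤ 2 * s.im ^ 2 + 2 * y ^ 2) :
      4 + (ρ : ℂ).im ^ 2 ≤ K * (x ^ 2 + y ^ 2) := by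
    have h3 : (s.re - 1) ^ 2 ≤ x ^ 2 := by gcongr
    have h4 : (4 + 2 * s.im ^ 2) ≤ (4 + 2 * s.im ^ 2) / (s.re - 1) ^ 2 * x ^ 2 := by
      rw [div_mul_eq_mul_div, le_div_iff₀ (by positivity)]
      gcongr
    have h5 : 0 ≤ (4 + 2 * s.im ^ 2) / (s.re - 1) ^ 2 * y ^ 2 := by positivity
    have h6 := sq_nonneg x
    simp only [K]
    linarith
  have hA := key (s - ρ).re (s - ρ).im (by simp; linarith [ρ.re_lt_one])
    (by simp; nlinarith [sq_nonneg (2 * s.im - (ρ : ℂ).im)])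
  have hB := key (s - 1 + ρ).re (s - 1 + ρ).im (by simp; linarith [ρ.re_pos])
    (by simp; nlinarith [sq_nonneg (2 * s.im + (ρ : ℂ).im)])
  have hn (z : ℂ) : z.re ^ 2 + z.im ^ 2 = ‖z‖ ^ 2 := by
    rw [Complex.sq_norm, Complex.normSq_apply]; ring
  rw [hn] at hA hB
  have hAB : 4 + (ρ : ℂ).im ^ 2 ≤ K * (‖s - ρ‖ * ‖s - 1 + ρ‖) := by
    have : (4 + (ρ : ℂ).im ^ 2) ^ 2 ≤ (K * (‖s - ρ‖ * ‖s - 1 + ρ‖)) ^ 2 := by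
      calc _ = (4 + (ρ : ℂ).im ^ 2) * (4 + (ρ : ℂ).im ^ 2) := sq _
        _ ≤ (K * ‖s - ρ‖ ^ 2) * (K * ‖s - 1 + ρ‖ ^ 2) := by gcongr
        _ = _ := by ring
    exact (pow_le_pow_iff_left₀ (by positivity) (by positivity) two_ne_zero).mp this
  have hpos1 := norm_pos_iff.mpr h1
  have hpos2 := norm_pos_iff.mpr h2
  have heq : pairTerm s ρ = mult ρ * ((1 / 2) * ((2 * s - 1) / ((s - ρ) * (s - 1 + ρ)))) := by
    unfold pairTerm
    field_simp
    ring
  have h6 : ‖(1 / 2 : ℂ)‖ = 1 / 2 := by norm_num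
  rw [heq, norm_mul, norm_mul, h6, norm_div, norm_mul (s - _), Complex.norm_real,
    norm_of_nonneg (mult_nonneg ρ)]
  have h7 : ‖2 * s - 1‖ / (‖s - ρ‖ * ‖s - 1 + ρ‖) ≤ ‖2 * s - 1‖ * K / (4 + (ρ : ℂ).im ^ 2) := by
    rw [div_le_div_iff₀ (by positivity) (by positivity), mul_assoc]
    gcongr
  calc mult ρ * (1 / 2 * (‖2 * s - 1‖ / (‖s - ρ‖ * ‖s - 1 + ρ‖)))
      ≤ mult ρ * (1 * (‖2 * s - 1‖ * K / (4 + (ρ : ℂ).im ^ 2))) := by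
        have := mult_nonneg ρ
        gcongr
        norm_num
    _ = _ := by ring

lemma summable_pairTerm {s : ℂ} (hs : 1 < s.re) : Summable (pairTerm s) :=
  .of_norm_bounded (summable_mult_div.mul_left _) (norm_pairTerm_le hs)

/-- The partial fraction expansion of `xi' / xi`. -/
lemma hasSum_pairTerm {s : ℂ} (hs : 1 < s.re) : HasSum (pairTerm s) (logDeriv xi s) := by
  have h1 := (summable_pairTerm hs).hasSum.comp tendsto_zerosIn
  have h2 := tendsto_sum_zerosIn (xi_ne_zero_of_one_le_re hs.le)
  have h3 : ((fun u ↦ ∑ ρ ∈ u, pairTerm s ρ) ∘ fun N : ℕ ↦ zerosIn N) =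
      fun N : ℕ ↦ ∑ ρ ∈ zerosIn N, (mult ρ : ℂ) / (s - ρ) := by
    ext N
    have h4 := sum_zerosIn_reflZero N (fun ρ ↦ (mult ρ : ℂ) / (s - ρ))
    simp only [Function.comp_apply, pairTerm, mul_add, Finset.sum_add_distrib]
    have h5 : ∑ ρ ∈ zerosIn N, (mult ρ : ℂ) * (1 / 2 * (1 / (s - 1 + ρ))) =
        1 / 2 * ∑ ρ ∈ zerosIn N, (mult ρ : ℂ) / (s - ρ) := by
      rw [← h4, Finset.mul_sum]
      refine Finset.sum_congr rfl fun ρ _ ↦ ?_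
      rw [mult_reflZero, coe_reflZero, show s - (1 - (ρ : ℂ)) = s - 1 + ρ by ring]
      ring
    have h6 : ∑ ρ ∈ zerosIn N, (mult ρ : ℂ) * (1 / 2 * (1 / (s - ρ))) =
        1 / 2 * ∑ ρ ∈ zerosIn N, (mult ρ : ℂ) / (s - ρ) := by
      rw [Finset.mul_sum]
      refine Finset.sum_congr rfl fun ρ _ ↦ ?_
      ring
    rw [h5, h6]
    ring
  rw [h3] at h1
  rw [tendsto_nhds_unique h2 h1]
  exact (summable_pairTerm hs).hasSum

end PrimeBound

namespace PrimeBound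

open Filter Topology MeasureTheory Set Metric
open scoped ComplexConjugate

/-! ### The digamma function -/

lemma hasDerivAt_log_Gamma {x : ℝ} (hx : 0 < x) :
    HasDerivAt (Real.log ∘ Real.Gamma) (Complex.digamma x).re x ∧
      ((Complex.digamma x).re : ℂ) = Complex.digamma x := by
  have hne (m : ℕ) : (x : ℝ) ≠ -m := by
    have : (0 : ℝ) ≤ m := by positivity
    linarith
  have h1 := (Real.differentiableAt_Gamma hne).hasDerivAt
  have h2 : HasDerivAt (fun y : ℝ ↦ Complex.Gamma y) (deriv Complex.Gamma x) x := by
    refine HasDerivAt.comp_ofReal (DifferentiableAt.hasDerivAt ?_)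
    exact Complex.differentiableAt_Gamma _ fun m ↦ by exact_mod_cast hne m
  have h3 : HasDerivAt (fun y : ℝ ↦ Complex.Gamma y) ((deriv Real.Gamma x : ℝ) : ℂ) x := by
    simp_rw [Complex.Gamma_ofReal]
    exact h1.ofReal_comp
  have h4 := h2.unique h3
  have h5 : Complex.digamma x = ((deriv Real.Gamma x / Real.Gamma x : ℝ) : ℂ) := by
    rw [Complex.digamma_def, logDeriv_apply, h4, Complex.Gamma_ofReal]
    push_cast
    rfl
  rw [h5]
  refine ⟨?_, by simp⟩
  rw [Complex.ofReal_re]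
  exact h1.log (Real.Gamma_pos_of_pos hx).ne'

/-- The digamma function on the reals. -/
noncomputable def digammaR (x : ℝ) : ℝ := (Complex.digamma x).re

lemma digamma_ofReal {x : ℝ} (hx : 0 < x) : Complex.digamma x = digammaR x :=
  (hasDerivAt_log_Gamma hx).2.symm

lemma log_Gamma_add_one {x : ℝ} (hx : 0 < x) :
    (Real.log ∘ Real.Gamma) (x + 1) = log x + (Real.log ∘ Real.Gamma) x := by
  simp only [Function.comp]
  rw [Real.Gamma_add_one hx.ne', Real.log_mul hx.ne' (Real.Gamma_pos_of_pos hx).ne']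

lemma digammaR_le_log {x : ℝ} (hx : 0 < x) : digammaR x ≤ log x := by
  have h := Real.convexOn_log_Gamma.le_slope_of_hasDerivAt (x := x) (y := x + 1) hx
    (by simp; linarith) (by linarith) (hasDerivAt_log_Gamma hx).1
  rw [slope_def_field, log_Gamma_add_one hx] at h
  simpa [digammaR] using h

lemma log_le_digammaR_add_one {x : ℝ} (hx : 0 < x) : log x ≤ digammaR (x + 1) := by
  have hx1 : 0 < x + 1 := by linarith
  have h := Real.convexOn_log_Gamma.slope_le_of_hasDerivAt (x := x) (y := x + 1) hx
    hx1 (by linarith) (hasDerivAt_log_Gamma hx1).1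
  rw [slope_def_field, log_Gamma_add_one hx] at h
  simpa [digammaR] using h

lemma digamma_add_nat {z : ℂ} (hz : 0 < z.re) (n : ℕ) :
    Complex.digamma (z + n) = Complex.digamma z + ∑ k ∈ Finset.range n, 1 / (z + k) := by
  induction n with
  | zero => simp
  | succ n ih =>
    rw [Finset.sum_range_succ, ← add_assoc, ← ih]
    push_cast
    rw [← add_assoc, Complex.digamma_apply_add_one]
    · simp
    · intro m h
      have := congrArg Complex.re h
      simp at this
      have h1 : (0 : ℝ) ≤ m := by positivity
      have h2 : (0 : ℝ) ≤ n := by positivity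
      linarith

lemma digammaR_add_nat {x : ℝ} (hx : 0 < x) (n : ℕ) :
    digammaR (x + n) = digammaR x + ∑ k ∈ Finset.range n, 1 / (x + k) := by
  have := digamma_add_nat (z := x) (by simpa) n
  have h2 := digamma_ofReal (x := x + n) (by positivity)
  push_cast at h2
  rw [h2, digamma_ofReal hx] at this
  exact_mod_cast this

lemma summable_digamma_term {z : ℂ} (hz : 0 < z.re) :
    Summable fun k : ℕ ↦ 1 / ((k : ℂ) + 1) - 1 / (z + k) := by
  have hs : Summable fun k : ℕ ↦ ‖z - 1‖ / min z.re 1 * (1 / ((k : ℝ) + 1) ^ 2) := by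
    refine Summable.mul_left _ ?_
    have := (summable_nat_add_iff 1).mpr (Real.summable_one_div_nat_pow.mpr (one_lt_two))
    simpa using this
  refine Summable.of_norm_bounded hs fun k ↦ ?_
  have hm : 0 < min z.re 1 := lt_min hz one_pos
  have h1 : (k : ℂ) + 1 ≠ 0 := by exact_mod_cast k.succ_ne_zero
  have h3 : min z.re 1 * (k + 1) ≤ ‖z + k‖ := by
    calc min z.re 1 * ((k : ℝ) + 1) ≤ z.re + k := by
          have h4 := min_le_left z.re 1
          have h5 : min z.re 1 * (k : ℝ) ≤ 1 * k := by gcongr; exact min_le_right _ _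
          linarith
      _ = (z + k).re := by simp
      _ ≤ _ := Complex.re_le_norm _
  have hk : 0 < ‖z + k‖ := lt_of_lt_of_le (by positivity) h3
  have h2 : z + k ≠ 0 := norm_pos_iff.mp hk
  have heq : 1 / ((k : ℂ) + 1) - 1 / (z + k) = (z - 1) / ((k + 1) * (z + k)) := by
    field_simp
    ring
  rw [heq, norm_div, norm_mul, show ‖(k : ℂ) + 1‖ = (k : ℝ) + 1 by
    exact_mod_cast Complex.norm_natCast (k + 1), div_mul_div_comm, mul_one]
  have : 0 < (k : ℝ) + 1 := by positivity
  refine div_le_div_of_nonneg_left (norm_nonneg _) (by positivity) ?_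
  nlinarith

lemma digammaR_eq {x : ℝ} (hx : 0 < x) :
    HasSum (fun k : ℕ ↦ 1 / ((k : ℝ) + 1) - 1 / (x + k))
      (digammaR x + eulerMascheroniConstant) := by
  have hsum : Summable (fun k : ℕ ↦ 1 / ((k : ℝ) + 1) - 1 / (x + k)) := by
    rw [← Complex.summable_ofReal]
    simpa using summable_digamma_term (z := x) (by simpa)
  have h1 := hsum.hasSum.tendsto_sum_nat
  have h2 : Tendsto (fun n : ℕ ↦ (∑ k ∈ Finset.range n, 1 / ((k : ℝ) + 1)) - log n) atTop
      (𝓝 eulerMascheroniConstant) := by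
    have := Real.tendsto_harmonic_sub_log
    refine this.congr fun n ↦ ?_
    simp [harmonic]
  have h3 : Tendsto (fun n : ℕ ↦ digammaR (x + n) - log n) atTop (𝓝 0) := by
    have hl (a : ℝ) : Tendsto (fun n : ℕ ↦ log (n + a) - log n) atTop (𝓝 0) := by
      have := (Real.tendsto_log_comp_add_sub_log a).comp tendsto_natCast_atTop_atTop
      simpa [Function.comp_def] using this
    refine tendsto_of_tendsto_of_tendsto_of_le_of_le' (hl (x - 1)) (hl x) ?_ ?_
    · filter_upwards [eventually_ge_atTop 1] with n hn
      have hn' : (1 : ℝ) ≤ n := by exact_mod_cast hn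
      have := log_le_digammaR_add_one (x := n + (x - 1)) (by linarith)
      rw [show (n : ℝ) + (x - 1) + 1 = x + n by ring] at this
      linarith
    · refine .of_forall fun n ↦ ?_
      have := digammaR_le_log (x := x + n) (by positivity)
      rw [add_comm x] at this ⊢
      linarith
  have h4 := h2.sub h3 
  have h5 : (fun n : ℕ ↦ (∑ k ∈ Finset.range n, 1 / ((k : ℝ) + 1)) - log n -
      (digammaR (x + n) - log n)) =
      fun n ↦ ∑ k ∈ Finset.range n, (1 / ((k : ℝ) + 1) - 1 / (x + k)) - digammaR x := by
    ext n
    rw [digammaR_add_nat hx, Finset.sum_sub_distrib]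
    ring
  rw [h5] at h4
  have h6 := tendsto_nhds_unique (h1.sub_const _) h4
  convert hsum.hasSum using 1
  linarith

lemma differentiableOn_digamma : DifferentiableOn ℂ Complex.digamma {z | 0 < z.re} := by
  have ho : IsOpen {z : ℂ | 0 < z.re} := isOpen_lt continuous_const Complex.continuous_re
  have h : DifferentiableOn ℂ Complex.Gamma {z | 0 < z.re} := fun z hz ↦
    (Complex.differentiableAt_Gamma z fun m h ↦ by
      have := congrArg Complex.re h
      simp at this hz
      have h1 : (0 : ℝ) ≤ m := by positivity
      linarith).differentiableWithinAt
  exact (h.deriv ho).div h fun z hz ↦ Complex.Gamma_ne_zero_of_re_pos hz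

lemma differentiableOn_digammaSeries :
    DifferentiableOn ℂ (fun z ↦ ∑' k : ℕ, (1 / ((k : ℂ) + 1) - 1 / (z + k))) {z | 0 < z.re} := by
  intro z hz
  simp only [mem_ofPred_eq] at hz
  set ε := min (z.re / 2) 1
  set R := ‖z‖ + 1
  have hε : 0 < ε := lt_min (by linarith) one_pos
  set U : Set ℂ := {w | ε < w.re} ∩ {w | ‖w‖ < R}
  have hU : IsOpen U := (isOpen_lt continuous_const Complex.continuous_re).inter
    (isOpen_lt continuous_norm continuous_const)
  have hzU : z ∈ U := by
    refine ⟨?_, by simp [R]⟩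
    have h1 : ε ≤ z.re / 2 := min_le_left _ _
    show ε < z.re
    linarith
  have hs : Summable fun k : ℕ ↦ (R + 1) / ε * (1 / ((k : ℝ) + 1) ^ 2) := by
    refine Summable.mul_left _ ?_
    have := (summable_nat_add_iff 1).mpr (Real.summable_one_div_nat_pow.mpr (one_lt_two))
    simpa using this
  have hk (k : ℕ) (w : ℂ) (hw : w ∈ U) : ε * (k + 1) ≤ ‖w + k‖ := by
    calc ε * ((k : ℝ) + 1) ≤ w.re + k := by
          have h4 := hw.1
          simp only [mem_ofPred_eq] at h4
          have h5 : ε * (k : ℝ) ≤ 1 * k := by gcongr; exact min_le_right _ _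
          linarith
      _ = (w + k).re := by simp
      _ ≤ _ := Complex.re_le_norm _
  have hk0 (k : ℕ) (w : ℂ) (hw : w ∈ U) : w + k ≠ 0 :=
    norm_pos_iff.mp (lt_of_lt_of_le (by positivity) (hk k w hw))
  have hd : DifferentiableOn ℂ (fun z ↦ ∑' k : ℕ, (1 / ((k : ℂ) + 1) - 1 / (z + k))) U := by
    refine Complex.differentiableOn_tsum_of_summable_norm hs (fun k w hw ↦ ?_) hU
      fun k w hw ↦ ?_
    · have := hk0 k w hw
      have hd : DifferentiableAt ℂ (fun z : ℂ ↦ z + k) w := differentiableAt_id.add_const _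
      exact ((differentiableAt_const _).sub
        ((differentiableAt_const _).fun_div hd this)).differentiableWithinAt
    · have h1 : (k : ℂ) + 1 ≠ 0 := by exact_mod_cast k.succ_ne_zero
      have h2 := hk0 k w hw
      have heq : 1 / ((k : ℂ) + 1) - 1 / (w + k) = (w - 1) / ((k + 1) * (w + k)) := by
        field_simp
        ring
      rw [heq, norm_div, norm_mul, show ‖(k : ℂ) + 1‖ = (k : ℝ) + 1 by
        exact_mod_cast Complex.norm_natCast (k + 1), div_mul_div_comm, mul_one]
      have h3 : 0 < (k : ℝ) + 1 := by positivity
      have h4 := hk k w hw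
      have h5 : ‖w‖ < R := hw.2
      have h6 : ‖w - 1‖ ≤ R + 1 := (norm_sub_le _ _).trans (by simpa using h5.le)
      refine div_le_div₀ (by positivity) h6 (by positivity) ?_
      calc ε * ((k : ℝ) + 1) ^ 2 = (k + 1) * (ε * (k + 1)) := by ring
        _ ≤ _ := mul_le_mul_of_nonneg_left h4 h3.le
  exact (hd.differentiableAt (hU.mem_nhds hzU)).differentiableWithinAt

/-- The series for the digamma function. -/
lemma hasSum_digamma {z : ℂ} (hz : 0 < z.re) :
    HasSum (fun k : ℕ ↦ 1 / ((k : ℂ) + 1) - 1 / (z + k))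
      (Complex.digamma z + eulerMascheroniConstant) := by
  have ho : IsOpen {z : ℂ | 0 < z.re} := isOpen_lt continuous_const Complex.continuous_re
  have hc : IsPreconnected {z : ℂ | 0 < z.re} := (convex_halfSpace_re_gt 0).isPreconnected
  have h1 := differentiableOn_digammaSeries.analyticOnNhd ho
  have h2 := (differentiableOn_digamma.add_const (eulerMascheroniConstant : ℂ)).analyticOnNhd ho
  have hreal (x : ℝ) (hx : 0 < x) :
      ∑' k : ℕ, (1 / ((k : ℂ) + 1) - 1 / ((x : ℂ) + k)) =
        Complex.digamma x + eulerMascheroniConstant := by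
    rw [digamma_ofReal hx]
    have := (Complex.hasSum_ofReal.mpr (digammaR_eq hx)).tsum_eq
    simpa using this
  have hfreq : ∃ᶠ w : ℂ in 𝓝[≠] 1, ∑' k : ℕ, (1 / ((k : ℂ) + 1) - 1 / (w + k)) =
        Complex.digamma w + eulerMascheroniConstant := by
    have ht : Tendsto (fun n : ℕ ↦ ((1 + 1 / ((n : ℝ) + 1) : ℝ) : ℂ)) atTop (𝓝[≠] 1) := by
      refine tendsto_nhdsWithin_iff.mpr ⟨?_, .of_forall fun n ↦ ?_⟩
      · have := (tendsto_one_div_add_atTop_nhds_zero_nat (𝕜 := ℝ)).const_add 1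
        have := (Complex.continuous_ofReal.tendsto _).comp this
        simpa [Function.comp_def] using this
      · have h : (1 + 1 / ((n : ℝ) + 1) : ℝ) ≠ 1 := by
          have : 0 < 1 / ((n : ℝ) + 1) := by positivity
          linarith
        simp only [mem_compl_iff, mem_singleton_iff]
        exact_mod_cast h
    exact ht.frequently (.of_forall fun n ↦ hreal _ (by positivity))
  have h3 := h1.eqOn_of_preconnected_of_frequently_eq h2 hc (z₀ := 1) (by simp) hfreq hz
  have h4 := (summable_digamma_term hz).hasSum
  simp only at h3
  rwa [h3] at h4

end PrimeBound

namespace PrimeBound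

open Filter Topology MeasureTheory Set Metric
open scoped ComplexConjugate

lemma log_mul_of_re_pos {a b : ℂ} (ha : 0 < a.re) (hb : 0 < b.re) :
    Complex.log (a * b) = Complex.log a + Complex.log b := by
  have ha0 : a ≠ 0 := by rintro rfl; simp at ha
  have hb0 : b ≠ 0 := by rintro rfl; simp at hb
  rw [Complex.log_mul_eq_add_log_iff ha0 hb0]
  have h1 := abs_lt.mp (Complex.abs_arg_lt_pi_div_two_iff.mpr (.inl ha))
  have h2 := abs_lt.mp (Complex.abs_arg_lt_pi_div_two_iff.mpr (.inl hb))
  constructor <;> linarith [h1.1, h1.2, h2.1, h2.2]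

lemma norm_log_add_sub_log_sub_sub_le {w : ℂ} (hw : 0 < w.re) (hn : 1 ≤ ‖w‖) :
    ‖Complex.log (w + 1 / 2) - Complex.log (w - 1 / 2) - 1 / w‖ ≤ 1 / 6 / ‖w‖ ^ 3 := by
  have hw0 : w ≠ 0 := by rintro rfl; simp at hw
  set q : ℂ := 1 / (2 * w) with hq
  have hqn : ‖q‖ = 1 / (2 * ‖w‖) := by simp [hq]
  have hq2 : ‖q‖ ≤ 1 / 2 := by
    rw [hqn]
    exact one_div_le_one_div_of_le (by norm_num) (by linarith)
  have hre : |q.re| ≤ 1 / 2 := (Complex.abs_re_le_norm q).trans hq2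
  rw [abs_le] at hre
  have e1 : w + 1 / 2 = w * (1 + q) := by rw [hq]; field_simp
  have e2 : w - 1 / 2 = w * (1 + -q) := by rw [hq]; field_simp; ring
  have e3 : 1 / w = 2 * q := by rw [hq]; field_simp
  rw [e1, e2, e3, log_mul_of_re_pos hw (by simp; linarith),
    log_mul_of_re_pos hw (by simp; linarith)]
  have t1 := Complex.norm_log_sub_logTaylor_le 2 (z := q) (by linarith)
  have t2 := Complex.norm_log_sub_logTaylor_le 2 (z := -q) (by rw [norm_neg]; linarith)
  rw [norm_neg] at t2
  have hT : Complex.logTaylor (2 + 1) q - Complex.logTaylor (2 + 1) (-q) = 2 * q := by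
    simp [Complex.logTaylor, Finset.sum_range_succ]
    ring
  have hb : (1 - ‖q‖)⁻¹ ≤ 2 := by
    rw [inv_le_comm₀ (by linarith) (by norm_num)]
    linarith
  have h3 : ‖q‖ ^ (2 + 1) * (1 - ‖q‖)⁻¹ / ((2 : ℕ) + 1) ≤ 1 / 12 / ‖w‖ ^ 3 := by
    calc ‖q‖ ^ (2 + 1) * (1 - ‖q‖)⁻¹ / ((2 : ℕ) + 1) ≤ ‖q‖ ^ 3 * 2 / 3 := by
          push_cast
          have : ‖q‖ ^ 3 * (1 - ‖q‖)⁻¹ ≤ ‖q‖ ^ 3 * 2 := by gcongr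
          norm_num at this ⊢
          linarith
      _ = _ := by
          rw [hqn]
          have : ‖w‖ ≠ 0 := by positivity
          field_simp
          norm_num
  rw [← hT]
  calc _ = ‖(Complex.log (1 + q) - Complex.logTaylor (2 + 1) q) -
        (Complex.log (1 + -q) - Complex.logTaylor (2 + 1) (-q))‖ := by congr 1; ring
    _ ≤ _ := (norm_sub_le _ _).trans (add_le_add (t1.trans h3) (t2.trans h3))
    _ = _ := by ring

lemma tendsto_digamma_add_sub_log {z : ℂ} (hz : 0 < z.re) :
    Tendsto (fun n : ℕ ↦ Complex.digamma (z + n) - Complex.log n) atTop (𝓝 0) := by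
  have h1 := (hasSum_digamma hz).tendsto_sum_nat
  have h2 : Tendsto (fun n : ℕ ↦ (∑ k ∈ Finset.range n, 1 / ((k : ℂ) + 1)) - Complex.log n) atTop
      (𝓝 eulerMascheroniConstant) := by
    have := (Complex.continuous_ofReal.tendsto _).comp Real.tendsto_harmonic_sub_log
    refine this.congr fun n ↦ ?_
    simp [harmonic, Complex.natCast_log]
  have h3 := (h2.sub h1).const_add (Complex.digamma z)
  rw [show Complex.digamma z + ((eulerMascheroniConstant : ℂ) -
    (Complex.digamma z + eulerMascheroniConstant)) = 0 by ring] at h3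
  refine h3.congr fun n ↦ ?_
  rw [digamma_add_nat hz, Finset.sum_sub_distrib]
  ring

lemma tendsto_log_add_sub_log (a : ℂ) :
    Tendsto (fun n : ℕ ↦ Complex.log (n + a) - Complex.log n) atTop (𝓝 0) := by
  have h1 : Tendsto (fun n : ℕ ↦ 1 + a / n) atTop (𝓝 1) := by
    simpa using (tendsto_const_div_atTop_nhds_zero_nat a).const_add 1
  have h2 := (continuousAt_clog (x := 1) (by simp)).tendsto.comp h1
  rw [Complex.log_one] at h2
  have h3 : ∀ᶠ n : ℕ in atTop, 0 < (1 + a / n).re :=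
    (Complex.continuous_re.tendsto _ |>.comp h1).eventually (lt_mem_nhds (by simp))
  refine h2.congr' ?_
  filter_upwards [h3, eventually_ge_atTop 1] with n hn hn1
  have hn0 : (n : ℂ) ≠ 0 := by exact_mod_cast (by omega : n ≠ 0)
  have : (n : ℂ) + a = n * (1 + a / n) := by field_simp
  rw [this, log_mul_of_re_pos (by simp; omega) hn]
  simp

lemma sum_one_div_add_cube_le {y : ℝ} (hy : 1 / 2 < y) (n : ℕ) :
    ∑ k ∈ Finset.range n, 1 / (y + k) ^ 3 ≤ 1 / (2 * (y - 1 / 2) ^ 2) := by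
  have h : ∑ k ∈ Finset.range n, 1 / (y + k) ^ 3 ≤
      1 / (2 * (y - 1 / 2) ^ 2) - 1 / (2 * (y + n - 1 / 2) ^ 2) := by
    induction n with
    | zero => simp
    | succ n ih =>
      rw [Finset.sum_range_succ]
      have hn : (0 : ℝ) ≤ n := by positivity
      set t := y + n with ht
      have ht2 : 1 / 2 < t := by linarith
      have hp : 0 < t - 1 / 2 := by linarith
      have key : 1 / t ^ 3 ≤ 1 / (2 * (t - 1 / 2) ^ 2) - 1 / (2 * (t + 1 / 2) ^ 2) := by
        rw [div_sub_div _ _ (by positivity) (by positivity),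
          div_le_div_iff₀ (by positivity) (by positivity)]
        nlinarith [sq_nonneg t, pow_pos (by linarith : 0 < t) 2]
      push_cast
      rw [show y + ((n : ℝ) + 1) - 1 / 2 = t + 1 / 2 by rw [ht]; ring]
      linarith
  have hn : (0 : ℝ) ≤ n := by positivity
  have : 0 ≤ 1 / (2 * (y + n - 1 / 2) ^ 2) := by positivity
  linarith

lemma norm_digamma_sub_log_le {z : ℂ} {c y : ℝ} (hz : 1 / 2 < z.re) (hc : 0 < c) (hy : 1 / 2 < y)
    (h1 : ∀ k : ℕ, 1 ≤ ‖z + k‖) (h2 : ∀ k : ℕ, c * (y + k) ≤ ‖z + k‖) :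
    ‖Complex.digamma z - Complex.log (z - 1 / 2)‖ ≤ 1 / (12 * c ^ 3 * (y - 1 / 2) ^ 2) := by
  have hz0 : 0 < z.re := by linarith
  have hD : Tendsto (fun n : ℕ ↦ Complex.digamma (z + n) - Complex.log (n + (z - 1 / 2)))
      atTop (𝓝 0) := by
    have := (tendsto_digamma_add_sub_log hz0).sub (tendsto_log_add_sub_log (z - 1 / 2))
    simpa using this
  have hS (n : ℕ) : Complex.digamma (z + n) - Complex.log (n + (z - 1 / 2)) =
      Complex.digamma z - Complex.log (z - 1 / 2) - ∑ k ∈ Finset.range n,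
        (Complex.log (z + k + 1 / 2) - Complex.log (z + k - 1 / 2) - 1 / (z + k)) := by
    rw [digamma_add_nat hz0, Finset.sum_sub_distrib]
    have := Finset.sum_range_sub (fun k : ℕ ↦ Complex.log (z + k - 1 / 2)) n
    have h4 : ∑ k ∈ Finset.range n, (Complex.log (z + k + 1 / 2) - Complex.log (z + k - 1 / 2)) =
        Complex.log (z + n - 1 / 2) - Complex.log (z - 1 / 2) := by
      have h5 : Complex.log (z - 1 / 2) = Complex.log (z + (0 : ℕ) - 1 / 2) := by simp
      rw [h5, ← this]
      refine Finset.sum_congr rfl fun k _ ↦ ?_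
      rw [show z + ((k + 1 : ℕ) : ℂ) - 1 / 2 = z + k + 1 / 2 by push_cast; ring]
    rw [h4, show (n : ℂ) + (z - 1 / 2) = z + n - 1 / 2 by ring]
    ring
  have hb (n : ℕ) : ‖∑ k ∈ Finset.range n,
      (Complex.log (z + k + 1 / 2) - Complex.log (z + k - 1 / 2) - 1 / (z + k))‖ ≤
      1 / (12 * c ^ 3 * (y - 1 / 2) ^ 2) := by
    calc _ ≤ ∑ k ∈ Finset.range n, 1 / (6 * c ^ 3) * (1 / (y + k) ^ 3) := by
          refine norm_sum_le_of_le _ fun k _ ↦ ?_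
          refine (norm_log_add_sub_log_sub_sub_le (by simp; positivity) (h1 k)).trans ?_
          have hp : 0 < c * (y + k) := by positivity
          calc 1 / 6 / ‖z + k‖ ^ 3 ≤ 1 / 6 / (c * (y + k)) ^ 3 := by
                gcongr
                exact h2 k
            _ = _ := by field_simp
      _ ≤ 1 / (6 * c ^ 3) * (1 / (2 * (y - 1 / 2) ^ 2)) := by
          rw [← Finset.mul_sum]
          gcongr
          exact sum_one_div_add_cube_le hy n
      _ = _ := by rw [div_mul_div_comm]; congr 1 <;> ring
  have hlim : Tendsto (fun n : ℕ ↦ ∑ k ∈ Finset.range n,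
      (Complex.log (z + k + 1 / 2) - Complex.log (z + k - 1 / 2) - 1 / (z + k))) atTop
      (𝓝 (Complex.digamma z - Complex.log (z - 1 / 2))) := by
    have := hD.const_sub (Complex.digamma z - Complex.log (z - 1 / 2))
    rw [sub_zero] at this
    refine this.congr fun n ↦ ?_
    rw [hS]
    ring
  exact le_of_tendsto hlim.norm (.of_forall hb)

lemma abs_digammaR_sub_log_le {x : ℝ} (hx : 1 ≤ x) :
    |digammaR x - log (x - 1 / 2)| ≤ 1 / (12 * (x - 1 / 2) ^ 2) := by
  have h := norm_digamma_sub_log_le (z := x) (c := 1) (y := x) (by simp; linarith) one_pos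
    (by linarith) (fun k ↦ ?_) fun k ↦ ?_
  · rw [digamma_ofReal (by linarith), show (x : ℂ) - 1 / 2 = ((x - 1 / 2 : ℝ) : ℂ) by push_cast; rfl,
      ← Complex.ofReal_log (by linarith), ← Complex.ofReal_sub, Complex.norm_real] at h
    simpa using h
  · refine le_trans ?_ (Complex.re_le_norm _)
    simp
    have : (0 : ℝ) ≤ k := by positivity
    linarith
  · refine le_trans ?_ (Complex.re_le_norm _)
    simp

/-- Asymptotics of the real part of the digamma function high up in the half plane. -/
lemma abs_re_digamma_sub_log_le {x t : ℝ} (hx : 1 ≤ x) (ht : 1 ≤ t) :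
    |(Complex.digamma (x + t * Complex.I)).re - log ((x - 1 / 2) ^ 2 + t ^ 2) / 2| ≤
      1 / (4 * t ^ 2) := by
  have hn (k : ℕ) : ‖(x + t * Complex.I : ℂ) + k‖ ^ 2 = (x + k) ^ 2 + t ^ 2 := by
    rw [Complex.sq_norm, Complex.normSq_apply]
    simp
    ring
  have h := norm_digamma_sub_log_le (z := x + t * Complex.I) (c := 7 / 10) (y := x + t)
    (by simp; linarith) (by norm_num) (by linarith) (fun k ↦ ?_) fun k ↦ ?_
  · have h2 := (Complex.abs_re_le_norm _).trans h
    rw [Complex.sub_re, Complex.log_re] at h2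
    have h3 : Real.log ‖(x + t * Complex.I : ℂ) - 1 / 2‖ =
        log ((x - 1 / 2) ^ 2 + t ^ 2) / 2 := by
      have : (x - 1 / 2) ^ 2 + t ^ 2 = ‖(x + t * Complex.I : ℂ) - 1 / 2‖ ^ 2 := by
        rw [Complex.sq_norm, Complex.normSq_apply]
        simp
        ring
      rw [this, Real.log_pow]
      push_cast
      ring
    rw [h3] at h2
    refine h2.trans ?_
    apply one_div_le_one_div_of_le (by positivity)
    have : t ^ 2 ≤ (x + t - 1 / 2) ^ 2 := by gcongr; linarith
    nlinarith
  · refine le_trans ?_ (Complex.re_le_norm _)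
    simp
    have : (0 : ℝ) ≤ k := by positivity
    linarith
  · have hk : (0 : ℝ) ≤ k := by positivity
    refine abs_le_of_sq_le_sq' ?_ (norm_nonneg _) |>.2
    rw [hn]
    nlinarith [sq_nonneg (x + k - t), sq_nonneg (x + k + t)]

end PrimeBound

namespace PrimeBound

open Filter Topology MeasureTheory Set Metric
open scoped ComplexConjugate
open scoped ArithmeticFunction.vonMangoldt

/-! ### The logarithmic derivative of the zeta function -/

/-- The Dirichlet series of the von Mangoldt function. -/
noncomputable def zetaLog (s : ℂ) : ℂ := LSeries (fun n ↦ (Λ n : ℂ)) s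

lemma logDeriv_mul_id_Gamma_half {s : ℂ} (hs : 1 < s.re) :
    logDeriv (fun s ↦ s * Complex.Gammaℝ s) s =
      (1 / 2) * Complex.digamma (s / 2 + 1) - (1 / 2) * Real.log π := by
  have hs0 : s ≠ 0 := by rintro rfl; norm_num at hs
  have hne (m : ℕ) : s / 2 ≠ -m := by
    intro h
    have := congrArg Complex.re h
    simp at this
    have h1 : (0 : ℝ) ≤ m := by positivity
    linarith
  have hG : DifferentiableAt ℂ (fun s : ℂ ↦ Complex.Gamma (s / 2)) s :=
    (Complex.differentiableAt_Gamma _ hne).comp s (differentiableAt_id.div_const 2)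
  have hG0 : Complex.Gamma (s / 2) ≠ 0 :=
    Complex.Gamma_ne_zero_of_re_pos (by simp; linarith)
  have hpi : (π : ℂ) ≠ 0 := by exact_mod_cast Real.pi_ne_zero
  have hP : HasDerivAt (fun s : ℂ ↦ (π : ℂ) ^ (-s / 2))
      ((π : ℂ) ^ (-s / 2) * Complex.log π * (-1 / 2)) s :=
    ((hasDerivAt_id s).neg.div_const 2).const_cpow (.inl hpi)
  have hP0 : (π : ℂ) ^ (-s / 2) ≠ 0 := by simp [Complex.cpow_eq_zero_iff, hpi]
  have e1 : logDeriv (fun s ↦ s * Complex.Gammaℝ s) s =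
      1 / s + (-(1 / 2) * Complex.log π + (1 / 2) * Complex.digamma (s / 2)) := by
    have : (fun s ↦ s * Complex.Gammaℝ s) =
        fun s ↦ s * ((π : ℂ) ^ (-s / 2) * Complex.Gamma (s / 2)) := rfl
    rw [this, logDeriv_mul (f := fun s ↦ s)
      (g := fun s ↦ (π : ℂ) ^ (-s / 2) * Complex.Gamma (s / 2)) s hs0 (mul_ne_zero hP0 hG0) differentiableAt_id
      (hP.differentiableAt.mul hG), logDeriv_mul (f := fun s ↦ (π : ℂ) ^ (-s / 2))
        (g := fun s ↦ Complex.Gamma (s / 2)) s hP0 hG0 hP.differentiableAt hG]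
    congr 1
    · simp [logDeriv_apply]
    · congr 1
      · rw [logDeriv_apply, hP.deriv]
        field_simp
      · have : (fun s : ℂ ↦ Complex.Gamma (s / 2)) = Complex.Gamma ∘ fun s ↦ s / 2 := rfl
        have hd : HasDerivAt (fun s : ℂ ↦ s / 2) (1 / 2) s := (hasDerivAt_id s).div_const 2
        rw [this, logDeriv_comp (g := fun s : ℂ ↦ s / 2)
          (Complex.differentiableAt_Gamma _ hne) hd.differentiableAt,
          Complex.digamma_def, hd.deriv, mul_comm]
  rw [e1, Complex.digamma_apply_add_one _ hne, Complex.ofReal_log Real.pi_pos.le]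
  field_simp
  ring

lemma zetaLog_eq {s : ℂ} (hs : 1 < s.re) :
    zetaLog s = 1 / (s - 1) + (1 / 2) * Complex.digamma (s / 2 + 1) - (1 / 2) * Real.log π -
      logDeriv xi s := by
  have hs0 : s ≠ 0 := by rintro rfl; norm_num at hs
  have hs1 : s ≠ 1 := by rintro rfl; norm_num at hs
  have hs1' : s - 1 ≠ 0 := sub_ne_zero.mpr hs1
  have hG0 : Complex.Gammaℝ s ≠ 0 := Complex.Gammaℝ_ne_zero_of_re_pos (by linarith)
  have hGd : DifferentiableAt ℂ Complex.Gammaℝ s := by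
    have := Complex.differentiable_Gammaℝ_inv s |>.inv (inv_ne_zero hG0)
    convert! this using 1
    ext w
    simp
  have hz0 : riemannZeta s ≠ 0 := riemannZeta_ne_zero_of_one_le_re hs.le
  have hzd := differentiableAt_riemannZeta hs1
  have hev : xi =ᶠ[𝓝 s] fun s ↦ (s * Complex.Gammaℝ s) * ((s - 1) * riemannZeta s) := by
    have ho : IsOpen {s : ℂ | 1 < s.re} := isOpen_lt continuous_const Complex.continuous_re
    filter_upwards [ho.mem_nhds hs] with w hw
    have hw' : 1 < w.re := hw
    rw [xi_eq_riemannZeta (by linarith) (by rintro rfl; norm_num at hw')]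
    ring
  have h1 : logDeriv xi s =
      logDeriv (fun s ↦ (s * Complex.Gammaℝ s) * ((s - 1) * riemannZeta s)) s := by
    rw [logDeriv_apply, logDeriv_apply, hev.deriv_eq, hev.eq_of_nhds]
  rw [h1, logDeriv_mul (f := fun s ↦ s * Complex.Gammaℝ s)
    (g := fun s ↦ (s - 1) * riemannZeta s) s (mul_ne_zero hs0 hG0) (mul_ne_zero hs1' hz0)
    (differentiableAt_id.mul hGd) ((differentiableAt_id.sub_const 1).mul hzd),
    logDeriv_mul (f := fun s ↦ s - 1) (g := riemannZeta) s hs1' hz0 (differentiableAt_id.sub_const 1) hzd,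
    logDeriv_mul_id_Gamma_half hs, zetaLog,
    ArithmeticFunction.LSeries_vonMangoldt_eq_deriv_riemannZeta_div hs]
  simp only [logDeriv_apply]
  have : deriv (fun s : ℂ ↦ s - 1) s = 1 := by simp
  rw [this]
  ring

lemma hasSum_zetaLog {s : ℂ} (hs : 1 < s.re) :
    HasSum (fun n : ℕ ↦ (Λ n : ℂ) * Complex.exp (-(s * Real.log n))) (zetaLog s) := by
  have h := (ArithmeticFunction.LSeriesSummable_vonMangoldt hs).LSeriesHasSum
  unfold LSeriesHasSum at h
  change HasSum _ (zetaLog s) at h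
  convert h using 1
  ext n
  symm
  rcases eq_or_ne n 0 with rfl | hn
  · simp
  · have hn' : (n : ℂ) ≠ 0 := by exact_mod_cast hn
    rw [LSeries.term_of_ne_zero hn, Complex.exp_neg, Complex.cpow_def_of_ne_zero hn',
      div_eq_mul_inv, mul_comm s, ← Complex.natCast_log]

lemma hasSum_zetaLog_re {σ : ℝ} (t : ℝ) (hσ : 1 < σ) :
    HasSum (fun n : ℕ ↦ Λ n * (exp (-(σ * log n)) * cos (t * log n)))
      (zetaLog (σ + t * Complex.I)).re := by
  have h := Complex.hasSum_re (hasSum_zetaLog (s := σ + t * Complex.I) (by simpa))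
  convert h using 1
  ext n
  symm
  have e : -((σ + t * Complex.I) * (log n : ℂ)) =
      ((-(σ * log n) : ℝ) : ℂ) + ((-(t * log n) : ℝ) : ℂ) * Complex.I := by
    push_cast
    ring
  rw [Complex.re_ofReal_mul, e, Complex.exp_re, Complex.add_re, Complex.add_im,
    Complex.re_ofReal_mul, Complex.im_ofReal_mul, Complex.ofReal_re, Complex.ofReal_im]
  simp

lemma hasSum_zetaLog_ofReal {σ : ℝ} (hσ : 1 < σ) :
    HasSum (fun n : ℕ ↦ Λ n * exp (-(σ * log n))) (zetaLog σ).re := by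
  simpa using hasSum_zetaLog_re 0 hσ

end PrimeBound

namespace PrimeBound

open Filter Topology MeasureTheory Set Metric
open scoped ComplexConjugate
open scoped ArithmeticFunction.vonMangoldt

/-! ### Sums over the zeros -/

lemma logDeriv_xi_ofReal_re {T : ℝ} (hT : 1 < T) :
    (logDeriv xi T).re = 1 / (T - 1) + digammaR (T / 2 + 1) / 2 - log π / 2 - (zetaLog T).re := by
  have h := zetaLog_eq (s := T) (by simpa)
  have h2 := digamma_ofReal (x := T / 2 + 1) (by linarith)
  push_cast at h2
  rw [h2] at h
  have h3 : logDeriv xi T = ((1 / (T - 1) + digammaR (T / 2 + 1) / 2 - log π / 2 : ℝ) : ℂ) -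
      zetaLog T := by
    rw [h]
    push_cast
    ring
  rw [h3, Complex.sub_re, Complex.ofReal_re]

lemma zetaLog_ofReal_re_nonneg {T : ℝ} (hT : 1 < T) : 0 ≤ (zetaLog T).re :=
  (hasSum_zetaLog_ofReal hT).nonneg fun n ↦
    mul_nonneg ArithmeticFunction.vonMangoldt_nonneg (exp_pos _).le

lemma logDeriv_xi_ofReal_re_le {T : ℝ} (hT : 1 < T) :
    (logDeriv xi T).re ≤ 1 / (T - 1) + log ((T + 2) / (2 * π)) / 2 := by
  have h1 := digammaR_le_log (x := T / 2 + 1) (by linarith)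
  have h2 := zetaLog_ofReal_re_nonneg hT
  have h3 : log ((T + 2) / (2 * π)) = log (T / 2 + 1) - log π := by
    rw [← Real.log_div (by linarith) Real.pi_ne_zero]
    congr 1
    field_simp
  rw [logDeriv_xi_ofReal_re hT, h3]
  linarith

lemma log_ge_of_pow_le {x : ℝ} (hx : 0 < x) (a b : ℕ) (hb : 0 < b) (h : (2 : ℝ) ^ a ≤ x ^ b) :
    (a : ℝ) / b * log 2 ≤ log x := by
  have := Real.log_le_log (by positivity) h
  rw [Real.log_pow, Real.log_pow] at this
  have hb' : (0 : ℝ) < b := by exact_mod_cast hb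
  rw [div_mul_eq_mul_div, div_le_iff₀ hb']
  linarith

lemma log_le_of_pow_le {x : ℝ} (hx : 0 < x) (a b : ℕ) (hb : 0 < b) (h : x ^ b ≤ (2 : ℝ) ^ a) :
    log x ≤ (a : ℝ) / b * log 2 := by
  have := Real.log_le_log (by positivity) h
  rw [Real.log_pow, Real.log_pow] at this
  have hb' : (0 : ℝ) < b := by exact_mod_cast hb
  rw [div_mul_eq_mul_div, le_div_iff₀ hb']
  linarith

lemma zetaLog_three_re_ge : 0.1613 ≤ (zetaLog (3 : ℝ)).re := by
  have h := sum_le_hasSum ({2, 3, 4, 5, 7, 8, 9, 11} : Finset ℕ)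
    (fun n _ ↦ mul_nonneg ArithmeticFunction.vonMangoldt_nonneg (exp_pos _).le)
    (hasSum_zetaLog_ofReal (σ := 3) (by norm_num))
  have he (n : ℕ) (hn : 0 < n) : exp (-(3 * log n)) = 1 / (n : ℝ) ^ 3 := by
    rw [show -(3 * log n) = log (1 / (n : ℝ) ^ 3) by
      rw [one_div, Real.log_inv, Real.log_pow]; norm_num, Real.exp_log (by positivity)]
  have h4 : Λ 4 = log 2 := by
    rw [show 4 = 2 ^ 2 by norm_num, ArithmeticFunction.vonMangoldt_apply_pow two_ne_zero,
      ArithmeticFunction.vonMangoldt_apply_prime Nat.prime_two]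
    norm_num
  have h8 : Λ 8 = log 2 := by
    rw [show 8 = 2 ^ 3 by norm_num, ArithmeticFunction.vonMangoldt_apply_pow three_ne_zero,
      ArithmeticFunction.vonMangoldt_apply_prime Nat.prime_two]
    norm_num
  have h9 : Λ 9 = log 3 := by
    rw [show 9 = 3 ^ 2 by norm_num, ArithmeticFunction.vonMangoldt_apply_pow two_ne_zero,
      ArithmeticFunction.vonMangoldt_apply_prime Nat.prime_three]
    norm_num
  have hp (p : ℕ) (hp : p.Prime) : Λ p = log p := ArithmeticFunction.vonMangoldt_apply_prime hp
  simp only [Finset.mem_insert, Finset.mem_singleton, Nat.reduceEqDiff, or_self,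
    not_false_eq_true, Finset.sum_insert, Finset.sum_singleton] at h
  rw [he 2 (by norm_num), he 3 (by norm_num), he 4 (by norm_num), he 5 (by norm_num),
    he 7 (by norm_num), he 8 (by norm_num), he 9 (by norm_num), he 11 (by norm_num), h4, h8, h9,
    hp 2 (by norm_num), hp 3 (by norm_num), hp 5 (by norm_num), hp 7 (by norm_num),
    hp 11 (by norm_num)] at h
  have l2 := Real.log_two_gt_d9
  have l3 := log_ge_of_pow_le (x := 3) (by norm_num) 19 12 (by norm_num) (by norm_num)
  have l5 := log_ge_of_pow_le (x := 5) (by norm_num) 65 28 (by norm_num) (by norm_num)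
  have l7 := log_ge_of_pow_le (x := 7) (by norm_num) 14 5 (by norm_num) (by norm_num)
  have l11 := log_ge_of_pow_le (x := 11) (by norm_num) 38 11 (by norm_num) (by norm_num)
  norm_num at h l3 l5 l7 l11 ⊢
  linarith

lemma log_pi_ge : 1.1436 ≤ log π := by
  have h1 := log_ge_of_pow_le (x := 3.14) (by norm_num) 33 20 (by norm_num) (by norm_num)
  have h2 := Real.log_le_log (by norm_num) Real.pi_gt_d2.le
  have l2 := Real.log_two_gt_d9
  norm_num at h1 h2 ⊢
  linarith

lemma logDeriv_xi_three_re_le : (logDeriv xi (3 : ℝ)).re ≤ 0.119 := by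
  rw [logDeriv_xi_ofReal_re (by norm_num)]
  have h1 := zetaLog_three_re_ge
  have h2 := log_pi_ge
  have h3 := digammaR_add_nat (x := 3 / 2 + 1) (by norm_num) 8
  have h4 := (abs_le.mp (abs_digammaR_sub_log_le (x := 3 / 2 + 1 + (8 : ℕ)) (by norm_num))).2
  have h5 := log_le_of_pow_le (x := 10) (by norm_num) 103 31 (by norm_num) (by norm_num)
  have l2 := Real.log_two_lt_d9
  simp only [Finset.sum_range_succ, Finset.sum_range_zero] at h3
  norm_num at h1 h2 h3 h4 h5 ⊢
  linarith

lemma XiZero.re_one_div_sub_nonneg {T : ℝ} (hT : 1 ≤ T) (ρ : XiZero) :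
    0 ≤ (1 / ((T : ℂ) - ρ)).re := by
  rw [re_one_div_sub]
  have := ρ.re_lt_one
  have : 0 ≤ (T : ℂ).re - (ρ : ℂ).re := by simp; linarith
  positivity

lemma sum_re_one_div_sub_le (S : Finset XiZero) {T : ℝ} (hT : 1 ≤ T) :
    ∑ ρ ∈ S, (1 / ((T : ℂ) - ρ)).re ≤ (logDeriv xi T).re := by
  have h := sum_le_hasSum S (fun ρ _ ↦ mul_nonneg (mult_nonneg ρ) (ρ.re_one_div_sub_nonneg hT))
    (hasSum_re_one_div_sub (s := T) (by simpa))
  refine le_trans (Finset.sum_le_sum fun ρ _ ↦ ?_) h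
  exact le_mul_of_one_le_left (ρ.re_one_div_sub_nonneg hT) (one_le_mult ρ)

lemma re_one_div_three_sub_add_ge (ρ : XiZero) :
    5 / (9 + (ρ : ℂ).im ^ 2) ≤
      (1 / (((3 : ℝ) : ℂ) - ρ)).re + (1 / (((3 : ℝ) : ℂ) - reflZero ρ)).re := by
  rw [re_one_div_sub, re_one_div_sub]
  have h0 := ρ.re_pos
  have h1 := ρ.re_lt_one
  simp only [coe_reflZero, Complex.ofReal_re, Complex.ofReal_im, Complex.sub_re, Complex.sub_im,
    Complex.one_re, Complex.one_im]
  set β := (ρ : ℂ).re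
  set γ := (ρ : ℂ).im
  have e1 : (3 - β) / (9 + γ ^ 2) ≤ (3 - β) / ((3 - β) ^ 2 + (0 - γ) ^ 2) := by
    refine div_le_div_of_nonneg_left (by linarith) (by nlinarith [sq_nonneg γ]) (by nlinarith)
  have e2 : (3 - (1 - β)) / (9 + γ ^ 2) ≤
      (3 - (1 - β)) / ((3 - (1 - β)) ^ 2 + (0 - (0 - γ)) ^ 2) := by
    refine div_le_div_of_nonneg_left (by linarith) (by nlinarith [sq_nonneg γ]) (by nlinarith)
  calc 5 / (9 + γ ^ 2) = (3 - β) / (9 + γ ^ 2) + (3 - (1 - β)) / (9 + γ ^ 2) := by ring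
    _ ≤ _ := add_le_add e1 e2

/-- Every zero has imaginary part at least `√32` in absolute value. -/
lemma XiZero.sq_im_ge (ρ : XiZero) : 32 ≤ (ρ : ℂ).im ^ 2 := by
  have h3 := logDeriv_xi_three_re_le
  have hp := re_one_div_three_sub_add_ge ρ
  by_cases h : reflZero ρ = ρ
  · have h1 : (1 - ρ : ℂ) = ρ := by rw [← coe_reflZero, h]
    have h2 : (ρ : ℂ).im = 0 := by
      have := congrArg Complex.im h1
      simp at this
      linarith
    have := sum_re_one_div_sub_le {ρ} (T := 3) (by norm_num)
    rw [Finset.sum_singleton] at this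
    rw [h, h2] at hp
    norm_num at hp this h3
    linarith
  · have := sum_re_one_div_sub_le {ρ, reflZero ρ} (T := 3) (by norm_num)
    rw [Finset.sum_pair (Ne.symm h)] at this
    have h4 : 5 / (9 + (ρ : ℂ).im ^ 2) ≤ 0.119 := by linarith
    rw [div_le_iff₀ (by positivity)] at h4
    norm_num at h4
    linarith

lemma XiZero.im_ne_zero (ρ : XiZero) : (ρ : ℂ).im ≠ 0 := by
  intro h
  have := ρ.sq_im_ge
  rw [h] at this
  norm_num at this

/-- The four zeros attached to a zero off the critical line are distinct. -/
lemma XiZero.four_distinct (ρ : XiZero) (h : (ρ : ℂ).re ≠ 1 / 2) :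
    ρ ∉ ({reflZero ρ, conjZero ρ, conjZero (reflZero ρ)} : Finset XiZero) ∧
    reflZero ρ ∉ ({conjZero ρ, conjZero (reflZero ρ)} : Finset XiZero) ∧
    conjZero ρ ∉ ({conjZero (reflZero ρ)} : Finset XiZero) := by
  have hi := ρ.im_ne_zero
  have a1 : ρ ≠ reflZero ρ := fun h ↦ hi <| by
    have := congrArg (fun z : XiZero ↦ (z : ℂ).im) h
    simp at this
    linarith
  have a2 : ρ ≠ conjZero ρ := fun h ↦ hi <| by
    have := congrArg (fun z : XiZero ↦ (z : ℂ).im) h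
    simp at this
    linarith
  have a3 : ρ ≠ conjZero (reflZero ρ) := fun h' ↦ h <| by
    have := congrArg (fun z : XiZero ↦ (z : ℂ).re) h'
    simp at this
    linarith
  have a4 : reflZero ρ ≠ conjZero ρ := fun h' ↦ h <| by
    have := congrArg (fun z : XiZero ↦ (z : ℂ).re) h'
    simp at this
    linarith
  have a5 : reflZero ρ ≠ conjZero (reflZero ρ) := fun h ↦ hi <| by
    have := congrArg (fun z : XiZero ↦ (z : ℂ).im) h
    simp at this
    linarith
  have a6 : conjZero ρ ≠ conjZero (reflZero ρ) := fun h ↦ a1 (conjZero.injective h)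
  simp only [Finset.mem_insert, Finset.mem_singleton, not_or]
  exact ⟨⟨a1, a2, a3⟩, ⟨a4, a5⟩, a6⟩

/-- Zeros off the critical line have imaginary part at least `√75`. -/
lemma XiZero.sq_im_ge_of_re_ne (ρ : XiZero) (h : (ρ : ℂ).re ≠ 1 / 2) : 75 ≤ (ρ : ℂ).im ^ 2 := by
  have h3 := logDeriv_xi_three_re_le
  have hp := re_one_div_three_sub_add_ge ρ
  have hq := re_one_div_three_sub_add_ge (conjZero ρ)
  obtain ⟨m1, m2, m3⟩ := ρ.four_distinct h
  have := sum_re_one_div_sub_le {ρ, reflZero ρ, conjZero ρ, conjZero (reflZero ρ)} (T := 3)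
    (by norm_num)
  rw [Finset.sum_insert m1, Finset.sum_insert m2, Finset.sum_insert m3,
    Finset.sum_singleton] at this
  have e : conjZero (reflZero ρ) = reflZero (conjZero ρ) := by
    ext
    simp
  have e2 : ((conjZero ρ : XiZero) : ℂ).im ^ 2 = (ρ : ℂ).im ^ 2 := by simp
  rw [e] at this
  rw [e2] at hq
  have h4 : 5 / (9 + (ρ : ℂ).im ^ 2) ≤ 0.119 / 2 := by linarith
  rw [div_le_iff₀ (by positivity)] at h4
  norm_num at h4
  linarith

end PrimeBound

namespace PrimeBound

open Filter Topology MeasureTheory Set Metric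
open scoped ComplexConjugate
open scoped ArithmeticFunction.vonMangoldt

/-! ### The kernel for the zero-free region -/

lemma kernel_left_eq {b Y : ℝ} (hb : 0 < b) (hY : 0 ≤ Y) :
    151 / 16 * (6 * b / ((6 * b) ^ 2 + Y)) - 57 / 4 * (8 * b / ((8 * b) ^ 2 + Y)) +
      93 / 16 * (10 * b / ((10 * b) ^ 2 + Y)) =
    b * (85920 * b ^ 4 - 405 * b ^ 2 * Y + 3 / 4 * Y ^ 2) /
      ((36 * b ^ 2 + Y) * (64 * b ^ 2 + Y) * (100 * b ^ 2 + Y)) := by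
  have h1 : (6 * b) ^ 2 + Y ≠ 0 := by positivity
  have h2 : (8 * b) ^ 2 + Y ≠ 0 := by positivity
  have h3 : (10 * b) ^ 2 + Y ≠ 0 := by positivity
  have h4 : 36 * b ^ 2 + Y ≠ 0 := by positivity
  have h5 : 64 * b ^ 2 + Y ≠ 0 := by positivity
  have h6 : 100 * b ^ 2 + Y ≠ 0 := by positivity
  rw [show 36 * b ^ 2 = (6 * b) ^ 2 by ring, show 64 * b ^ 2 = (8 * b) ^ 2 by ring,
    show 100 * b ^ 2 = (10 * b) ^ 2 by ring]
  field_simp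
  ring

lemma kernel_left_nonneg {b Y : ℝ} (hb : 0 < b) (hY : 0 ≤ Y) :
    0 ≤ b * (85920 * b ^ 4 - 405 * b ^ 2 * Y + 3 / 4 * Y ^ 2) /
      ((36 * b ^ 2 + Y) * (64 * b ^ 2 + Y) * (100 * b ^ 2 + Y)) := by
  have : 0 ≤ 85920 * b ^ 4 - 405 * b ^ 2 * Y + 3 / 4 * Y ^ 2 := by
    nlinarith [sq_nonneg (Y - 270 * b ^ 2), sq_nonneg (b ^ 2)]
  positivity

lemma kernel_left_ge {b Y : ℝ} (hb : 0 < b) (hb1 : b ≤ 1 / 10) (hY : 0 ≤ Y)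
    (hYb : Y ≤ 12 / 10 * b) :
    2 * b ≤ b * (85920 * b ^ 4 - 405 * b ^ 2 * Y + 3 / 4 * Y ^ 2) /
      ((36 * b ^ 2 + Y) * (64 * b ^ 2 + Y) * (100 * b ^ 2 + Y)) := by
  rw [le_div_iff₀ (by positivity)]
  have h1 : 2 * ((36 * b ^ 2 + Y) * (64 * b ^ 2 + Y) * (100 * b ^ 2 + Y)) ≤
      85920 * b ^ 4 - 405 * b ^ 2 * Y + 3 / 4 * Y ^ 2 := by
    have hb2 : b ^ 2 ≤ 1 / 100 := by nlinarith
    have hY1 : Y ≤ 12 / 100 := by linarith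
    have hY2 : Y ^ 2 ≤ 144 / 100 * b ^ 2 := by nlinarith
    have e1 : b ^ 6 ≤ 1 / 100 * b ^ 4 := by nlinarith [pow_pos hb 4]
    have e2 : b ^ 4 * Y ≤ 12 / 100 * b ^ 4 := by nlinarith [pow_pos hb 4]
    have e3 : b ^ 2 * Y ^ 2 ≤ 144 / 100 * b ^ 4 := by nlinarith [pow_pos hb 2]
    have e4 : Y ^ 3 ≤ 144 / 100 * (b ^ 2 * Y) := by nlinarith
    nlinarith [sq_nonneg (Y - 272 * b ^ 2), pow_pos hb 4]
  calc _ = b * (2 * ((36 * b ^ 2 + Y) * (64 * b ^ 2 + Y) * (100 * b ^ 2 + Y))) := by ring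
    _ ≤ _ := by gcongr

lemma kernel_right_eq {b Y : ℝ} (hb : 0 < b) (hY : 0 ≤ Y) :
    151 / 16 * ((1 + 6 * b) / ((1 + 6 * b) ^ 2 + Y)) -
      57 / 4 * ((1 + 8 * b) / ((1 + 8 * b) ^ 2 + Y)) +
      93 / 16 * ((1 + 10 * b) / ((1 + 10 * b) ^ 2 + Y)) =
    ((1 - Y + 93 / 4 * b + 179 * b ^ 2) * ((1 + 6 * b) * (1 + 8 * b) * (1 + 10 * b) -
      (3 + 24 * b) * Y) + Y * (2 + 93 / 4 * b) * (3 + 48 * b + 188 * b ^ 2 - Y)) /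
      (((1 + 6 * b) ^ 2 + Y) * ((1 + 8 * b) ^ 2 + Y) * ((1 + 10 * b) ^ 2 + Y)) := by
  have h1 : (1 + 6 * b) ^ 2 + Y ≠ 0 := by positivity
  have h2 : (1 + 8 * b) ^ 2 + Y ≠ 0 := by positivity
  have h3 : (1 + 10 * b) ^ 2 + Y ≠ 0 := by positivity
  field_simp
  ring

lemma kernel_diff_eq {b Y : ℝ} (hb : 0 < b) (hY : 0 ≤ Y) :
    151 / 16 * ((1 + 6 * b) / ((1 + 6 * b) ^ 2 + Y)) -
      57 / 4 * ((1 + 8 * b) / ((1 + 8 * b) ^ 2 + Y)) +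
      93 / 16 * ((1 + 10 * b) / ((1 + 10 * b) ^ 2 + Y)) -
      223 / 500 * (31 / 50 / ((31 / 50) ^ 2 + Y) + 81 / 50 / ((81 / 50) ^ 2 + Y)) =
    (((1 - Y + 93 / 4 * b + 179 * b ^ 2) * ((1 + 6 * b) * (1 + 8 * b) * (1 + 10 * b) -
      (3 + 24 * b) * Y) + Y * (2 + 93 / 4 * b) * (3 + 48 * b + 188 * b ^ 2 - Y)) *
      (((31 / 50) ^ 2 + Y) * ((81 / 50) ^ 2 + Y)) -
      223 / 500 * (31 / 50 * ((81 / 50) ^ 2 + Y) + 81 / 50 * ((31 / 50) ^ 2 + Y)) *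
      (((1 + 6 * b) ^ 2 + Y) * ((1 + 8 * b) ^ 2 + Y) * ((1 + 10 * b) ^ 2 + Y))) /
      (((1 + 6 * b) ^ 2 + Y) * ((1 + 8 * b) ^ 2 + Y) * ((1 + 10 * b) ^ 2 + Y) *
      (((31 / 50) ^ 2 + Y) * ((81 / 50) ^ 2 + Y))) := by
  rw [kernel_right_eq hb hY]
  have h1 : (1 + 6 * b) ^ 2 + Y ≠ 0 := by positivity
  have h2 : (1 + 8 * b) ^ 2 + Y ≠ 0 := by positivity
  have h3 : (1 + 10 * b) ^ 2 + Y ≠ 0 := by positivity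
  have h4 : (31 / 50 : ℝ) ^ 2 + Y ≠ 0 := by positivity
  have h5 : (81 / 50 : ℝ) ^ 2 + Y ≠ 0 := by positivity
  rw [div_add_div _ _ h4 h5, mul_div_assoc', div_sub_div _ _ (by positivity) (by positivity)]
  congr 1
  ring

lemma kernel_num_ge {b Y : ℝ} (hb : 0 < b) (hb1 : b ≤ 1 / 10) (hY : 0 ≤ Y) :
    (Y - 12 / 10 * b) * (1 + 45 * b + 880 * b ^ 2 + 10900 * b ^ 3 + 64000 * b ^ 4) ≤
    ((1 - Y + 93 / 4 * b + 179 * b ^ 2) * ((1 + 6 * b) * (1 + 8 * b) * (1 + 10 * b) -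
      (3 + 24 * b) * Y) + Y * (2 + 93 / 4 * b) * (3 + 48 * b + 188 * b ^ 2 - Y)) *
      (((31 / 50) ^ 2 + Y) * ((81 / 50) ^ 2 + Y)) -
      223 / 500 * (31 / 50 * ((81 / 50) ^ 2 + Y) + 81 / 50 * ((31 / 50) ^ 2 + Y)) *
      (((1 + 6 * b) ^ 2 + Y) * ((1 + 8 * b) ^ 2 + Y) * ((1 + 10 * b) ^ 2 + Y)) := by
  have h3 : b ^ 3 * Y ^ 3 ≤ 1 / 1000 * Y ^ 3 := by
    have : b ^ 3 ≤ (1 / 10) ^ 3 := by gcongr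
    nlinarith [pow_nonneg hY 3]
  have h6 : b ^ 6 * Y ≤ 1 / 10 * (b ^ 5 * Y) := by
    have : 0 ≤ b ^ 5 * Y := by positivity
    nlinarith
  have k5 : b ^ 6 ≤ 1 / 10 * b ^ 5 := by nlinarith [pow_pos hb 5]
  have k4 : b ^ 5 ≤ 1 / 10 * b ^ 4 := by nlinarith [pow_pos hb 4]
  have k3 : b ^ 4 ≤ 1 / 10 * b ^ 3 := by nlinarith [pow_pos hb 3]
  have k2 : b ^ 3 ≤ 1 / 10 * b ^ 2 := by nlinarith [pow_pos hb 2]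
  have p1 : 0 ≤ b * Y := by positivity
  have p2 : 0 ≤ b ^ 2 * Y := by positivity
  have p3 : 0 ≤ b ^ 3 * Y := by positivity
  have p4 : 0 ≤ b ^ 4 * Y := by positivity
  have p5 : 0 ≤ b ^ 5 * Y := by positivity
  have q0 : 0 ≤ Y ^ 2 := by positivity
  have q1 : 0 ≤ b * Y ^ 2 := by positivity
  have q2 : 0 ≤ b ^ 2 * Y ^ 2 := by positivity
  have q3 : 0 ≤ b ^ 3 * Y ^ 2 := by positivity
  have q4 : 0 ≤ b ^ 4 * Y ^ 2 := by positivity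
  have q5 : 0 ≤ b ^ 5 * Y ^ 2 := by positivity
  have r0 : 0 ≤ Y ^ 3 := by positivity
  have r1 : 0 ≤ b * Y ^ 3 := by positivity
  have r2 : 0 ≤ b ^ 2 * Y ^ 3 := by positivity
  have t0 : 0 ≤ Y ^ 4 := by positivity
  have t1 : 0 ≤ b * Y ^ 4 := by positivity
  have u2 := pow_pos hb 2
  ring_nf
  ring_nf at *
  linarith

/-- The boundary inequality for the kernel. -/
lemma kernel_boundary_nonneg {b Y : ℝ} (hb : 0 < b) (hb1 : b ≤ 1 / 10) (hY : 0 ≤ Y) :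
    0 ≤ (151 / 16 * (6 * b / ((6 * b) ^ 2 + Y)) - 57 / 4 * (8 * b / ((8 * b) ^ 2 + Y)) +
      93 / 16 * (10 * b / ((10 * b) ^ 2 + Y))) +
      (151 / 16 * ((1 + 6 * b) / ((1 + 6 * b) ^ 2 + Y)) -
      57 / 4 * ((1 + 8 * b) / ((1 + 8 * b) ^ 2 + Y)) +
      93 / 16 * ((1 + 10 * b) / ((1 + 10 * b) ^ 2 + Y)) -
      223 / 500 * (31 / 50 / ((31 / 50) ^ 2 + Y) + 81 / 50 / ((81 / 50) ^ 2 + Y))) := by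
  rw [kernel_left_eq hb hY, kernel_diff_eq hb hY]
  have hnum := kernel_num_ge hb hb1 hY
  rcases le_total Y (12 / 10 * b) with h | h
  · have h1 := kernel_left_ge hb hb1 hY h
    refine le_trans ?_ (add_le_add_left h1 _)
    have hden : (1 + 6 * b) ^ 2 * (1 + 8 * b) ^ 2 * (1 + 10 * b) ^ 2 ≤
        ((1 + 6 * b) ^ 2 + Y) * ((1 + 8 * b) ^ 2 + Y) * ((1 + 10 * b) ^ 2 + Y) *
      (((31 / 50) ^ 2 + Y) * ((81 / 50) ^ 2 + Y)) := by
      have : (1 : ℝ) ≤ ((31 / 50) ^ 2 + Y) * ((81 / 50) ^ 2 + Y) := by nlinarith [sq_nonneg Y]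
      calc _ ≤ ((1 + 6 * b) ^ 2 + Y) * ((1 + 8 * b) ^ 2 + Y) * ((1 + 10 * b) ^ 2 + Y) := by
            gcongr <;> linarith
        _ ≤ _ := le_mul_of_one_le_right (by positivity) this
    have hD : 0 < ((1 + 6 * b) ^ 2 + Y) * ((1 + 8 * b) ^ 2 + Y) * ((1 + 10 * b) ^ 2 + Y) *
      (((31 / 50) ^ 2 + Y) * ((81 / 50) ^ 2 + Y)) := by positivity
    set D := ((1 + 6 * b) ^ 2 + Y) * ((1 + 8 * b) ^ 2 + Y) * ((1 + 10 * b) ^ 2 + Y) *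
      (((31 / 50) ^ 2 + Y) * ((81 / 50) ^ 2 + Y))
    refine (fun {N : ℝ} (hN : -(2 * b * D) ≤ N) ↦ ?_ : ∀ {N : ℝ}, -(2 * b * D) ≤ N →
      0 ≤ 2 * b + N / D) (le_trans ?_ hnum)
    · have := (le_div_iff₀ hD).2 (show -(2 * b) * D ≤ N by linarith)
      linarith
    have hR : 12 / 10 * b * (1 + 45 * b + 880 * b ^ 2 + 10900 * b ^ 3 + 64000 * b ^ 4) ≤
        2 * b * ((1 + 6 * b) ^ 2 * (1 + 8 * b) ^ 2 * (1 + 10 * b) ^ 2) := by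
      have : 12 / 10 * (1 + 45 * b + 880 * b ^ 2 + 10900 * b ^ 3 + 64000 * b ^ 4) ≤
          2 * ((1 + 6 * b) ^ 2 * (1 + 8 * b) ^ 2 * (1 + 10 * b) ^ 2) := by
        rw [← sub_nonneg]
        ring_nf
        positivity
      nlinarith
    have hP : 0 ≤ Y * (1 + 45 * b + 880 * b ^ 2 + 10900 * b ^ 3 + 64000 * b ^ 4) := by positivity
    have := mul_le_mul_of_nonneg_left hden (show 0 ≤ 2 * b by positivity)
    linarith
  · refine add_nonneg (kernel_left_nonneg hb hY) (div_nonneg (le_trans ?_ hnum) (by positivity))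
    have : 0 ≤ Y - 12 / 10 * b := by linarith
    positivity

end PrimeBound

namespace PrimeBound

open Filter Topology MeasureTheory Set Metric
open scoped ComplexConjugate
open scoped ArithmeticFunction.vonMangoldt

noncomputable def kerF (b : ℝ) (z : ℂ) : ℂ :=
  ((151 / 16 : ℝ) : ℂ) * (1 / (z + (6 * b : ℝ))) - ((57 / 4 : ℝ) : ℂ) * (1 / (z + (8 * b : ℝ))) +
    ((93 / 16 : ℝ) : ℂ) * (1 / (z + (10 * b : ℝ)))

noncomputable def kerW (b : ℝ) (z : ℂ) : ℂ :=
  kerF b z + kerF b (1 - z) -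
    ((223 / 500 : ℝ) : ℂ) * (1 / (z + (31 / 50 : ℝ)) + 1 / (1 - z + (31 / 50 : ℝ)))

lemma re_one_div_add (z : ℂ) (a : ℝ) :
    (1 / (z + (a : ℂ))).re = (z.re + a) / ((z.re + a) ^ 2 + z.im ^ 2) := by
  rw [one_div, Complex.inv_re, Complex.normSq_apply]
  simp [sq]

lemma kerF_re (b : ℝ) (z : ℂ) : (kerF b z).re =
    151 / 16 * ((z.re + 6 * b) / ((z.re + 6 * b) ^ 2 + z.im ^ 2)) -
      57 / 4 * ((z.re + 8 * b) / ((z.re + 8 * b) ^ 2 + z.im ^ 2)) +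
      93 / 16 * ((z.re + 10 * b) / ((z.re + 10 * b) ^ 2 + z.im ^ 2)) := by
  simp only [kerF, Complex.add_re, Complex.sub_re, Complex.re_ofReal_mul, re_one_div_add]

lemma kerW_re (b : ℝ) (z : ℂ) : (kerW b z).re = (kerF b z).re + (kerF b (1 - z)).re -
    223 / 500 * ((z.re + 31 / 50) / ((z.re + 31 / 50) ^ 2 + z.im ^ 2) +
      (1 - z.re + 31 / 50) / ((1 - z.re + 31 / 50) ^ 2 + z.im ^ 2)) := by
  have h := re_one_div_add (1 - z) (31 / 50)
  simp only [Complex.sub_re, Complex.sub_im, Complex.one_re, Complex.one_im, zero_sub,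
    neg_sq] at h
  simp only [kerW, Complex.add_re, Complex.sub_re, Complex.re_ofReal_mul, re_one_div_add z, h]

lemma kerW_one_sub (b : ℝ) (z : ℂ) : kerW b (1 - z) = kerW b z := by
  simp only [kerW, sub_sub_cancel]
  ring

lemma add_ofReal_ne_zero {z : ℂ} {a : ℝ} (hz : 0 ≤ z.re) (ha : 0 < a) : z + (a : ℂ) ≠ 0 := by
  intro h
  have := congrArg Complex.re h
  simp at this
  linarith

lemma norm_one_div_add_le {z : ℂ} {a : ℝ} (hz : 0 ≤ z.re) (ha : 0 < a) :
    ‖1 / (z + (a : ℂ))‖ ≤ 1 / a := by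
  rw [norm_div, norm_one]
  gcongr
  calc a ≤ |(z + (a : ℂ)).re| := by
        simp only [Complex.add_re, Complex.ofReal_re]
        rw [abs_of_nonneg] <;> linarith
    _ ≤ _ := Complex.abs_re_le_norm _

lemma kerW_re_boundary {b : ℝ} (hb : 0 < b) (hb1 : b ≤ 1 / 10) {z : ℂ} (hz : z.re = 0) :
    0 ≤ (kerW b z).re := by
  have h := kernel_boundary_nonneg hb hb1 (sq_nonneg z.im)
  rw [kerW_re, kerF_re, kerF_re]
  simp only [Complex.sub_re, Complex.sub_im, Complex.one_re, Complex.one_im, zero_sub,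
    neg_sq, hz, zero_add, sub_zero]
  have e : (1 + 31 / 50 : ℝ) = 81 / 50 := by norm_num
  rw [e]
  linarith

lemma norm_kerF_le {b : ℝ} (hb : 0 < b) {z : ℂ} (hz : 0 ≤ z.re) :
    ‖kerF b z‖ ≤ 30 / b := by
  have h6 := norm_one_div_add_le hz (show 0 < 6 * b by positivity)
  have h8 := norm_one_div_add_le hz (show 0 < 8 * b by positivity)
  have h10 := norm_one_div_add_le hz (show 0 < 10 * b by positivity)
  have e (k : ℝ) (hk : 1 ≤ k) : 1 / (k * b) ≤ 1 / b := by
    gcongr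
    nlinarith
  refine (norm_add_le _ _).trans ((add_le_add_left (norm_sub_le _ _) _).trans ?_)
  rw [norm_mul, norm_mul, norm_mul, Complex.norm_real, Complex.norm_real, Complex.norm_real,
    Real.norm_of_nonneg (by norm_num), Real.norm_of_nonneg (by norm_num),
    Real.norm_of_nonneg (by norm_num)]
  have := e 6 (by norm_num)
  have := e 8 (by norm_num)
  have := e 10 (by norm_num)
  have hb' : 0 < 1 / b := by positivity
  rw [show 30 / b = 30 * (1 / b) by ring]
  nlinarith

lemma norm_kerW_le {b : ℝ} (hb : 0 < b) {z : ℂ} (hz : 0 ≤ z.re) (hz1 : z.re ≤ 1) :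
    ‖kerW b z‖ ≤ 60 / b + 2 := by
  have hz' : 0 ≤ (1 - z).re := by simpa using hz1
  have h1 := norm_kerF_le hb hz
  have h2 := norm_kerF_le hb hz'
  have h3 := norm_one_div_add_le hz (show (0 : ℝ) < 31 / 50 by norm_num)
  have h4 := norm_one_div_add_le hz' (show (0 : ℝ) < 31 / 50 by norm_num)
  refine (norm_sub_le _ _).trans ?_
  rw [norm_mul, Complex.norm_real, Real.norm_of_nonneg (by norm_num)]
  have h5 := norm_add_le (kerF b z) (kerF b (1 - z))
  have h6 := norm_add_le (1 / (z + ((31 / 50 : ℝ) : ℂ))) (1 / (1 - z + ((31 / 50 : ℝ) : ℂ)))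
  rw [show 60 / b = 30 / b + 30 / b by ring]
  norm_num at h3 h4 h6 ⊢
  linarith

lemma differentiableAt_kerF {b : ℝ} (hb : 0 < b) {z : ℂ} (hz : 0 ≤ z.re) :
    DifferentiableAt ℂ (kerF b) z := by
  have h6 := add_ofReal_ne_zero hz (show 0 < 6 * b by positivity)
  have h8 := add_ofReal_ne_zero hz (show 0 < 8 * b by positivity)
  have h10 := add_ofReal_ne_zero hz (show 0 < 10 * b by positivity)
  unfold kerF
  refine ((DifferentiableAt.const_mul ?_ _).sub (.const_mul ?_ _)).add (.const_mul ?_ _)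
  · exact (differentiableAt_const _).div (by fun_prop) h6
  · exact (differentiableAt_const _).div (by fun_prop) h8
  · exact (differentiableAt_const _).div (by fun_prop) h10

lemma differentiableAt_kerW {b : ℝ} (hb : 0 < b) {z : ℂ} (hz : 0 ≤ z.re) (hz1 : z.re ≤ 1) :
    DifferentiableAt ℂ (kerW b) z := by
  have hz' : 0 ≤ (1 - z).re := by simpa using hz1
  have h3 := add_ofReal_ne_zero hz (show (0 : ℝ) < 31 / 50 by norm_num)
  have h4 := add_ofReal_ne_zero hz' (show (0 : ℝ) < 31 / 50 by norm_num)
  unfold kerW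
  have hd : DifferentiableAt ℂ (fun z : ℂ ↦ kerF b (1 - z)) z :=
    DifferentiableAt.comp z (differentiableAt_kerF hb hz') (by fun_prop)
  refine ((differentiableAt_kerF hb hz).add hd).sub (.const_mul (.add ?_ ?_) _)
  · exact (differentiableAt_const _).div (by fun_prop) h3
  · exact (differentiableAt_const _).div (by fun_prop) h4

/-- The kernel has nonnegative real part on the closed critical strip. -/
lemma kerW_re_nonneg {b : ℝ} (hb : 0 < b) (hb1 : b ≤ 1 / 10) {z : ℂ} (hz : 0 ≤ z.re)
    (hz1 : z.re ≤ 1) : 0 ≤ (kerW b z).re := by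
  have hn (w : ℂ) : ‖Complex.exp (-kerW b w)‖ = exp (-(kerW b w).re) := by
    rw [Complex.norm_exp, Complex.neg_re]
  have key : ‖Complex.exp (-kerW b z)‖ ≤ 1 := by
    refine PhragmenLindelof.vertical_strip (a := 0) (b := 1)
      (f := fun z ↦ Complex.exp (-kerW b z)) ?_ ⟨0, by simpa using pi_pos, 0, ?_⟩ ?_ ?_ hz hz1
    · have hd : ∀ w : ℂ, 0 ≤ w.re → w.re ≤ 1 →
          DifferentiableAt ℂ (fun z ↦ Complex.exp (-kerW b z)) w := fun w h0 h1 ↦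
        (differentiableAt_kerW hb h0 h1).neg.cexp
      refine ⟨fun w hw ↦ (hd w hw.1.le hw.2.le).differentiableWithinAt, fun w hw ↦ ?_⟩
      have hw' : w ∈ Complex.re ⁻¹' Icc 0 1 :=
        closure_minimal (preimage_mono Ioo_subset_Icc_self)
          (isClosed_Icc.preimage Complex.continuous_re) hw
      exact (hd w hw'.1 hw'.2).continuousAt.continuousWithinAt
    · refine Asymptotics.IsBigO.of_bound (exp (60 / b + 2)) ?_
      refine Filter.mem_of_superset (mem_inf_of_right (mem_principal_self _)) fun w hw ↦ ?_
      change ‖Complex.exp (-kerW b w)‖ ≤ _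
      rw [hn]
      simp only [zero_mul, exp_zero, norm_one, mul_one]
      rw [exp_le_exp]
      have := norm_kerW_le hb (le_of_lt hw.1) (le_of_lt hw.2)
      have := (abs_le.1 (Complex.abs_re_le_norm (kerW b w))).1
      linarith
    · intro w hw
      change ‖Complex.exp (-kerW b w)‖ ≤ _
      rw [hn, exp_le_one_iff]
      linarith [kerW_re_boundary hb hb1 hw]
    · intro w hw
      change ‖Complex.exp (-kerW b w)‖ ≤ _
      rw [hn, exp_le_one_iff, ← kerW_one_sub]
      linarith [kerW_re_boundary hb hb1 (z := 1 - w) (by simp [hw])]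
  rw [hn, exp_le_one_iff] at key
  linarith

end PrimeBound

namespace PrimeBound

open Filter Topology MeasureTheory Set Metric
open scoped ComplexConjugate
open scoped ArithmeticFunction.vonMangoldt

lemma hasSum_of_eq {ι : Type*} {f g : ι → ℝ} {a c : ℝ} (h : HasSum f a) (hf : ∀ i, g i = f i)
    (hc : c = a) : HasSum g c := by
  rw [show g = f from funext hf, hc]
  exact h

noncomputable def zetaComb (b t : ℝ) : ℝ :=
  151 / 16 * (zetaLog (((1 + 6 * b : ℝ) : ℂ) + t * Complex.I)).re -
    57 / 4 * (zetaLog (((1 + 8 * b : ℝ) : ℂ) + t * Complex.I)).re +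
    93 / 16 * (zetaLog (((1 + 10 * b : ℝ) : ℂ) + t * Complex.I)).re -
    223 / 500 * (zetaLog (((81 / 50 : ℝ) : ℂ) + t * Complex.I)).re

noncomputable def xiComb (b t : ℝ) : ℝ :=
  151 / 16 * (logDeriv xi (((1 + 6 * b : ℝ) : ℂ) + t * Complex.I)).re -
    57 / 4 * (logDeriv xi (((1 + 8 * b : ℝ) : ℂ) + t * Complex.I)).re +
    93 / 16 * (logDeriv xi (((1 + 10 * b : ℝ) : ℂ) + t * Complex.I)).re -
    223 / 500 * (logDeriv xi (((81 / 50 : ℝ) : ℂ) + t * Complex.I)).re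

noncomputable def digammaComb (b t : ℝ) : ℝ :=
  151 / 16 * (Complex.digamma (((3 + 6 * b) / 2 : ℝ) + (t / 2 : ℝ) * Complex.I)).re -
    57 / 4 * (Complex.digamma (((3 + 8 * b) / 2 : ℝ) + (t / 2 : ℝ) * Complex.I)).re +
    93 / 16 * (Complex.digamma (((3 + 10 * b) / 2 : ℝ) + (t / 2 : ℝ) * Complex.I)).re -
    223 / 500 * (Complex.digamma ((181 / 100 : ℝ) + (t / 2 : ℝ) * Complex.I)).re

lemma laplace_kernel_nonneg {b u : ℝ} (hb : 0 < b) (hb1 : b ≤ 1 / 10) (hu : 0 ≤ u) :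
    0 ≤ 151 / 16 * exp (-((1 + 6 * b) * u)) - 57 / 4 * exp (-((1 + 8 * b) * u)) +
      93 / 16 * exp (-((1 + 10 * b) * u)) - 223 / 500 * exp (-(81 / 50 * u)) := by
  set X := exp (-(2 * b * u)) with hX
  have hX0 : 0 < X := exp_pos _
  have hX1 : X ≤ 1 := exp_le_one_iff.2 (by nlinarith [mul_nonneg hb.le hu])
  have e0 := exp_pos (-u)
  have e6 : exp (-((1 + 6 * b) * u)) = exp (-u) * X ^ 3 := by
    rw [hX, ← exp_nat_mul, ← exp_add]; congr 1; push_cast; ring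
  have e8 : exp (-((1 + 8 * b) * u)) = exp (-u) * X ^ 4 := by
    rw [hX, ← exp_nat_mul, ← exp_add]; congr 1; push_cast; ring
  have e10 : exp (-((1 + 10 * b) * u)) = exp (-u) * X ^ 5 := by
    rw [hX, ← exp_nat_mul, ← exp_add]; congr 1; push_cast; ring
  have e4 : exp (-(81 / 50 * u)) ≤ exp (-((1 + 6 * b) * u)) := by
    rw [exp_le_exp]; nlinarith
  have hp : 0 ≤ 151 / 16 - 57 / 4 * X + 93 / 16 * X ^ 2 - 223 / 500 := by nlinarith
  have : 0 ≤ exp (-u) * X ^ 3 * (151 / 16 - 57 / 4 * X + 93 / 16 * X ^ 2 - 223 / 500) := by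
    positivity
  rw [e8, e10]
  rw [e6] at e4 ⊢
  nlinarith

lemma trig_poly_nonneg (θ : ℝ) : 0 ≤ 5 + 8 * cos θ + 4 * cos (2 * θ) + cos (3 * θ) := by
  rw [cos_two_mul, cos_three_mul]
  have h := neg_one_le_cos θ
  have : 0 ≤ (1 + cos θ) * (1 + 2 * cos θ) ^ 2 := mul_nonneg (by linarith) (sq_nonneg _)
  linarith

lemma hasSum_zetaComb {b : ℝ} (hb : 0 < b) (t : ℝ) :
    HasSum (fun n : ℕ ↦ Λ n * ((151 / 16 * exp (-((1 + 6 * b) * log n)) -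
      57 / 4 * exp (-((1 + 8 * b) * log n)) + 93 / 16 * exp (-((1 + 10 * b) * log n)) -
      223 / 500 * exp (-(81 / 50 * log n))) * cos (t * log n))) (zetaComb b t) := by
  have h6 := (hasSum_zetaLog_re (σ := 1 + 6 * b) t (by linarith)).mul_left (151 / 16)
  have h8 := (hasSum_zetaLog_re (σ := 1 + 8 * b) t (by linarith)).mul_left (57 / 4)
  have h10 := (hasSum_zetaLog_re (σ := 1 + 10 * b) t (by linarith)).mul_left (93 / 16)
  have h4 := (hasSum_zetaLog_re (σ := 81 / 50) t (by norm_num)).mul_left (223 / 500)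
  refine hasSum_of_eq (((h6.sub h8).add h10).sub h4) (fun n ↦ ?_) rfl
  ring

lemma zetaComb_sum_nonneg {b : ℝ} (hb : 0 < b) (hb1 : b ≤ 1 / 10) (γ : ℝ) :
    0 ≤ 5 * zetaComb b 0 + 8 * zetaComb b γ + 4 * zetaComb b (2 * γ) + zetaComb b (3 * γ) := by
  have h := ((((hasSum_zetaComb hb 0).mul_left 5).add ((hasSum_zetaComb hb γ).mul_left 8)).add
    ((hasSum_zetaComb hb (2 * γ)).mul_left 4)).add (hasSum_zetaComb hb (3 * γ))
  refine h.nonneg fun n ↦ ?_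
  have h1 := laplace_kernel_nonneg hb hb1 (log_natCast_nonneg n)
  have h2 := trig_poly_nonneg (γ * log n)
  have h3 : 0 ≤ Λ n := ArithmeticFunction.vonMangoldt_nonneg
  have := mul_nonneg h3 (mul_nonneg h1 h2)
  simp only [zero_mul, cos_zero, mul_assoc] at this ⊢
  linarith

lemma xiComb_hasSum {b : ℝ} (hb : 0 < b) (t : ℝ) :
    HasSum (fun ρ : XiZero ↦ mult ρ * ((1 / 2) * (kerW b (1 + t * Complex.I - ρ)).re))
      (xiComb b t) := by
  have key (σ : ℝ) (hσ : 0 < σ) : HasSum (fun ρ : XiZero ↦ mult ρ *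
      (((1 / 2) * ((1 / ((1 + t * Complex.I - ρ) + (σ : ℂ))).re +
        (1 / ((1 - (1 + t * Complex.I - ρ)) + (σ : ℂ))).re))))
      (logDeriv xi (((1 + σ : ℝ) : ℂ) + t * Complex.I)).re := by
    have h := hasSum_re_one_div_sub (s := ((1 + σ : ℝ) : ℂ) + t * Complex.I) (by simp; linarith)
    have h' := (conjZero.trans reflZero).hasSum_iff.2 h
    have h2 := (h.add h').mul_left (1 / 2)
    refine hasSum_of_eq h2 (fun ρ ↦ ?_) (by ring)
    · simp only [Function.comp, Equiv.trans_apply, mult_reflZero, mult_conjZero, coe_reflZero,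
        coe_conjZero]
      have e1 : (1 + (t : ℂ) * Complex.I - ρ) + (σ : ℂ) =
        ((1 + σ : ℝ) : ℂ) + t * Complex.I - ρ := by push_cast; ring
      have e2 : (1 / ((1 - (1 + (t : ℂ) * Complex.I - ρ)) + (σ : ℂ))).re =
          (1 / (((1 + σ : ℝ) : ℂ) + t * Complex.I - (1 - conj (ρ : ℂ)))).re := by
        rw [re_one_div_add, re_one_div_sub]
        simp
        ring
      rw [e1, e2]
      ring
  have h6 := (key (6 * b) (by positivity)).mul_left (151 / 16)
  have h8 := (key (8 * b) (by positivity)).mul_left (57 / 4)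
  have h10 := (key (10 * b) (by positivity)).mul_left (93 / 16)
  have h4 := (key (31 / 50) (by norm_num)).mul_left (223 / 500)
  refine hasSum_of_eq (((h6.sub h8).add h10).sub h4) (fun ρ ↦ ?_) ?_
  · simp only [kerW, kerF, Complex.add_re, Complex.sub_re, Complex.re_ofReal_mul]
    ring
  · rw [xiComb]
    norm_num

lemma kerW_zero_nonneg {b : ℝ} (hb : 0 < b) (hb1 : b ≤ 1 / 10) (t : ℝ) (ρ : XiZero) :
    0 ≤ mult ρ * ((1 / 2) * (kerW b (1 + t * Complex.I - ρ)).re) := by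
  have h0 := ρ.re_pos
  have h1 := ρ.re_lt_one
  have := kerW_re_nonneg hb hb1 (z := 1 + t * Complex.I - ρ) (by simp; linarith)
    (by simp; linarith)
  have := mult_nonneg ρ
  positivity

lemma xiComb_nonneg {b : ℝ} (hb : 0 < b) (hb1 : b ≤ 1 / 10) (t : ℝ) : 0 ≤ xiComb b t :=
  (xiComb_hasSum hb t).nonneg (kerW_zero_nonneg hb hb1 t)

lemma xiComb_ge {b : ℝ} (hb : 0 < b) (hb1 : b ≤ 1 / 10) (ρ : XiZero)
    (hρ : (ρ : ℂ).re = 1 - b) : (kerW b b).re ≤ xiComb b (ρ : ℂ).im := by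
  set ρ' := reflZero (conjZero ρ) with hρ'
  have hc : (ρ' : ℂ) = 1 - conj (ρ : ℂ) := by rw [hρ', coe_reflZero, coe_conjZero]
  have hne : ρ ≠ ρ' := by
    intro h
    have := congrArg (fun z : XiZero ↦ (z : ℂ).re) h
    simp only [hc, Complex.sub_re, Complex.one_re, Complex.conj_re, hρ] at this
    linarith
  have h := sum_le_hasSum ({ρ, ρ'} : Finset XiZero)
    (fun σ _ ↦ kerW_zero_nonneg hb hb1 _ σ) (xiComb_hasSum hb (ρ : ℂ).im)
  rw [Finset.sum_pair hne] at h
  have e1 : 1 + ((ρ : ℂ).im : ℂ) * Complex.I - ρ = b := by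
    apply Complex.ext <;> simp [hρ]
  have e2 : 1 + ((ρ : ℂ).im : ℂ) * Complex.I - ρ' = 1 - b := by
    rw [hc]
    apply Complex.ext <;> simp [hρ]
  rw [e1, e2, kerW_one_sub] at h
  have hW := kerW_re_nonneg hb hb1 (z := (b : ℂ)) (by simpa using hb.le) (by simp; linarith)
  have m1 := one_le_mult ρ
  have m2 := one_le_mult ρ'
  nlinarith

lemma zetaComb_eq {b : ℝ} (hb : 0 < b) (t : ℝ) :
    zetaComb b t = (kerF b (t * Complex.I)).re - 223 / 500 * (31 / 50 / ((31 / 50) ^ 2 + t ^ 2)) +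
      digammaComb b t / 2 - 277 / 1000 * log π - xiComb b t := by
  have key (σ : ℝ) (hσ : 0 < σ) : (zetaLog (((1 + σ : ℝ) : ℂ) + t * Complex.I)).re =
      (1 / (t * Complex.I + (σ : ℂ))).re +
      (Complex.digamma (((3 + σ) / 2 : ℝ) + (t / 2 : ℝ) * Complex.I)).re / 2 - log π / 2 -
        (logDeriv xi (((1 + σ : ℝ) : ℂ) + t * Complex.I)).re := by
    rw [zetaLog_eq (by simp; linarith)]
    have e1 : ((1 + σ : ℝ) : ℂ) + t * Complex.I - 1 = t * Complex.I + (σ : ℂ) := by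
      push_cast; ring
    have e2 : (((1 + σ : ℝ) : ℂ) + t * Complex.I) / 2 + 1 =
      ((3 + σ) / 2 : ℝ) + (t / 2 : ℝ) * Complex.I := by push_cast; ring
    have e3 (z : ℂ) : ((1 / 2 : ℂ) * z).re = z.re / 2 := by
      rw [show (1 / 2 : ℂ) = ((1 / 2 : ℝ) : ℂ) by push_cast; rfl, Complex.re_ofReal_mul]; ring
    rw [e1, e2]
    simp only [Complex.add_re, Complex.sub_re, e3, Complex.ofReal_re]
  have h4 := key (31 / 50) (by norm_num)
  rw [re_one_div_add] at h4
  norm_num at h4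
  rw [zetaComb, key _ (by positivity), key _ (by positivity), key _ (by positivity),
    show ((81 / 50 : ℝ) : ℂ) = 81 / 50 by push_cast; rfl, h4, digammaComb, xiComb, kerF]
  simp only [Complex.add_re, Complex.sub_re, Complex.re_ofReal_mul]
  norm_num
  ring

end PrimeBound

namespace PrimeBound

open Filter Topology MeasureTheory Set Metric
open scoped ComplexConjugate
open scoped ArithmeticFunction.vonMangoldt

lemma one_div_sub_kernel_le {b z : ℝ} (hb : 0 < b) (hb1 : b ≤ 1 / 10) (hz : 3 ≤ z) :
    1 / z - (151 / 16 * (1 / (z + 6 * b)) - 57 / 4 * (1 / (z + 8 * b)) +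
      93 / 16 * (1 / (z + 10 * b))) ≤ b / z ^ 2 := by
  have hz0 : 0 < z := by linarith
  have h6 : 0 < z + 6 * b := by positivity
  have h8 : 0 < z + 8 * b := by positivity
  have h10 : 0 < z + 10 * b := by positivity
  have e : 1 / z - (151 / 16 * (1 / (z + 6 * b)) - 57 / 4 * (1 / (z + 8 * b)) +
      93 / 16 * (1 / (z + 10 * b))) = b * ((3 / 4 * z ^ 2 + 9 * b * z + 480 * b ^ 2) * z) /
        (z ^ 2 * ((z + 6 * b) * (z + 8 * b) * (z + 10 * b))) := by
    field_simp
    ring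
  rw [e, div_le_div_iff₀ (by positivity) (by positivity)]
  have h : (3 / 4 * z ^ 2 + 9 * b * z + 480 * b ^ 2) * z ≤
      (z + 6 * b) * (z + 8 * b) * (z + 10 * b) := by
    have h1 : 292 * b ^ 2 ≤ 15 * b * z := by nlinarith
    have : 292 * b ^ 2 * z ≤ 15 * b * z * z := by gcongr
    have : 0 < b ^ 3 := by positivity
    have : 0 < z ^ 3 := by positivity
    nlinarith
  have hp : 0 ≤ b * z ^ 2 := by positivity
  nlinarith

lemma digammaComb_zero_le {b : ℝ} (hb : 0 < b) (hb1 : b ≤ 1 / 10) :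
    digammaComb b 0 ≤ digammaR (3 / 2) + b / 2 - 223 / 500 * digammaR (181 / 100) := by
  have h6 := (digammaR_eq (x := (3 + 6 * b) / 2) (by positivity)).mul_left (151 / 16)
  have h8 := (digammaR_eq (x := (3 + 8 * b) / 2) (by positivity)).mul_left (57 / 4)
  have h10 := (digammaR_eq (x := (3 + 10 * b) / 2) (by positivity)).mul_left (93 / 16)
  have h := (((h6.sub h8).add h10).sub (digammaR_eq (x := 3 / 2) (by norm_num))).tendsto_sum_nat
  have hle := le_of_tendsto' h (b := b / 2) fun n ↦ ?_
  · rw [digammaComb]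
    simp only [zero_div, Complex.ofReal_zero, zero_mul, add_zero]
    simp only [digammaR] at hle ⊢
    linarith
  · have hn : ∑ k ∈ Finset.range n, (b / 2) * (1 / ((k : ℝ) + 1) - 1 / (k + 2)) =
        (b / 2) * (1 - 1 / ((n : ℝ) + 1)) := by
      induction n with
      | zero => simp
      | succ n ih =>
        rw [Finset.sum_range_succ, ih]
        push_cast
        field_simp
        ring
    have h1 : 0 ≤ (b / 2) * (1 / ((n : ℝ) + 1)) := by positivity
    refine le_trans (Finset.sum_le_sum fun k _ ↦ ?_) (hn.trans_le (by linarith))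
    have hk := one_div_sub_kernel_le hb hb1 (z := 3 + 2 * k) (by linarith [k.cast_nonneg (α := ℝ)])
    have e (r : ℝ) : 1 / ((3 + r * b) / 2 + (k : ℝ)) = 2 * (1 / (3 + 2 * k + r * b)) := by
      rw [show (3 + r * b) / 2 + (k : ℝ) = (3 + 2 * k + r * b) / 2 by ring, one_div_div]; ring
    have e0 : 1 / (3 / 2 + (k : ℝ)) = 2 * (1 / (3 + 2 * k)) := by
      rw [show 3 / 2 + (k : ℝ) = (3 + 2 * k) / 2 by ring, one_div_div]; ring
    have hq : b / (3 + 2 * (k : ℝ)) ^ 2 ≤ (b / 4) * (1 / ((k : ℝ) + 1) - 1 / (k + 2)) := by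
      rw [show (b / 4) * (1 / ((k : ℝ) + 1) - 1 / (k + 2)) =
        b / (4 * (k + 1) * (k + 2)) by field_simp; ring]
      gcongr
      nlinarith [k.cast_nonneg (α := ℝ)]
    rw [e, e, e, e0]
    linarith

lemma digammaComb_le {b t : ℝ} (hb : 0 < b) (hb1 : b ≤ 1 / 10) (ht : 2 ≤ t) :
    digammaComb b t ≤ 277 / 500 * log (t / 2) + 38 / t ^ 2 := by
  have ht0 : 0 < t := by linarith
  have key (x : ℝ) (hx : 1 ≤ x) :
      |(Complex.digamma ((x : ℝ) + (t / 2 : ℝ) * Complex.I)).re -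
        (log (t / 2) + log (1 + (2 * x - 1) ^ 2 / t ^ 2) / 2)| ≤ 1 / t ^ 2 := by
    have h := abs_re_digamma_sub_log_le (x := x) (t := t / 2) hx (by linarith)
    have e : log ((x - 1 / 2) ^ 2 + (t / 2) ^ 2) / 2 =
        log (t / 2) + log (1 + (2 * x - 1) ^ 2 / t ^ 2) / 2 := by
      rw [show (x - 1 / 2) ^ 2 + (t / 2) ^ 2 = (t / 2) ^ 2 * (1 + (2 * x - 1) ^ 2 / t ^ 2) by
        field_simp; ring, log_mul (by positivity) (by positivity), log_pow]
      push_cast; ring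
    rw [e] at h
    refine h.trans_eq ?_
    field_simp
    ring
  have k6 := abs_le.1 (key ((3 + 6 * b) / 2) (by linarith))
  have k8 := abs_le.1 (key ((3 + 8 * b) / 2) (by linarith))
  have k10 := abs_le.1 (key ((3 + 10 * b) / 2) (by linarith))
  have k4 := abs_le.1 (key (181 / 100) (by norm_num))
  have l4 : 0 ≤ log (1 + (2 * (181 / 100 : ℝ) - 1) ^ 2 / t ^ 2) :=
    log_nonneg (by rw [le_add_iff_nonneg_right]; positivity)
  have l68 : log (1 + (2 * ((3 + 6 * b) / 2) - 1) ^ 2 / t ^ 2) ≤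
      log (1 + (2 * ((3 + 8 * b) / 2) - 1) ^ 2 / t ^ 2) := by
    gcongr <;> linarith
  have l8 : log (1 + (2 * ((3 + 8 * b) / 2) - 1) ^ 2 / t ^ 2) ≤ 7.84 / t ^ 2 := by
    refine (log_le_sub_one_of_pos (by positivity)).trans ?_
    rw [add_sub_cancel_left]
    gcongr
    nlinarith
  have l10 : log (1 + (2 * ((3 + 10 * b) / 2) - 1) ^ 2 / t ^ 2) ≤
      log (1 + (2 * ((3 + 8 * b) / 2) - 1) ^ 2 / t ^ 2) + 1.16 / t ^ 2 := by
    have h0 : (0 : ℝ) < 1 + (2 * ((3 + 8 * b) / 2) - 1) ^ 2 / t ^ 2 := by positivity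
    have hle : 1 + (2 * ((3 + 10 * b) / 2) - 1) ^ 2 / t ^ 2 ≤
        (1 + (2 * ((3 + 8 * b) / 2) - 1) ^ 2 / t ^ 2) * exp (1.16 / t ^ 2) := by
      have h1 := add_one_le_exp (1.16 / t ^ 2)
      have h2 : (2 * ((3 + 10 * b) / 2) - 1) ^ 2 / t ^ 2 ≤
          (2 * ((3 + 8 * b) / 2) - 1) ^ 2 / t ^ 2 + 1.16 / t ^ 2 := by
        rw [← add_div]
        gcongr
        nlinarith
      have h3 : 0 ≤ (2 * ((3 + 8 * b) / 2) - 1) ^ 2 / t ^ 2 := by positivity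
      have h4 : 0 ≤ 1.16 / t ^ 2 := by positivity
      nlinarith
    have := log_le_log (by positivity) hle
    rwa [log_mul h0.ne' (exp_pos _).ne', log_exp] at this
  rw [digammaComb]
  rw [show (7.84 : ℝ) / t ^ 2 = 7.84 * (1 / t ^ 2) by ring] at l8
  rw [show (1.16 : ℝ) / t ^ 2 = 1.16 * (1 / t ^ 2) by ring] at l10
  rw [show (38 : ℝ) / t ^ 2 = 38 * (1 / t ^ 2) by ring]
  have hu : 0 < 1 / t ^ 2 := by positivity
  linarith [k6.2, k8.1, k10.2, k4.1]

lemma kerF_im_axis_le {b t : ℝ} (hb : 0 < b) (hb1 : b ≤ 1 / 10) (ht : 32 ≤ t ^ 2) :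
    (kerF b (t * Complex.I)).re - 223 / 500 * (31 / 50 / ((31 / 50) ^ 2 + t ^ 2)) ≤ 0 := by
  have h := kernel_left_eq hb (sq_nonneg t)
  rw [kerF_re]
  simp only [Complex.re_ofReal_mul, Complex.I_re, mul_zero, zero_add, Complex.im_ofReal_mul,
    Complex.I_im, mul_one]
  rw [h]
  generalize t ^ 2 = Y at ht
  have hY : 0 < Y := by linarith
  have h1 : b * (85920 * b ^ 4 - 405 * b ^ 2 * Y + 3 / 4 * Y ^ 2) /
      ((36 * b ^ 2 + Y) * (64 * b ^ 2 + Y) * (100 * b ^ 2 + Y)) ≤ 0.076 / Y := by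
    have hnum : b * (85920 * b ^ 4 - 405 * b ^ 2 * Y + 3 / 4 * Y ^ 2) ≤ 0.076 * Y ^ 2 := by
      have hb4 : b ^ 4 ≤ (1 / 10) ^ 4 := by gcongr
      have : 85920 * b ^ 4 - 405 * b ^ 2 * Y + 3 / 4 * Y ^ 2 ≤ 0.76 * Y ^ 2 := by
        have : 0 ≤ b ^ 2 * Y := by positivity
        nlinarith
      nlinarith
    have hden : Y ^ 3 ≤ (36 * b ^ 2 + Y) * (64 * b ^ 2 + Y) * (100 * b ^ 2 + Y) := by
      have : Y ^ 3 = Y * Y * Y := by ring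
      rw [this]
      gcongr <;> nlinarith [sq_nonneg b]
    calc _ ≤ 0.076 * Y ^ 2 / ((36 * b ^ 2 + Y) * (64 * b ^ 2 + Y) * (100 * b ^ 2 + Y)) := by
          gcongr
      _ ≤ 0.076 * Y ^ 2 / Y ^ 3 := by gcongr
      _ = _ := by field_simp
  have h2 : 0.076 / Y ≤ 223 / 500 * (31 / 50 / ((31 / 50) ^ 2 + Y)) := by
    rw [← mul_div_assoc, div_le_div_iff₀ hY (by positivity)]
    nlinarith
  linarith

lemma kerF_zero_re {b : ℝ} (hb : 0 < b) : (kerF b ((0 : ℝ) * Complex.I)).re = 179 / 480 / b := by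
  rw [kerF_re]
  simp
  field_simp
  norm_num

lemma kerW_self_ge {b : ℝ} (hb : 0 < b) (hb1 : b ≤ 1 / 10) :
    813 / 2772 / b + b / 5 ≤ (kerW b b).re := by
  rw [kerW_re, kerF_re, kerF_re]
  simp only [Complex.sub_re, Complex.sub_im, Complex.one_re, Complex.one_im, Complex.ofReal_re,
    Complex.ofReal_im, sub_zero]
  have e (x : ℝ) (hx : 0 < x) : x / (x ^ 2 + 0 ^ 2) = 1 / x := by field_simp; simp
  rw [e _ (by positivity), e _ (by positivity), e _ (by positivity), e _ (by linarith),
    e _ (by linarith), e _ (by linarith), e _ (by linarith), e _ (by linarith)]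
  have e1 : 151 / 16 * (1 / (b + 6 * b)) - 57 / 4 * (1 / (b + 8 * b)) +
      93 / 16 * (1 / (b + 10 * b)) = 813 / 2772 / b := by
    field_simp
    norm_num
  have h3 : 0 < 81 / 50 - b := by linarith
  rw [show 1 - b + 6 * b = 1 + 5 * b by ring, show 1 - b + 8 * b = 1 + 7 * b by ring,
    show 1 - b + 10 * b = 1 + 9 * b by ring, show 1 - b + 31 / 50 = 81 / 50 - b by ring]
  have h4 : 0 < b + 31 / 50 := by linarith
  have e2 : b / 5 ≤ 151 / 16 * (1 / (1 + 5 * b)) - 57 / 4 * (1 / (1 + 7 * b)) +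
      93 / 16 * (1 / (1 + 9 * b)) -
      223 / 500 * (1 / (b + 31 / 50) + 1 / (81 / 50 - b)) := by
    have e3 : 151 / 16 * (1 / (1 + 5 * b)) - 57 / 4 * (1 / (1 + 7 * b)) +
      93 / 16 * (1 / (1 + 9 * b)) = (1 + 85 / 4 * b + 627 / 4 * b ^ 2) /
        ((1 + 5 * b) * (1 + 7 * b) * (1 + 9 * b)) := by
      field_simp
      ring
    have e4 : 1 / (b + 31 / 50) + 1 / (81 / 50 - b) =
        (2.24) / ((b + 31 / 50) * (81 / 50 - b)) := by
      rw [div_add_div _ _ h4.ne' h3.ne']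
      ring
    rw [e3, e4, ← mul_div_assoc, div_sub_div _ _ (by positivity) (by positivity),
      le_div_iff₀ (by positivity)]
    have p2 := pow_pos hb 2
    have p3 := pow_pos hb 3
    have k4 : b ^ 5 ≤ 1 / 10 * b ^ 4 := by nlinarith [pow_pos hb 4]
    have k3 : b ^ 4 ≤ 1 / 10 * b ^ 3 := by nlinarith [pow_pos hb 3]
    have k2 : b ^ 3 ≤ 1 / 10 * b ^ 2 := by nlinarith [pow_pos hb 2]
    have k1 : b ^ 2 ≤ 1 / 10 * b := by nlinarith
    have p5 := pow_pos hb 5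
    have p6 := pow_pos hb 6
    have k5 : b ^ 6 ≤ 1 / 10 * b ^ 5 := by nlinarith [pow_pos hb 5]
    ring_nf
    ring_nf at *
    nlinarith
  linarith

end PrimeBound

namespace PrimeBound

open Filter Topology MeasureTheory Set Metric
open scoped ComplexConjugate
open scoped ArithmeticFunction.vonMangoldt

lemma digammaR_three_halves_le : digammaR (3 / 2) ≤ 0.0372 := by
  have h3 := digammaR_add_nat (x := 3 / 2) (by norm_num) 20
  have h4 := (abs_le.mp (abs_digammaR_sub_log_le (x := 3 / 2 + (20 : ℕ)) (by norm_num))).2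
  have h5 := log_le_of_pow_le (x := 21) (by norm_num) 123 28 (by norm_num) (by norm_num)
  have l2 := Real.log_two_lt_d9
  simp only [Finset.sum_range_succ, Finset.sum_range_zero] at h3
  norm_num at h3 h4 h5 ⊢
  linarith

lemma digammaR_181_ge : 0.2917 ≤ digammaR (181 / 100) := by
  have h3 := digammaR_add_nat (x := 181 / 100) (by norm_num) 20
  have h4 := (abs_le.mp (abs_digammaR_sub_log_le (x := 181 / 100 + (20 : ℕ)) (by norm_num))).1
  have h5 := log_ge_of_pow_le (x := 21.31) (by norm_num) 203 46 (by norm_num) (by norm_num)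
  have l2 := Real.log_two_gt_d9
  simp only [Finset.sum_range_succ, Finset.sum_range_zero] at h3
  norm_num at h3 h4 h5 ⊢
  linarith

lemma zero_free_core {b : ℝ} (hb : 0 < b) (hb1 : b ≤ 1 / 10) (ρ : XiZero)
    (hρ : (ρ : ℂ).re = 1 - b) (hγ : 0 < (ρ : ℂ).im) :
    (6504 / 2772 - 895 / 480) / b ≤
      3.601 * log ((ρ : ℂ).im / (2 * π)) - 4.338 + 174 / (ρ : ℂ).im ^ 2 := by
  set γ := (ρ : ℂ).im with hγd
  have hγ2 : 32 ≤ γ ^ 2 := ρ.sq_im_ge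
  have hγ5 : 5 ≤ γ := by nlinarith
  have hpos := zetaComb_sum_nonneg hb hb1 γ
  have hx0 := xiComb_nonneg hb hb1 0
  have hx1 := xiComb_ge hb hb1 ρ hρ
  have hx2 := xiComb_nonneg hb hb1 (2 * γ)
  have hx3 := xiComb_nonneg hb hb1 (3 * γ)
  have hW := kerW_self_ge hb hb1
  have hd0 := digammaComb_zero_le hb hb1
  have hd1 := digammaComb_le hb hb1 (t := γ) (by linarith)
  have hd2 := digammaComb_le hb hb1 (t := 2 * γ) (by linarith)
  have hd3 := digammaComb_le hb hb1 (t := 3 * γ) (by linarith)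
  have hk1 := kerF_im_axis_le hb hb1 hγ2
  have hk2 := kerF_im_axis_le hb hb1 (t := 2 * γ) (by nlinarith)
  have hk3 := kerF_im_axis_le hb hb1 (t := 3 * γ) (by nlinarith)
  have hk0 := kerF_zero_re hb
  have e0 := zetaComb_eq hb 0
  have e1 := zetaComb_eq hb γ
  have e2 := zetaComb_eq hb (2 * γ)
  have e3 := zetaComb_eq hb (3 * γ)
  have a1 := digammaR_three_halves_le
  have a2 := digammaR_181_ge
  have a3 := log_pi_ge
  have l3 := log_le_of_pow_le (x := 3) (by norm_num) 65 41 (by norm_num) (by norm_num)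
  have l2 := Real.log_two_lt_d9
  have g2 : log (2 * γ / 2) = log (γ / 2) + log 2 := by
    rw [← log_mul (by positivity) (by norm_num)]; congr 1; ring
  have g3 : log (3 * γ / 2) = log (γ / 2) + log 3 := by
    rw [← log_mul (by positivity) (by norm_num)]; congr 1; ring
  have g1 : log (γ / (2 * π)) = log (γ / 2) - log π := by
    rw [← log_div (by positivity) pi_pos.ne']; congr 1; field_simp
  have q2 : 38 / (2 * γ) ^ 2 = 38 / 4 * (1 / γ ^ 2) := by field_simp; norm_num
  have q3 : 38 / (3 * γ) ^ 2 = 38 / 9 * (1 / γ ^ 2) := by field_simp; norm_num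
  have q1 : 38 / γ ^ 2 = 38 * (1 / γ ^ 2) := by ring
  have q : 174 / γ ^ 2 = 174 * (1 / γ ^ 2) := by ring
  have qp : 0 < 1 / γ ^ 2 := by positivity
  have b1 : (6504 / 2772 - 895 / 480) / b = 8 * (813 / 2772 / b) - 5 * (179 / 480 / b) := by
    field_simp; norm_num
  rw [hk0] at e0
  rw [g2, q2] at hd2
  rw [g3, q3] at hd3
  rw [q1] at hd1
  rw [g1, q, b1]
  have n0 : (31 / 50 : ℝ) / ((31 / 50) ^ 2 + 0 ^ 2) = 50 / 31 := by norm_num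
  rw [n0] at e0
  generalize 813 / 2772 / b = A at *
  generalize 179 / 480 / b = B at *
  generalize 1 / γ ^ 2 = Q at *
  generalize log (γ / 2) = G at *
  generalize log π = P at *
  norm_num at l3
  linarith

/-- An explicit zero-free region. -/
lemma zero_free (ρ : XiZero) (hρ : 9 / 10 ≤ (ρ : ℂ).re) (hγ : 0 < (ρ : ℂ).im) :
    77 ≤ (ρ : ℂ).im ∧
      1 / (1 - (ρ : ℂ).re) ≤ 7.4751 * log ((ρ : ℂ).im / (2 * π)) - 8.94 := by
  have hb : 0 < 1 - (ρ : ℂ).re := by linarith [ρ.re_lt_one]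
  have h := zero_free_core hb (by linarith) ρ (by ring) hγ
  have h75 := ρ.sq_im_ge_of_re_ne (by linarith)
  set γ := (ρ : ℂ).im
  set b := 1 - (ρ : ℂ).re
  have hb1 : b ≤ 1 / 10 := by linarith
  have hinv : 10 ≤ 1 / b := by rw [le_div_iff₀ hb]; linarith
  rw [show (6504 / 2772 - 895 / 480) / b = (6504 / 2772 - 895 / 480) * (1 / b) by ring] at h
  generalize 1 / b = B at *
  have hl2 := Real.log_two_lt_d9
  have hl2' := Real.log_two_gt_d9
  have step (E c : ℝ) (hE : 174 / γ ^ 2 ≤ E) (hc : 0 < c)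
      (hlc : 3.601 * log c ≤ 4.8173 + 4.338 - E) : 2 * π * c ≤ γ := by
    by_contra hcon
    push Not at hcon
    have h1 : γ / (2 * π) < c := by
      rw [div_lt_iff₀ (by positivity)]; linarith
    have h2 := log_lt_log (by positivity) h1
    norm_num at h hlc
    linarith
  have hpi := pi_gt_d2
  have s1 : 39 ≤ γ := by
    have h1 := step 2.32 6.4 (by rw [div_le_iff₀ (by positivity)]; linarith) (by norm_num) ?_
    · linarith
    · have := log_le_of_pow_le (x := 6.4) (by norm_num) 27 10 (by norm_num) (by norm_num)
      norm_num at this ⊢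
      linarith
  have s2 : 77 ≤ γ := by
    have h1 := step 0.1145 12.27 (by rw [div_le_iff₀ (by positivity)]; nlinarith) (by norm_num) ?_
    · linarith
    · have := log_le_of_pow_le (x := 12.27) (by norm_num) 105 29 (by norm_num) (by norm_num)
      norm_num at this ⊢
      linarith
  refine ⟨s2, ?_⟩
  have h3 : 174 / γ ^ 2 ≤ 0.02935 := by rw [div_le_iff₀ (by positivity)]; nlinarith
  have hl : 0 ≤ log (γ / (2 * π)) := by
    refine log_nonneg ?_
    rw [le_div_iff₀ (by positivity)]
    linarith [pi_lt_d2]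
  norm_num at h ⊢
  linarith

end PrimeBound

namespace PrimeBound

open Filter Topology MeasureTheory Set Metric
open scoped ComplexConjugate
open scoped ArithmeticFunction.vonMangoldt

/-- `f` is continuous on `[0, ∞)` and has Laplace transform `F` on the line `Re s = 2`. -/
structure LaplacePair (f : ℝ → ℂ) (F : ℂ → ℂ) : Prop where
  cont : Continuous (fun v ↦ f (max v 0))
  integrable : ∀ s : ℂ, s.re = 2 → IntegrableOn (fun v : ℝ ↦ Complex.exp (-(s * v)) * f v) (Ioi 0)
  eq : ∀ s : ℂ, s.re = 2 → ∫ v in Ioi (0 : ℝ), Complex.exp (-(s * v)) * f v = F s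

namespace LaplacePair

variable {f g : ℝ → ℂ} {F G : ℂ → ℂ}

lemma add (hf : LaplacePair f F) (hg : LaplacePair g G) :
    LaplacePair (fun v ↦ f v + g v) (fun s ↦ F s + G s) where
  cont := hf.cont.add hg.cont
  integrable s hs := by
    simp only [mul_add]
    exact (hf.integrable s hs).add (hg.integrable s hs)
  eq s hs := by
    simp only [mul_add]
    rw [integral_add (hf.integrable s hs) (hg.integrable s hs), hf.eq s hs, hg.eq s hs]

lemma const_mul (c : ℂ) (hf : LaplacePair f F) :
    LaplacePair (fun v ↦ c * f v) (fun s ↦ c * F s) where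
  cont := continuous_const.mul hf.cont
  integrable s hs := by
    simp only [mul_left_comm _ c]
    exact (hf.integrable s hs).const_mul c
  eq s hs := by
    simp only [mul_left_comm _ c]
    rw [integral_const_mul, hf.eq s hs]

lemma sub (hf : LaplacePair f F) (hg : LaplacePair g G) :
    LaplacePair (fun v ↦ f v - g v) (fun s ↦ F s - G s) := by
  have := hf.add (hg.const_mul (-1))
  simpa only [neg_one_mul, ← sub_eq_add_neg] using this

lemma congr (hf : LaplacePair f F) (hfg : ∀ v, 0 ≤ v → f v = g v)
    (hFG : ∀ s : ℂ, s.re = 2 → F s = G s) : LaplacePair g G where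
  cont := by
    simpa only [hfg _ (le_max_right _ _)] using hf.cont
  integrable s hs := (hf.integrable s hs).congr_fun
    (fun v hv ↦ by simp only [hfg v (le_of_lt hv)]) measurableSet_Ioi
  eq s hs := by
    rw [← hFG s hs, ← hf.eq s hs]
    exact setIntegral_congr_fun measurableSet_Ioi
      (fun v hv ↦ by simp only [hfg v (le_of_lt hv)])

lemma norm_exp_neg_mul {s : ℂ} (hs : s.re = 2) (v : ℝ) :
    ‖Complex.exp (-(s * v))‖ = exp (-(2 * v)) := by
  rw [Complex.norm_exp]
  simp [hs]

lemma exp_mul {α : ℂ} (hα : α.re < 2) :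
    LaplacePair (fun v ↦ Complex.exp (α * v)) (fun s ↦ 1 / (s - α)) where
  cont := by fun_prop
  integrable s hs := by
    have := integrableOn_exp_mul_complex_Ioi (a := α - s) (by simp [hs]; linarith) 0
    refine this.congr_fun (fun v _ ↦ ?_) measurableSet_Ioi
    simp only
    rw [← Complex.exp_add]; congr 1; ring
  eq s hs := by
    have h := integral_exp_mul_complex_Ioi (a := α - s) (by simp [hs]; linarith) 0
    have h2 : ∀ v : ℝ, Complex.exp (-(s * v)) * Complex.exp (α * v) =
        Complex.exp ((α - s) * v) := fun v ↦ by
      rw [← Complex.exp_add]; congr 1; ring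
    simp only [h2, h]
    have : s - α ≠ 0 := fun h0 ↦ by
      have := congrArg Complex.re h0
      simp [hs] at this; linarith
    have h3 : α - s ≠ 0 := fun h0 ↦ this (by rw [← neg_sub, h0, neg_zero])
    simp
    rw [← neg_sub s α, div_neg, neg_div, neg_neg, one_div]

lemma max_sub {c : ℝ} (hc : 0 ≤ c) :
    LaplacePair (fun v ↦ ((max (v - c) 0 : ℝ) : ℂ))
      (fun s ↦ Complex.exp (-(s * c)) / s ^ 2) := by
  have key : ∀ s : ℂ, s.re = 2 →
      IntegrableOn (fun v : ℝ ↦ Complex.exp (-(s * v)) * ((v - c : ℝ) : ℂ)) (Ioi c) := by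
    intro s hs
    have h1 : IntegrableOn (fun v : ℝ ↦ exp (-1 * v)) (Ioi c) :=
      integrableOn_exp_mul_Ioi (by norm_num) c
    refine Integrable.mono' (h1.const_mul (1 : ℝ)) (by fun_prop) ?_
    filter_upwards [ae_restrict_mem measurableSet_Ioi] with v hv
    have hv' : c < v := hv
    rw [norm_mul, norm_exp_neg_mul hs, Complex.norm_real, Real.norm_of_nonneg (by linarith)]
    have h2 : v - c ≤ exp v := by linarith [add_one_le_exp v]
    calc exp (-(2 * v)) * (v - c) ≤ exp (-(2 * v)) * exp v := by gcongr
      _ = 1 * exp (-1 * v) := by rw [← Real.exp_add, one_mul]; congr 1; ring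
  have hval : ∀ s : ℂ, s.re = 2 →
      ∫ v in Ioi c, Complex.exp (-(s * v)) * ((v - c : ℝ) : ℂ) = Complex.exp (-(s * c)) / s ^ 2 := by
    intro s hs
    have hs0 : s ≠ 0 := fun h ↦ by simp [h] at hs
    have hd : ∀ v ∈ Ici c, HasDerivAt
        (fun v : ℝ ↦ -(((v - c : ℝ) : ℂ) / s + 1 / s ^ 2) * Complex.exp (-(s * v)))
        (Complex.exp (-(s * v)) * ((v - c : ℝ) : ℂ)) v := by
      intro v _
      have h1 : HasDerivAt (fun v : ℝ ↦ ((v - c : ℝ) : ℂ)) 1 v :=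
        ((hasDerivAt_id v).sub_const c).ofReal_comp.congr_deriv (by simp)
      have h2 : HasDerivAt (fun v : ℝ ↦ Complex.exp (-(s * v))) (Complex.exp (-(s * v)) * (-(s * 1))) v :=
        (((hasDerivAt_id v).ofReal_comp.congr_deriv (by simp)).const_mul s).neg.cexp
      refine (((h1.div_const s).add_const (1 / s ^ 2)).neg.mul h2).congr_deriv ?_
      simp only [Pi.neg_apply]
      field_simp
      ring
    have ht : Tendsto (fun v : ℝ ↦ -(((v - c : ℝ) : ℂ) / s + 1 / s ^ 2) * Complex.exp (-(s * v)))
        atTop (𝓝 0) := by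
      rw [tendsto_zero_iff_norm_tendsto_zero]
      have hb : Tendsto (fun v : ℝ ↦ (1 / ‖s‖ + 1 / ‖s‖ ^ 2) * exp (-v)) atTop (𝓝 0) := by
        simpa only [mul_zero] using
          (tendsto_exp_neg_atTop_nhds_zero).const_mul (1 / ‖s‖ + 1 / ‖s‖ ^ 2)
      refine squeeze_zero' (Eventually.of_forall fun _ ↦ norm_nonneg _) ?_ hb
      filter_upwards [eventually_ge_atTop c, eventually_ge_atTop 0] with v hv hv0
      rw [norm_mul, norm_neg, norm_exp_neg_mul hs]
      have h2 : v - c ≤ exp v := by linarith [add_one_le_exp v]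
      have h3 : 1 ≤ exp v := Real.one_le_exp hv0
      have h4 : ‖((v - c : ℝ) : ℂ) / s + 1 / s ^ 2‖ ≤ (1 / ‖s‖ + 1 / ‖s‖ ^ 2) * exp v := by
        refine (norm_add_le _ _).trans ?_
        rw [norm_div, norm_div, norm_pow, norm_one, Complex.norm_real,
          Real.norm_of_nonneg (by linarith), add_mul]
        gcongr
        · rw [div_mul_eq_mul_div, one_mul]; gcongr
        · exact le_mul_of_one_le_right (by positivity) h3
      calc _ ≤ ((1 / ‖s‖ + 1 / ‖s‖ ^ 2) * exp v) * exp (-(2 * v)) := by gcongr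
        _ = _ := by rw [mul_assoc, ← Real.exp_add]; congr 2; ring
    have := integral_Ioi_of_hasDerivAt_of_tendsto' hd (key s hs) ht
    rw [this]
    simp
    field_simp
  have hsplit : Ioi (0 : ℝ) = Ioc 0 c ∪ Ioi c := (Ioc_union_Ioi_eq_Ioi hc).symm
  have hz : ∀ s : ℂ, EqOn (fun v : ℝ ↦ Complex.exp (-(s * v)) * ((max (v - c) 0 : ℝ) : ℂ))
      (fun _ ↦ 0) (Ioc 0 c) := fun s v hv ↦ by
    simp only
    rw [max_eq_right (by linarith [hv.2])]; simp
  have hp : ∀ s : ℂ, EqOn (fun v : ℝ ↦ Complex.exp (-(s * v)) * ((max (v - c) 0 : ℝ) : ℂ))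
      (fun v ↦ Complex.exp (-(s * v)) * ((v - c : ℝ) : ℂ)) (Ioi c) := fun s v hv ↦ by
    have hv' : c < v := hv
    simp only
    rw [max_eq_left (by linarith)]
  have i1 : ∀ s : ℂ, IntegrableOn
      (fun v : ℝ ↦ Complex.exp (-(s * v)) * ((max (v - c) 0 : ℝ) : ℂ)) (Ioc 0 c) := fun s ↦
    (integrableOn_zero).congr_fun (hz s).symm measurableSet_Ioc
  have i2 : ∀ s : ℂ, s.re = 2 → IntegrableOn
      (fun v : ℝ ↦ Complex.exp (-(s * v)) * ((max (v - c) 0 : ℝ) : ℂ)) (Ioi c) := fun s hs ↦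
    (key s hs).congr_fun (hp s).symm measurableSet_Ioi
  refine ⟨by fun_prop, fun s hs ↦ ?_, fun s hs ↦ ?_⟩
  · rw [hsplit]; exact (i1 s).union (i2 s hs)
  · rw [hsplit, setIntegral_union (Ioc_disjoint_Ioi le_rfl) measurableSet_Ioi (i1 s) (i2 s hs),
      setIntegral_congr_fun measurableSet_Ioc (hz s), setIntegral_congr_fun measurableSet_Ioi (hp s),
      hval s hs]
    simp

lemma id : LaplacePair (fun v ↦ (v : ℂ)) (fun s ↦ 1 / s ^ 2) :=
  (max_sub le_rfl).congr (fun v hv ↦ by simp [hv]) (fun s _ ↦ by simp)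

lemma tsum {ι : Type*} [Countable ι] {f : ι → ℝ → ℂ} {F : ι → ℂ → ℂ} {a : ι → ℝ}
    (ha : Summable a) (h : ∀ i, LaplacePair (f i) (F i))
    (hb : ∀ i v, 0 ≤ v → ‖f i v‖ ≤ a i * exp (3 / 2 * v)) :
    LaplacePair (fun v ↦ ∑' i, f i v) (fun s ↦ ∑' i, F i s) := by
  have hcont : Continuous (fun v : ℝ ↦ ∑' i, f i (max v 0)) := by
    have h1 : Continuous (fun v : ℝ ↦ ∑' i, Complex.exp (-(3 / 2 * (max v 0 : ℝ) : ℝ)) * f i (max v 0)) := by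
      refine continuous_tsum (u := a) (fun i ↦ ?_) ha (fun i v ↦ ?_)
      · exact (by fun_prop : Continuous _).mul (h i).cont
      · rw [norm_mul, ← Complex.ofReal_neg, ← Complex.ofReal_exp, Complex.norm_real, Real.norm_of_nonneg (exp_pos _).le]
        calc _ ≤ exp (-(3 / 2 * max v 0)) * (a i * exp (3 / 2 * max v 0)) := by
              gcongr; exact hb i _ (le_max_right _ _)
          _ = a i := by rw [mul_left_comm, ← Real.exp_add]; simp
    have h2 : Continuous (fun v : ℝ ↦ Complex.exp ((3 / 2 * (max v 0 : ℝ) : ℝ)) *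
        ∑' i, Complex.exp (-(3 / 2 * (max v 0 : ℝ) : ℝ)) * f i (max v 0)) :=
      (by fun_prop : Continuous _).mul h1
    refine h2.congr fun v ↦ ?_
    rw [tsum_mul_left, ← mul_assoc, ← Complex.exp_add]
    simp
  have hbd : ∀ s : ℂ, s.re = 2 → ∀ i, ∀ v : ℝ, 0 < v →
      ‖Complex.exp (-(s * v)) * f i v‖ ≤ a i * exp (-(1 / 2) * v) := by
    intro s hs i v hv
    rw [norm_mul, norm_exp_neg_mul hs]
    calc _ ≤ exp (-(2 * v)) * (a i * exp (3 / 2 * v)) := by gcongr; exact hb i v hv.le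
      _ = _ := by rw [mul_left_comm, ← Real.exp_add]; congr 2; ring
  have hexp : IntegrableOn (fun v : ℝ ↦ exp (-(1 / 2) * v)) (Ioi 0) :=
    integrableOn_exp_mul_Ioi (by norm_num) 0
  refine ⟨hcont, fun s hs ↦ ?_, fun s hs ↦ ?_⟩
  · have hm : Continuous (fun v : ℝ ↦ Complex.exp (-(s * v)) * ∑' i, f i (max v 0)) :=
      (by fun_prop : Continuous _).mul hcont
    have : IntegrableOn (fun v : ℝ ↦ Complex.exp (-(s * v)) * ∑' i, f i (max v 0)) (Ioi 0) := by
      refine Integrable.mono' (hexp.const_mul (∑' i, a i)) hm.aestronglyMeasurable ?_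
      filter_upwards [ae_restrict_mem measurableSet_Ioi] with v hv
      have hv' : 0 < v := hv
      rw [max_eq_left hv'.le, ← tsum_mul_left, ← tsum_mul_right]
      exact tsum_of_norm_bounded (ha.mul_right _).hasSum (fun i ↦ hbd s hs i v hv')
    refine this.congr_fun (fun v hv ↦ ?_) measurableSet_Ioi
    have hv' : 0 < v := hv
    simp only [max_eq_left hv'.le]
  · have hs1 : Summable (fun i ↦ ∫ v in Ioi (0 : ℝ), ‖Complex.exp (-(s * v)) * f i v‖) := by
      refine Summable.of_nonneg_of_le (fun i ↦ integral_nonneg fun _ ↦ norm_nonneg _) (fun i ↦ ?_)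
        (ha.mul_right (∫ v in Ioi (0 : ℝ), exp (-(1 / 2) * v)))
      rw [← integral_const_mul]
      refine setIntegral_mono_on ((h i).integrable s hs).norm (hexp.const_mul _)
        measurableSet_Ioi (fun v hv ↦ hbd s hs i v hv)
    have := (hasSum_integral_of_summable_integral_norm (fun i ↦ (h i).integrable s hs) hs1).tsum_eq
    simp only [tsum_mul_left] at this
    rw [← this]
    exact tsum_congr fun i ↦ (h i).eq s hs

lemma eq_zero (hf : LaplacePair f (fun _ ↦ 0)) (h0 : f 0 = 0) {v : ℝ} (hv : 0 ≤ v) : f v = 0 := by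
  set h : ℝ → ℂ := fun v ↦ Complex.exp (-(2 * (max v 0 : ℝ))) * f (max v 0) with hh
  have hc : Continuous h := (by fun_prop : Continuous _).mul hf.cont
  have hneg : ∀ v ≤ 0, h v = 0 := fun v hv ↦ by simp [hh, max_eq_right hv, h0]
  have hpos : ∀ v, 0 < v → h v = Complex.exp (-(2 * v)) * f v := fun v hv ↦ by
    simp [hh, max_eq_left hv.le]
  have hi : Integrable h := by
    rw [← integrableOn_univ, ← Iic_union_Ioi (a := (0 : ℝ))]
    refine IntegrableOn.union ?_ ?_
    · exact integrableOn_zero.congr_fun (fun v hv ↦ (hneg v hv).symm) measurableSet_Iic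
    · exact (hf.integrable 2 (by simp)).congr_fun (fun v hv ↦ (hpos v hv).symm) measurableSet_Ioi
  have hF : FourierTransform.fourier h = fun _ ↦ 0 := by
    funext w
    rw [Real.fourier_real_eq_integral_exp_smul]
    have h1 : ∫ v : ℝ, Complex.exp (↑(-2 * π * v * w) * Complex.I) • h v =
        ∫ v in Ioi (0 : ℝ), Complex.exp (↑(-2 * π * v * w) * Complex.I) • h v := by
      symm
      refine setIntegral_eq_integral_of_forall_compl_eq_zero fun v hv ↦ ?_
      rw [hneg v (not_lt.mp hv), smul_zero]
    rw [h1, ← hf.eq (2 + 2 * π * w * Complex.I) (by simp)]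
    refine setIntegral_congr_fun measurableSet_Ioi (fun v hv ↦ ?_)
    rw [hpos v hv, smul_eq_mul, ← mul_assoc, ← Complex.exp_add]
    congr 2
    push_cast; ring
  have hinv := hc.fourierInv_fourier_eq hi (by rw [hF]; exact integrable_zero _ _ _)
  have hz : h v = 0 := by
    rw [← hinv, hF, Real.fourierInv_eq]
    simp only [smul_zero, integral_zero]
  simp only [hh, max_eq_left hv, mul_eq_zero, Complex.exp_ne_zero, false_or] at hz
  exact hz

lemma unique (hf : LaplacePair f F) (hg : LaplacePair g F) (h0 : f 0 = g 0) {v : ℝ}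
    (hv : 0 ≤ v) : f v = g v := by
  have := ((hf.sub hg).congr (fun _ _ ↦ rfl) (G := fun _ ↦ 0) (fun s _ ↦ by simp)).eq_zero
    (by simp [h0]) hv
  exact sub_eq_zero.mp this

end LaplacePair

end PrimeBound

namespace PrimeBound

open Filter Topology MeasureTheory Set Metric
open scoped ComplexConjugate
open scoped ArithmeticFunction.vonMangoldt

instance : Countable XiZero := by
  have h : (⋃ N : ℕ, (zerosIn N : Set XiZero)) = univ := by
    refine eq_univ_of_forall fun ρ ↦ mem_iUnion.mpr ?_
    obtain ⟨N, hN⟩ := exists_nat_ge (dist (ρ : ℂ) (1 / 2))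
    exact ⟨N, by simpa [mem_zerosIn] using hN⟩
  rw [← Set.countable_univ_iff, ← h]
  exact countable_iUnion fun N ↦ (zerosIn N).countable_toSet

lemma XiZero.ne_zero (ρ : XiZero) : (ρ : ℂ) ≠ 0 := fun h ↦ ρ.im_ne_zero (by simp [h])

lemma XiZero.one_sub_ne_zero (ρ : XiZero) : (1 - ρ : ℂ) ≠ 0 := by
  simpa using (reflZero ρ).ne_zero

lemma XiZero.sq_im_pos (ρ : XiZero) : 0 < (ρ : ℂ).im ^ 2 := by linarith [ρ.sq_im_ge]

/-- The primitive `∑ Λ(n) (v - log n)₊` of `v ↦ ψ(exp v)`. -/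
noncomputable def psiOne (v : ℝ) : ℝ := ∑' n : ℕ, Λ n * max (v - log n) 0

lemma psiOne_of_nonpos {v : ℝ} (hv : v ≤ 0) : psiOne v = 0 := by
  have h : ∀ n : ℕ, Λ n * max (v - log n) 0 = 0 := fun n ↦ by
    rw [max_eq_right (by linarith [log_natCast_nonneg n]), mul_zero]
  simp only [psiOne, h, tsum_zero]

lemma max_sub_zero_le_exp (x : ℝ) : max x 0 ≤ exp (3 / 2 * x) := by
  refine max_le ?_ (exp_pos _).le
  rcases le_total x 0 with h | h
  · exact h.trans (exp_pos _).le
  · linarith [add_one_le_exp (3 / 2 * x)]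

lemma laplacePair_psiOne :
    LaplacePair (fun v ↦ (psiOne v : ℂ)) (fun s ↦ zetaLog s / s ^ 2) := by
  have h := LaplacePair.tsum (hasSum_zetaLog_ofReal (σ := 3 / 2) (by norm_num)).summable
    (fun n : ℕ ↦ (LaplacePair.max_sub (c := log n) (log_natCast_nonneg n)).const_mul (Λ n : ℂ))
    (fun n v _ ↦ by
      rw [norm_mul, Complex.norm_real, Complex.norm_real,
        Real.norm_of_nonneg ArithmeticFunction.vonMangoldt_nonneg,
        Real.norm_of_nonneg (le_max_right _ _), mul_assoc, ← Real.exp_add]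
      refine mul_le_mul_of_nonneg_left ?_ ArithmeticFunction.vonMangoldt_nonneg
      refine (max_sub_zero_le_exp _).trans_eq ?_
      congr 1; ring)
  refine h.congr (fun v _ ↦ ?_) (fun s hs ↦ ?_)
  · rw [psiOne, Complex.ofReal_tsum]
    simp only [Complex.ofReal_mul]
  · simp only [← mul_div_assoc, tsum_div_const]
    rw [(hasSum_zetaLog (s := s) (by rw [hs]; norm_num)).tsum_eq]

lemma ne_zero_of_re_eq_two {s : ℂ} (hs : s.re = 2) : s ≠ 0 := fun h ↦ by simp [h] at hs

lemma LaplacePair.exp_sub_one_sub {α : ℂ} (hα : α.re < 2) (h0 : α ≠ 0) :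
    LaplacePair (fun v ↦ (Complex.exp (α * v) - 1 - α * v) / α ^ 2)
      (fun s ↦ 1 / (s ^ 2 * (s - α))) := by
  have h := (((LaplacePair.exp_mul hα).sub (LaplacePair.exp_mul (α := 0) (by simp))).sub
    (LaplacePair.id.const_mul α)).const_mul (1 / α ^ 2)
  refine h.congr (fun v _ ↦ by simp; ring) (fun s hs ↦ ?_)
  have h1 : s - α ≠ 0 := fun h ↦ by
    have := congrArg Complex.re h
    simp [hs] at this; linarith
  have h2 := ne_zero_of_re_eq_two hs
  rw [sub_zero]
  field_simp
  ring

/-- The contribution of the trivial zeros to `psiOne`. -/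
noncomputable def trivialPart (v : ℝ) : ℝ :=
  ∑' k : ℕ, (1 - exp (-(2 * ((k : ℝ) + 1)) * v)) / (4 * ((k : ℝ) + 1) ^ 2)

lemma hasSum_one_div_four_sq :
    HasSum (fun k : ℕ ↦ 1 / (4 * ((k : ℝ) + 1) ^ 2)) (π ^ 2 / 24) := by
  have h := ((hasSum_nat_add_iff' (f := fun n : ℕ ↦ (1 : ℝ) / (n : ℝ) ^ 2) 1).mpr
    hasSum_zeta_two).mul_left (1 / 4)
  refine hasSum_of_eq h (fun k ↦ ?_) (by simp; ring)
  push_cast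
  rw [div_mul_div_comm, mul_one]

lemma trivialPart_term_mem {v : ℝ} (hv : 0 ≤ v) (k : ℕ) :
    0 ≤ (1 - exp (-(2 * ((k : ℝ) + 1)) * v)) / (4 * ((k : ℝ) + 1) ^ 2) ∧
    (1 - exp (-(2 * ((k : ℝ) + 1)) * v)) / (4 * ((k : ℝ) + 1) ^ 2) ≤
      1 / (4 * ((k : ℝ) + 1) ^ 2) := by
  have h1 : exp (-(2 * ((k : ℝ) + 1)) * v) ≤ 1 := exp_le_one_iff.mpr (by
    have : 0 ≤ 2 * ((k : ℝ) + 1) * v := by positivity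
    linarith)
  constructor
  · exact div_nonneg (by linarith) (by positivity)
  · gcongr
    linarith [exp_pos (-(2 * ((k : ℝ) + 1)) * v)]

lemma trivialPart_mem {v : ℝ} (hv : 0 ≤ v) :
    0 ≤ trivialPart v ∧ trivialPart v ≤ π ^ 2 / 24 := by
  refine ⟨tsum_nonneg fun k ↦ (trivialPart_term_mem hv k).1, ?_⟩
  rw [← hasSum_one_div_four_sq.tsum_eq]
  exact Summable.tsum_le_tsum (fun k ↦ (trivialPart_term_mem hv k).2)
    (hasSum_one_div_four_sq.summable.of_nonneg_of_le (fun k ↦ (trivialPart_term_mem hv k).1)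
      (fun k ↦ (trivialPart_term_mem hv k).2)) hasSum_one_div_four_sq.summable

lemma laplacePair_trivialPart : LaplacePair (fun v ↦ (trivialPart v : ℂ))
    (fun s ↦ (1 / 2) * (Complex.digamma (s / 2 + 1) + eulerMascheroniConstant) / s ^ 2) := by
  have h := LaplacePair.tsum hasSum_one_div_four_sq.summable
    (fun k : ℕ ↦ ((LaplacePair.exp_mul (α := 0) (by simp)).sub
      (LaplacePair.exp_mul (α := -(2 * ((k : ℂ) + 1)))
        (by simp; linarith [(k.cast_nonneg : (0 : ℝ) ≤ k)]))).const_mul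
        (1 / (4 * ((k : ℂ) + 1) ^ 2)))
    (fun k v hv ↦ by
      have e : (1 / (4 * ((k : ℂ) + 1) ^ 2)) * (Complex.exp (0 * v) -
          Complex.exp (-(2 * ((k : ℂ) + 1)) * v)) =
          (((1 - exp (-(2 * ((k : ℝ) + 1)) * v)) / (4 * ((k : ℝ) + 1) ^ 2) : ℝ) : ℂ) := by
        push_cast; rw [zero_mul, Complex.exp_zero]; ring
      have := trivialPart_term_mem hv k
      rw [e, Complex.norm_real, Real.norm_of_nonneg this.1]
      refine this.2.trans (le_mul_of_one_le_right (by positivity) ?_)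
      exact Real.one_le_exp (by positivity))
  refine h.congr (fun v _ ↦ ?_) (fun s hs ↦ ?_)
  · rw [trivialPart, Complex.ofReal_tsum]
    refine tsum_congr fun k ↦ ?_
    push_cast; rw [zero_mul, Complex.exp_zero]; ring
  · have hd := (hasSum_digamma (z := s / 2 + 1) (by simp [hs])).mul_left (1 / 2 : ℂ)
    rw [← hd.tsum_eq, ← tsum_div_const]
    refine tsum_congr fun k ↦ ?_
    have h2 := ne_zero_of_re_eq_two hs
    have h3 : (k : ℂ) + 1 ≠ 0 := by exact_mod_cast k.succ_ne_zero
    have h4 : s + 2 * ((k : ℂ) + 1) ≠ 0 := fun h ↦ by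
      have := congrArg Complex.re h
      simp [hs] at this
      have hk : (0 : ℝ) ≤ k := k.cast_nonneg
      linarith
    have h5 : s / 2 + 1 + k = (s + 2 * ((k : ℂ) + 1)) / 2 := by ring
    rw [h5, sub_neg_eq_add, sub_zero]
    generalize hw : s + 2 * ((k : ℂ) + 1) = w at h4
    field_simp
    rw [← hw]
    ring

lemma summable_mult_div_sq_im : Summable (fun ρ : XiZero ↦ mult ρ / (ρ : ℂ).im ^ 2) := by
  refine Summable.of_nonneg_of_le (fun ρ ↦ div_nonneg (mult_nonneg ρ) (by positivity)) (fun ρ ↦ ?_)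
    (summable_mult_div.mul_left (9 / 8))
  have := ρ.sq_im_ge
  rw [mul_div_assoc', div_le_div_iff₀ (by linarith) (by linarith)]
  nlinarith [mult_nonneg ρ]

lemma tsum_mult_div_sq_im_le : ∑' ρ : XiZero, mult ρ / (ρ : ℂ).im ^ 2 ≤ 0.061 := by
  have h1 := hasSum_re_one_div_sub (s := ((3 : ℝ) : ℂ)) (by simp)
  have h2 : HasSum (fun ρ : XiZero ↦ mult ρ * (1 / (((3 : ℝ) : ℂ) - reflZero ρ)).re)
      (logDeriv xi ((3 : ℝ) : ℂ)).re := by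
    simpa only [Function.comp_def, mult_reflZero] using (reflZero.hasSum_iff).mpr h1
  have h3 := (h1.add h2).mul_left (41 / 160)
  rw [summable_mult_div_sq_im.hasSum.tsum_eq]
  refine (hasSum_le (fun ρ ↦ ?_) summable_mult_div_sq_im.hasSum h3).trans ?_
  · have h4 := re_one_div_three_sub_add_ge ρ
    have h5 := ρ.sq_im_ge
    have h6 : 1 / (ρ : ℂ).im ^ 2 ≤ 41 / 160 * (5 / (9 + (ρ : ℂ).im ^ 2)) := by
      rw [div_mul_div_comm, div_le_div_iff₀ (by linarith) (by linarith)]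
      linarith
    rw [← mul_add, mul_left_comm, div_eq_mul_one_div]
    exact mul_le_mul_of_nonneg_left (by linarith) (mult_nonneg ρ)
  · have := logDeriv_xi_three_re_le
    norm_num at this ⊢
    linarith

/-- The contribution of a zero `ρ` to `psiOne`. -/
noncomputable def zeroTerm (ρ : XiZero) (v : ℝ) : ℂ :=
  mult ρ * (Complex.exp (ρ * v) / (ρ : ℂ) ^ 2)

lemma sq_im_le_sq_norm (z : ℂ) : z.im ^ 2 ≤ ‖z‖ ^ 2 := by
  rw [← sq_abs z.im]
  exact pow_le_pow_left₀ (abs_nonneg _) (Complex.abs_im_le_norm z) 2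

lemma norm_zeroTerm_le (ρ : XiZero) (v : ℝ) :
    ‖zeroTerm ρ v‖ ≤ mult ρ / (ρ : ℂ).im ^ 2 * exp (max v 0) := by
  rw [zeroTerm, norm_mul, Complex.norm_real, Real.norm_of_nonneg (mult_nonneg ρ), norm_div,
    norm_pow, Complex.norm_exp, div_mul_eq_mul_div, mul_div_assoc]
  refine mul_le_mul_of_nonneg_left ?_ (mult_nonneg ρ)
  refine div_le_div₀ (exp_pos _).le (exp_le_exp.mpr ?_) ρ.sq_im_pos (sq_im_le_sq_norm _)
  have h1 := ρ.re_pos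
  have h2 := ρ.re_lt_one
  simp only [Complex.re_mul_ofReal]
  rcases le_total v 0 with h | h
  · rw [max_eq_right h]; nlinarith
  · rw [max_eq_left h]; nlinarith

lemma summable_zeroTerm (v : ℝ) : Summable (fun ρ ↦ zeroTerm ρ v) :=
  (summable_mult_div_sq_im.mul_right (exp (max v 0))).of_norm_bounded (fun ρ ↦ norm_zeroTerm_le ρ v)

lemma norm_tsum_zeroTerm_le {v : ℝ} (hv : v ≤ 0) : ‖∑' ρ, zeroTerm ρ v‖ ≤ 0.061 := by
  refine (tsum_of_norm_bounded summable_mult_div_sq_im.hasSum fun ρ ↦ ?_).trans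
    tsum_mult_div_sq_im_le
  simpa [hv] using norm_zeroTerm_le ρ v

/-- The pair contribution of `ρ` and `1 - ρ`, normalised to vanish to second order at `0`. -/
noncomputable def pairLaplaceTerm (ρ : XiZero) (v : ℝ) : ℂ :=
  mult ρ * ((1 / 2) * ((Complex.exp (ρ * v) - 1 - ρ * v) / (ρ : ℂ) ^ 2 +
    (Complex.exp ((1 - ρ) * v) - 1 - (1 - ρ) * v) / (1 - ρ : ℂ) ^ 2))

lemma pairLaplaceTerm_eq (ρ : XiZero) (v : ℝ) :
    pairLaplaceTerm ρ v = (1 / 2) * (zeroTerm ρ v + zeroTerm (reflZero ρ) v) -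
      (1 / 2) * (zeroTerm ρ 0 + zeroTerm (reflZero ρ) 0) -
      v * ((1 / 2) * (mult ρ / ((ρ : ℂ) * (1 - ρ)))) := by
  have h1 := ρ.ne_zero
  have h2 := ρ.one_sub_ne_zero
  simp only [pairLaplaceTerm, zeroTerm, mult_reflZero, coe_reflZero, Complex.ofReal_zero, mul_zero,
    Complex.exp_zero]
  field_simp
  ring

lemma norm_mult_div_mul_le (ρ : XiZero) :
    ‖(mult ρ : ℂ) / ((ρ : ℂ) * (1 - ρ))‖ ≤ mult ρ / (ρ : ℂ).im ^ 2 := by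
  rw [norm_div, Complex.norm_real, Real.norm_of_nonneg (mult_nonneg ρ), norm_mul]
  refine div_le_div_of_nonneg_left (mult_nonneg ρ) ρ.sq_im_pos ?_
  have h1 := Complex.abs_im_le_norm (ρ : ℂ)
  have h2 := Complex.abs_im_le_norm (1 - ρ : ℂ)
  simp only [Complex.sub_im, Complex.one_im, zero_sub, abs_neg] at h2
  rw [← sq_abs, sq]
  gcongr

lemma summable_mult_div_mul : Summable (fun ρ : XiZero ↦ (mult ρ : ℂ) / ((ρ : ℂ) * (1 - ρ))) :=
  summable_mult_div_sq_im.of_norm_bounded norm_mult_div_mul_le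

lemma summable_zeroTerm_reflZero (v : ℝ) : Summable (fun ρ ↦ zeroTerm (reflZero ρ) v) :=
  (reflZero.summable_iff (f := fun ρ ↦ zeroTerm ρ v)).mpr (summable_zeroTerm v)

lemma tsum_pairLaplaceTerm (v : ℝ) :
    ∑' ρ, pairLaplaceTerm ρ v = ∑' ρ, zeroTerm ρ v - ∑' ρ, zeroTerm ρ 0 -
      v * ((1 / 2) * ∑' ρ : XiZero, (mult ρ : ℂ) / ((ρ : ℂ) * (1 - ρ))) := by
  have e : ∀ v, HasSum (fun ρ ↦ (1 / 2) * (zeroTerm ρ v + zeroTerm (reflZero ρ) v))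
      (∑' ρ, zeroTerm ρ v) := fun v ↦ by
    have h := ((summable_zeroTerm v).hasSum.add (summable_zeroTerm_reflZero v).hasSum).mul_left
      (1 / 2 : ℂ)
    have h2 : ∑' ρ, zeroTerm (reflZero ρ) v = ∑' ρ, zeroTerm ρ v :=
      reflZero.tsum_eq (fun ρ ↦ zeroTerm ρ v)
    rw [h2] at h
    have h3 : (1 / 2 : ℂ) * (∑' ρ, zeroTerm ρ v + ∑' ρ, zeroTerm ρ v) = ∑' ρ, zeroTerm ρ v := by
      ring
    rwa [h3] at h
  have := ((e v).sub (e 0)).sub ((summable_mult_div_mul.hasSum.mul_left (1 / 2 : ℂ)).mul_left (v : ℂ))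
  rw [← this.tsum_eq]
  exact tsum_congr fun ρ ↦ pairLaplaceTerm_eq ρ v

lemma norm_pairLaplaceTerm_le (ρ : XiZero) {v : ℝ} (hv : 0 ≤ v) :
    ‖pairLaplaceTerm ρ v‖ ≤ (3 * (mult ρ / (ρ : ℂ).im ^ 2)) * exp (3 / 2 * v) := by
  rw [pairLaplaceTerm_eq]
  have a1 := norm_zeroTerm_le ρ v
  have a2 := norm_zeroTerm_le (reflZero ρ) v
  have a3 := norm_zeroTerm_le ρ 0
  have a4 := norm_zeroTerm_le (reflZero ρ) 0
  have a5 := norm_mult_div_mul_le ρ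
  simp only [mult_reflZero, coe_reflZero, Complex.sub_im, Complex.one_im, zero_sub, neg_sq,
    max_self, exp_zero, mul_one, max_eq_left hv] at a1 a2 a3 a4
  set q := mult ρ / (ρ : ℂ).im ^ 2
  have hq : 0 ≤ q := div_nonneg (mult_nonneg ρ) (sq_nonneg _)
  have n1 : ‖(1 / 2 : ℂ) * (zeroTerm ρ v + zeroTerm (reflZero ρ) v)‖ ≤ q * exp v := by
    rw [norm_mul]
    have := norm_add_le (zeroTerm ρ v) (zeroTerm (reflZero ρ) v)
    norm_num
    linarith
  have n2 : ‖(1 / 2 : ℂ) * (zeroTerm ρ 0 + zeroTerm (reflZero ρ) 0)‖ ≤ q := by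
    rw [norm_mul]
    have := norm_add_le (zeroTerm ρ 0) (zeroTerm (reflZero ρ) 0)
    norm_num
    linarith
  have n3 : ‖(v : ℂ) * ((1 / 2) * (mult ρ / ((ρ : ℂ) * (1 - ρ))))‖ ≤ v * q := by
    rw [norm_mul, norm_mul, Complex.norm_real, Real.norm_of_nonneg hv]
    refine mul_le_mul_of_nonneg_left ?_ hv
    norm_num at a5 ⊢
    linarith
  refine (norm_sub_le _ _).trans ((add_le_add (norm_sub_le _ _) le_rfl).trans
    ((add_le_add (add_le_add n1 n2) n3).trans ?_))
  have e1 : exp v ≤ exp (3 / 2 * v) := exp_le_exp.mpr (by linarith)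
  have e2 := add_one_le_exp (3 / 2 * v)
  have e3 : v ≤ exp (3 / 2 * v) := by linarith
  have e4 : 1 ≤ exp (3 / 2 * v) := by linarith
  nlinarith

lemma laplacePair_tsum_pairLaplaceTerm : LaplacePair (fun v ↦ ∑' ρ, pairLaplaceTerm ρ v)
    (fun s ↦ logDeriv xi s / s ^ 2) := by
  have h := LaplacePair.tsum (summable_mult_div_sq_im.mul_left 3)
    (fun ρ : XiZero ↦ (((LaplacePair.exp_sub_one_sub (by linarith [ρ.re_lt_one]) ρ.ne_zero).add
      (LaplacePair.exp_sub_one_sub (α := 1 - ρ) (by simp; linarith [ρ.re_pos])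
        ρ.one_sub_ne_zero)).const_mul (1 / 2)).const_mul (mult ρ : ℂ))
    (fun ρ v hv ↦ norm_pairLaplaceTerm_le ρ hv)
  refine h.congr (fun v _ ↦ rfl) (fun s hs ↦ ?_)
  have hs1 : 1 < s.re := by rw [hs]; norm_num
  rw [← (hasSum_pairTerm hs1).tsum_eq, ← tsum_div_const]
  refine tsum_congr fun ρ ↦ ?_
  have h1 := sub_ne_zero_of_one_lt_re hs1 ρ
  have h2 := sub_add_ne_zero_of_one_lt_re hs1 ρ
  have h3 := ne_zero_of_re_eq_two hs
  have h4 : s - (1 - ρ) = s - 1 + ρ := by ring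
  rw [pairTerm, h4]
  field_simp

theorem psiOne_eq {v : ℝ} (hv : 0 ≤ v) :
    (psiOne v : ℂ) = (Complex.exp v - 1 - v) + trivialPart v -
      (1 / 2) * ((eulerMascheroniConstant + log π : ℝ) : ℂ) * v - ∑' ρ, pairLaplaceTerm ρ v := by
  have h1 := LaplacePair.exp_sub_one_sub (α := 1) (by norm_num) one_ne_zero
  have h := ((h1.add laplacePair_trivialPart).sub (LaplacePair.id.const_mul
    ((1 / 2) * ((eulerMascheroniConstant + log π : ℝ) : ℂ)))).sub laplacePair_tsum_pairLaplaceTerm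
  have h2 := h.congr (G := fun s ↦ zetaLog s / s ^ 2) (fun v _ ↦ rfl) (fun s hs ↦ by
    have hs1 : 1 < s.re := by rw [hs]; norm_num
    have h3 := ne_zero_of_re_eq_two hs
    have h4 : s - 1 ≠ 0 := fun h ↦ by
      have := congrArg Complex.re h
      simp [hs] at this
      norm_num at this
    rw [zetaLog_eq hs1]
    push_cast
    field_simp
    ring)
  have h3 := laplacePair_psiOne.unique h2 (by
    rw [psiOne_of_nonpos le_rfl, tsum_pairLaplaceTerm]
    simp [trivialPart]) hv
  rw [h3]
  simp

lemma log_pi_le : log π ≤ 1.1553 := by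
  have h := log_le_of_pow_le (x := 3.15) (by norm_num) 5 3 (by norm_num) (by norm_num)
  have h2 : log π ≤ log 3.15 := log_le_log pi_pos pi_lt_d2.le
  have := log_two_lt_d9
  linarith

/-- The explicit formula for `psiOne`. -/
theorem abs_psiOne_sub_le (v : ℝ) :
    |psiOne v - (exp v - (∑' ρ, zeroTerm ρ v).re)| ≤ 2 * (1 + |v|) := by
  rcases le_total v 0 with hv | hv
  · rw [psiOne_of_nonpos hv, abs_of_nonpos hv]
    have h1 := (Complex.abs_re_le_norm _).trans (norm_tsum_zeroTerm_le hv)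
    have h2 : exp v ≤ 1 := exp_le_one_iff.mpr hv
    have h3 := exp_pos v
    rw [abs_le] at h1 ⊢
    constructor <;> linarith [h1.1, h1.2]
  · have h := congrArg Complex.re (psiOne_eq hv)
    rw [tsum_pairLaplaceTerm] at h
    have a1 := (Complex.abs_re_le_norm _).trans (norm_tsum_zeroTerm_le (v := 0) le_rfl)
    have a2 := (Complex.abs_re_le_norm _).trans ((tsum_of_norm_bounded
      summable_mult_div_sq_im.hasSum norm_mult_div_mul_le).trans tsum_mult_div_sq_im_le)
    set A := ∑' ρ, zeroTerm ρ 0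
    set B := ∑' ρ : XiZero, (mult ρ : ℂ) / ((ρ : ℂ) * (1 - ρ))
    set Z := ∑' ρ, zeroTerm ρ v
    have e1 : (v * ((1 / 2) * B) : ℂ).re = v / 2 * B.re := by
      rw [Complex.re_ofReal_mul]
      simp
      ring
    have e2 : ((1 / 2) * ((eulerMascheroniConstant + log π : ℝ) : ℂ) * v).re =
        (eulerMascheroniConstant + log π) / 2 * v := by
      rw [Complex.re_mul_ofReal, show (1 / 2 : ℂ) = ((1 / 2 : ℝ) : ℂ) by norm_num,
        ← Complex.ofReal_mul, Complex.ofReal_re]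
      ring
    simp only [Complex.ofReal_re, Complex.sub_re, Complex.add_re, e1, e2, Complex.one_re,
      Complex.exp_ofReal_re] at h
    have h4 := trivialPart_mem hv
    have h5 := eulerMascheroniConstant_lt_two_thirds
    have h6 := one_half_lt_eulerMascheroniConstant
    have h7 := log_pi_le
    have h8 := log_pi_ge
    have h9 : π ^ 2 / 24 ≤ 0.42 := by nlinarith [pi_lt_d2, pi_pos]
    rw [abs_le] at a1 a2
    rw [abs_of_nonneg hv, h, abs_le]
    have b1 : v / 2 * B.re ≤ v / 2 * 0.061 := mul_le_mul_of_nonneg_left a2.2 (by linarith)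
    have b2 : v / 2 * (-0.061) ≤ v / 2 * B.re := mul_le_mul_of_nonneg_left a2.1 (by linarith)
    have b3 : (eulerMascheroniConstant + log π) / 2 * v ≤ 0.92 * v := by
      gcongr; linarith
    have b4 : 0 ≤ (eulerMascheroniConstant + log π) / 2 * v := by
      apply mul_nonneg _ hv; linarith
    constructor <;> linarith [a1.1, a1.2]

end PrimeBound

namespace PrimeBound

open Filter Topology MeasureTheory Set Metric
open scoped ComplexConjugate
open scoped ArithmeticFunction.vonMangoldt

lemma integrableOn_pow_mul_exp (n : ℕ) {r : ℝ} (hr : 0 < r) :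
    IntegrableOn (fun w : ℝ ↦ w ^ n * exp (-(r * w))) (Ioi 0) := by
  have h := integrableOn_rpow_mul_exp_neg_mul_rpow (p := 1) (s := n)
    (by linarith [(n.cast_nonneg : (0 : ℝ) ≤ n)]) one_pos hr
  refine h.congr_fun (fun w _ ↦ ?_) measurableSet_Ioi
  simp only [rpow_one, rpow_natCast, neg_mul]

lemma integral_pow_mul_exp (n : ℕ) {r : ℝ} (hr : 0 < r) :
    ∫ w in Ioi (0 : ℝ), w ^ n * exp (-(r * w)) = n.factorial / r ^ (n + 1) := by
  have h := Real.integral_rpow_mul_exp_neg_mul_Ioi (a := n + 1)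
    (by linarith [(n.cast_nonneg : (0 : ℝ) ≤ n)]) hr
  rw [Real.Gamma_nat_eq_factorial, add_sub_cancel_right] at h
  simp only [rpow_natCast] at h
  rw [h, ← Nat.cast_succ, rpow_natCast, one_div, inv_pow, Nat.succ_eq_add_one]
  ring

lemma integrableOn_pow_mul_cexp (n : ℕ) {p : ℂ} (hp : 0 < p.re) :
    IntegrableOn (fun w : ℝ ↦ (w : ℂ) ^ n * Complex.exp (-(p * w))) (Ioi 0) := by
  refine Integrable.mono' (integrableOn_pow_mul_exp n hp) (by fun_prop) ?_
  filter_upwards [ae_restrict_mem measurableSet_Ioi] with w hw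
  have hw' : 0 < w := hw
  rw [norm_mul, norm_pow, Complex.norm_real, Real.norm_of_nonneg hw'.le, Complex.norm_exp]
  simp

lemma integral_cexp_neg_mul {p : ℂ} (hp : 0 < p.re) :
    ∫ w in Ioi (0 : ℝ), (w : ℂ) ^ 0 * Complex.exp (-(p * w)) = 1 / p := by
  have h := integral_exp_mul_complex_Ioi (a := -p) (by simpa) 0
  simpa using h

lemma integral_mul_cexp_neg_mul {p : ℂ} (hp : 0 < p.re) :
    ∫ w in Ioi (0 : ℝ), (w : ℂ) ^ 1 * Complex.exp (-(p * w)) = 1 / p ^ 2 := by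
  have hp0 : p ≠ 0 := fun h ↦ by simp [h] at hp
  have hd : ∀ w ∈ Ici (0 : ℝ), HasDerivAt
      (fun w : ℝ ↦ -((w : ℂ) / p + 1 / p ^ 2) * Complex.exp (-(p * w)))
      ((w : ℂ) ^ 1 * Complex.exp (-(p * w))) w := by
    intro w _
    have h1 : HasDerivAt (fun w : ℝ ↦ (w : ℂ)) 1 w := (hasDerivAt_id w).ofReal_comp
    have h2 : HasDerivAt (fun w : ℝ ↦ Complex.exp (-(p * w))) (Complex.exp (-(p * w)) * (-(p * 1))) w :=
      (h1.const_mul p).neg.cexp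
    refine (((h1.div_const p).add_const (1 / p ^ 2)).neg.mul h2).congr_deriv ?_
    simp only [Pi.neg_apply]
    field_simp
    ring
  have ht : Tendsto (fun w : ℝ ↦ -((w : ℂ) / p + 1 / p ^ 2) * Complex.exp (-(p * w)))
      atTop (𝓝 0) := by
    rw [tendsto_zero_iff_norm_tendsto_zero]
    have t1 := (tendsto_rpow_mul_exp_neg_mul_atTop_nhds_zero 1 p.re hp).const_mul (1 / ‖p‖)
    have t2 := (tendsto_rpow_mul_exp_neg_mul_atTop_nhds_zero 0 p.re hp).const_mul (1 / ‖p‖ ^ 2)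
    have hb := t1.add t2
    simp only [mul_zero, add_zero] at hb
    refine squeeze_zero' (Eventually.of_forall fun _ ↦ norm_nonneg _) ?_ hb
    filter_upwards [eventually_ge_atTop 0] with w hw
    rw [norm_mul, norm_neg, Complex.norm_exp, rpow_one, rpow_zero]
    have e1 : (-(p * (w : ℂ))).re = -p.re * w := by simp
    rw [e1]
    have e2 : ‖(w : ℂ) / p + 1 / p ^ 2‖ ≤ w / ‖p‖ + 1 / ‖p‖ ^ 2 := by
      refine (norm_add_le _ _).trans_eq ?_
      rw [norm_div, norm_div, norm_pow, norm_one, Complex.norm_real, Real.norm_of_nonneg hw]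
    calc _ ≤ (w / ‖p‖ + 1 / ‖p‖ ^ 2) * exp (-p.re * w) := by gcongr
      _ = _ := by ring
  rw [integral_Ioi_of_hasDerivAt_of_tendsto' hd (integrableOn_pow_mul_cexp 1 hp) ht]
  simp

/-- Minus the derivative of the Gamma density `w ↦ l ^ 2 * w * exp (-l * w)`. -/
noncomputable def smoothKer (l w : ℝ) : ℝ := l ^ 2 * (l * w - 1) * exp (-(l * w))

lemma smoothKer_eq (l w : ℝ) :
    smoothKer l w = l ^ 3 * (w ^ 1 * exp (-(l * w))) - l ^ 2 * (w ^ 0 * exp (-(l * w))) := by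
  rw [smoothKer]; ring

section Kernel

variable {l : ℝ}

lemma integrableOn_smoothKer (hl : 0 < l) : IntegrableOn (smoothKer l) (Ioi 0) := by
  simp only [funext (smoothKer_eq l)]
  exact ((integrableOn_pow_mul_exp 1 hl).const_mul _).sub ((integrableOn_pow_mul_exp 0 hl).const_mul _)

lemma integral_smoothKer (hl : 0 < l) : ∫ w in Ioi (0 : ℝ), smoothKer l w = 0 := by
  simp only [smoothKer_eq]
  rw [integral_sub ((integrableOn_pow_mul_exp 1 hl).const_mul _)
    ((integrableOn_pow_mul_exp 0 hl).const_mul _), integral_const_mul, integral_const_mul,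
    integral_pow_mul_exp 1 hl, integral_pow_mul_exp 0 hl]
  simp
  field_simp
  ring

lemma mul_smoothKer_eq (l w : ℝ) :
    w * smoothKer l w = l ^ 3 * (w ^ 2 * exp (-(l * w))) - l ^ 2 * (w ^ 1 * exp (-(l * w))) := by
  rw [smoothKer]; ring

lemma integrableOn_mul_smoothKer (hl : 0 < l) :
    IntegrableOn (fun w ↦ w * smoothKer l w) (Ioi 0) := by
  simp only [mul_smoothKer_eq]
  exact ((integrableOn_pow_mul_exp 2 hl).const_mul _).sub ((integrableOn_pow_mul_exp 1 hl).const_mul _)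

lemma integral_mul_smoothKer (hl : 0 < l) : ∫ w in Ioi (0 : ℝ), w * smoothKer l w = 1 := by
  simp only [mul_smoothKer_eq]
  rw [integral_sub ((integrableOn_pow_mul_exp 2 hl).const_mul _)
    ((integrableOn_pow_mul_exp 1 hl).const_mul _), integral_const_mul, integral_const_mul,
    integral_pow_mul_exp 2 hl, integral_pow_mul_exp 1 hl]
  simp [Nat.factorial]
  field_simp
  ring

lemma cexp_mul_smoothKer_eq (l : ℝ) (z : ℂ) (w : ℝ) :
    Complex.exp (z * w) * (smoothKer l w : ℂ) =
      l ^ 3 * ((w : ℂ) ^ 1 * Complex.exp (-((l - z) * w))) -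
      l ^ 2 * ((w : ℂ) ^ 0 * Complex.exp (-((l - z) * w))) := by
  have : Complex.exp (-((l - z) * w)) = Complex.exp (z * w) * Complex.exp (-(l * w)) := by
    rw [← Complex.exp_add]; congr 1; ring
  rw [this, smoothKer]
  push_cast
  ring

lemma integrableOn_cexp_mul_smoothKer {z : ℂ} (hz : z.re < l) :
    IntegrableOn (fun w : ℝ ↦ Complex.exp (z * w) * (smoothKer l w : ℂ)) (Ioi 0) := by
  have hp : 0 < ((l : ℂ) - z).re := by simpa using hz
  simp only [cexp_mul_smoothKer_eq]
  exact ((integrableOn_pow_mul_cexp 1 hp).const_mul _).sub ((integrableOn_pow_mul_cexp 0 hp).const_mul _)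

lemma integral_cexp_mul_smoothKer {z : ℂ} (hz : z.re < l) :
    ∫ w in Ioi (0 : ℝ), Complex.exp (z * w) * (smoothKer l w : ℂ) =
      l ^ 2 * z / (l - z) ^ 2 := by
  have hp : 0 < ((l : ℂ) - z).re := by simpa using hz
  have h0 : (l : ℂ) - z ≠ 0 := fun h ↦ by simp [h] at hp
  simp only [cexp_mul_smoothKer_eq]
  rw [integral_sub ((integrableOn_pow_mul_cexp 1 hp).const_mul _)
    ((integrableOn_pow_mul_cexp 0 hp).const_mul _), integral_const_mul, integral_const_mul,
    integral_mul_cexp_neg_mul hp, integral_cexp_neg_mul hp]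
  simp
  field_simp
  ring

lemma abs_smoothKer_le (hl : 0 < l) {w : ℝ} (hw : 0 ≤ w) :
    |smoothKer l w| ≤ l ^ 3 * (w ^ 1 * exp (-(l * w))) + l ^ 2 * (w ^ 0 * exp (-(l * w))) := by
  rw [smoothKer, abs_mul, abs_mul, abs_of_nonneg (exp_pos _).le, abs_of_nonneg (sq_nonneg l)]
  have h : |l * w - 1| ≤ l * w + 1 := by
    rw [abs_le]; constructor <;> nlinarith
  calc _ ≤ l ^ 2 * (l * w + 1) * exp (-(l * w)) := by gcongr
    _ = _ := by ring

lemma integrableOn_affine_mul_abs_smoothKer (hl : 0 < l) (A : ℝ) :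
    IntegrableOn (fun w ↦ (A + w) * |smoothKer l w|) (Ioi 0) := by
  have h : (fun w ↦ (A + w) * |smoothKer l w|) = fun w ↦ A * |smoothKer l w| + w * |smoothKer l w| := by
    funext w; ring
  rw [h]
  refine ((integrableOn_smoothKer hl).abs.const_mul A).add ?_
  refine IntegrableOn.congr_fun (f := fun w ↦ |w * smoothKer l w|)
    (integrableOn_mul_smoothKer hl).abs (fun w hw ↦ ?_) measurableSet_Ioi
  have hw' : 0 < w := hw
  simp only [abs_mul, abs_of_pos hw']

lemma integral_affine_mul_abs_smoothKer_le (hl : 0 < l) {A : ℝ} (hA : 0 ≤ A) :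
    ∫ w in Ioi (0 : ℝ), (A + w) * |smoothKer l w| ≤ 2 * A * l + 3 := by
  have i : ∀ n, IntegrableOn (fun w : ℝ ↦ w ^ n * exp (-(l * w))) (Ioi 0) := fun n ↦
    integrableOn_pow_mul_exp n hl
  have i01 : IntegrableOn (fun w : ℝ ↦ A * l ^ 2 * (w ^ 0 * exp (-(l * w))) +
      (A * l ^ 3 + l ^ 2) * (w ^ 1 * exp (-(l * w)))) (Ioi 0) :=
    ((i 0).const_mul _).add ((i 1).const_mul _)
  have hle : ∫ w in Ioi (0 : ℝ), (A + w) * |smoothKer l w| ≤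
      ∫ w in Ioi (0 : ℝ), (A * l ^ 2 * (w ^ 0 * exp (-(l * w))) +
        (A * l ^ 3 + l ^ 2) * (w ^ 1 * exp (-(l * w)))) + l ^ 3 * (w ^ 2 * exp (-(l * w))) := by
    refine setIntegral_mono_on (integrableOn_affine_mul_abs_smoothKer hl A)
      (i01.add ((i 2).const_mul _)) measurableSet_Ioi ?_
    intro w hw
    have hw' : 0 < w := hw
    calc _ ≤ (A + w) * (l ^ 3 * (w ^ 1 * exp (-(l * w))) + l ^ 2 * (w ^ 0 * exp (-(l * w)))) := by
          gcongr; exact abs_smoothKer_le hl hw'.le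
      _ = _ := by ring
  refine hle.trans_eq ?_
  rw [integral_add i01 ((i 2).const_mul _),
    integral_add ((i 0).const_mul _) ((i 1).const_mul _), integral_const_mul, integral_const_mul,
    integral_const_mul, integral_pow_mul_exp 0 hl, integral_pow_mul_exp 1 hl,
    integral_pow_mul_exp 2 hl]
  simp [Nat.factorial]
  field_simp
  ring

end Kernel

lemma summable_psiOne (v : ℝ) : Summable (fun n : ℕ ↦ Λ n * max (v - log n) 0) := by
  refine Summable.of_nonneg_of_le
    (fun n ↦ mul_nonneg ArithmeticFunction.vonMangoldt_nonneg (le_max_right _ _)) (fun n ↦ ?_)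
    ((hasSum_zetaLog_ofReal (σ := 3 / 2) (by norm_num)).summable.mul_right (exp (3 / 2 * v)))
  rw [mul_assoc, ← Real.exp_add]
  refine mul_le_mul_of_nonneg_left ?_ ArithmeticFunction.vonMangoldt_nonneg
  refine (max_sub_zero_le_exp _).trans_eq ?_
  congr 1; ring

lemma continuous_psiOne : Continuous psiOne := by
  have h := Complex.continuous_re.comp laplacePair_psiOne.cont
  refine h.congr fun v ↦ ?_
  simp only [Function.comp_apply, Complex.ofReal_re]
  rcases le_total v 0 with hv | hv
  · rw [max_eq_right hv, psiOne_of_nonpos hv, psiOne_of_nonpos le_rfl]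
  · rw [max_eq_left hv]

lemma convexOn_psiOne : ConvexOn ℝ univ psiOne := by
  refine ⟨convex_univ, fun x _ y _ a b ha hb hab ↦ ?_⟩
  simp only [smul_eq_mul, psiOne]
  have h := ((summable_psiOne x).hasSum.mul_left a).add ((summable_psiOne y).hasSum.mul_left b)
  refine hasSum_le (fun n ↦ ?_) (summable_psiOne (a * x + b * y)).hasSum h
  have h1 : max (a * x + b * y - log n) 0 ≤ a * max (x - log n) 0 + b * max (y - log n) 0 := by
    refine max_le ?_ (by positivity)
    have e1 := mul_le_mul_of_nonneg_left (le_max_left (x - log n) 0) ha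
    have e2 := mul_le_mul_of_nonneg_left (le_max_left (y - log n) 0) hb
    have e3 : a * log n + b * log n = log n := by rw [← add_mul, hab, one_mul]
    linarith
  calc _ ≤ Λ n * (a * max (x - log n) 0 + b * max (y - log n) 0) :=
        mul_le_mul_of_nonneg_left h1 ArithmeticFunction.vonMangoldt_nonneg
    _ = _ := by ring

lemma psiOne_add_mul_psi_le (L h : ℝ) :
    psiOne L + h * Chebyshev.psi (exp L) ≤ psiOne (L + h) := by
  have hs : HasSum (fun n : ℕ ↦ if n ∈ Finset.Ioc 0 ⌊exp L⌋₊ then Λ n else 0)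
      (Chebyshev.psi (exp L)) := by
    have h2 : Chebyshev.psi (exp L) =
        ∑ n ∈ Finset.Ioc 0 ⌊exp L⌋₊, if n ∈ Finset.Ioc 0 ⌊exp L⌋₊ then Λ n else 0 :=
      Finset.sum_congr rfl (fun n hn ↦ (if_pos hn).symm)
    rw [h2]
    exact hasSum_sum_of_ne_finset_zero fun n hn ↦ if_neg hn
  refine hasSum_le (fun n ↦ ?_) ((summable_psiOne L).hasSum.add (hs.mul_left h))
    (summable_psiOne (L + h)).hasSum
  rcases Nat.eq_zero_or_pos n with rfl | hn
  · simp
  have hn' : (0 : ℝ) < n := by exact_mod_cast hn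
  have hΛ := ArithmeticFunction.vonMangoldt_nonneg (n := n)
  split_ifs with hm
  · have h1 : (n : ℝ) ≤ exp L := (Nat.le_floor_iff (exp_pos L).le).mp (Finset.mem_Ioc.mp hm).2
    have h2 : log n ≤ L := (log_le_iff_le_exp hn').mpr h1
    rw [max_eq_left (by linarith : 0 ≤ L - log n)]
    calc _ = Λ n * (L + h - log n) := by ring
      _ ≤ _ := mul_le_mul_of_nonneg_left (le_max_left _ _) hΛ
  · have h1 : exp L < n := by
      by_contra hc
      exact hm (Finset.mem_Ioc.mpr ⟨hn, (Nat.le_floor_iff (exp_pos L).le).mpr (not_lt.mp hc)⟩)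
    have h2 : L ≤ log n := (le_log_iff_exp_le hn').mpr h1.le
    rw [max_eq_right (by linarith : L - log n ≤ 0)]
    simp only [mul_zero, add_zero]
    exact mul_nonneg hΛ (le_max_right _ _)

lemma psiOne_le (v : ℝ) : |psiOne v| ≤ 4 * (exp v + 1) + 4 * (1 + |v|) := by
  have h := abs_psiOne_sub_le v
  have h1 := (Complex.abs_re_le_norm _).trans (tsum_of_norm_bounded
    (summable_mult_div_sq_im.hasSum.mul_right (exp (max v 0))) fun ρ ↦ norm_zeroTerm_le ρ v)
  have h2 : exp (max v 0) ≤ exp v + 1 := by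
    rcases le_total v 0 with hv | hv
    · rw [max_eq_right hv, exp_zero]; linarith [exp_pos v]
    · rw [max_eq_left hv]; linarith
  have h3 := tsum_mult_div_sq_im_le
  have h4 : (∑' ρ : XiZero, mult ρ / (ρ : ℂ).im ^ 2) * exp (max v 0) ≤ 1 * (exp v + 1) := by
    gcongr; linarith
  have h5 := exp_pos v
  have h6 := abs_nonneg v
  rw [abs_le] at h h1 ⊢
  constructor <;> linarith [h.1, h.2, h1.1, h1.2]

lemma integrableOn_psiOne_mul_smoothKer {l : ℝ} (hl : 1 < l) (L : ℝ) {ε : ℝ} (hε : |ε| ≤ 1) :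
    IntegrableOn (fun w ↦ psiOne (L + ε * w) * smoothKer l w) (Ioi 0) := by
  have hl0 : 0 < l := by linarith
  have h1 : IntegrableOn (fun w : ℝ ↦ ‖Complex.exp ((ε : ℂ) * w) * (smoothKer l w : ℂ)‖) (Ioi 0) :=
    (integrableOn_cexp_mul_smoothKer (z := (ε : ℂ))
      (by simpa using (le_abs_self ε).trans_lt (hε.trans_lt hl))).norm
  have h2 := ((h1.const_mul (4 * exp L)).add ((integrableOn_smoothKer hl0).abs.const_mul 4)).add
    ((integrableOn_affine_mul_abs_smoothKer hl0 (1 + |L|)).const_mul 4)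
  refine Integrable.mono' h2 (Continuous.aestronglyMeasurable ?_) ?_
  · unfold smoothKer
    exact (continuous_psiOne.comp (by fun_prop)).mul (by fun_prop)
  filter_upwards [ae_restrict_mem measurableSet_Ioi] with w hw
  have hw' : 0 < w := hw
  simp only [Pi.add_apply]
  rw [norm_mul, norm_mul, Complex.norm_exp, Complex.norm_real, Real.norm_eq_abs, Real.norm_eq_abs]
  have e1 := psiOne_le (L + ε * w)
  have e2 : |L + ε * w| ≤ |L| + w := by
    refine (abs_add_le _ _).trans ?_
    rw [abs_mul, abs_of_pos hw']
    nlinarith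
  have e3 : ((ε : ℂ) * w).re = ε * w := by simp
  rw [e3]
  calc _ ≤ (4 * (exp (L + ε * w) + 1) + 4 * (1 + (|L| + w))) * |smoothKer l w| := by
        refine mul_le_mul_of_nonneg_right (e1.trans ?_) (abs_nonneg _)
        linarith
    _ = _ := by rw [Real.exp_add]; ring

/-- Smoothing inequality: `ψ(exp L)` is controlled by an average of `psiOne`. -/
lemma mul_psi_le_integral {l : ℝ} (hl : 1 < l) (L : ℝ) {ε : ℝ} (hε : |ε| ≤ 1) :
    ε * Chebyshev.psi (exp L) ≤ ∫ w in Ioi (0 : ℝ), psiOne (L + ε * w) * smoothKer l w := by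
  have hl0 : 0 < l := by linarith
  set P := Chebyshev.psi (exp L)
  set e : ℝ → ℝ := fun w ↦ psiOne (L + ε * w) - psiOne L - ε * w * P with he
  have he0 : ∀ w, 0 ≤ e w := fun w ↦ by
    have := psiOne_add_mul_psi_le L (ε * w)
    simp only [he]; linarith
  have hconv : ∀ t w, 0 ≤ t → t ≤ 1 → e (t * w) ≤ t * e w := fun t w ht ht1 ↦ by
    have := convexOn_psiOne.2 (mem_univ L) (mem_univ (L + ε * w)) (sub_nonneg.mpr ht1) ht (by ring)
    simp only [smul_eq_mul] at this
    have e1 : (1 - t) * L + t * (L + ε * w) = L + ε * (t * w) := by ring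
    rw [e1] at this
    simp only [he]
    linarith
  set c := l * e (1 / l) with hc
  have hc0 : 0 ≤ c := mul_nonneg hl0.le (he0 _)
  have hpt : ∀ w ∈ Ioi (0 : ℝ), psiOne L * smoothKer l w + (ε * P + c) * (w * smoothKer l w) ≤
      psiOne (L + ε * w) * smoothKer l w := by
    intro w hw
    have hw' : 0 < w := hw
    have hlw : 0 < l * w := mul_pos hl0 hw'
    have key : c * w * smoothKer l w ≤ e w * smoothKer l w := by
      rw [smoothKer]
      rcases le_total 1 (l * w) with h | h
      · have h1 := hconv (1 / (l * w)) w (by positivity) ((div_le_one hlw).mpr h)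
        have h2 : 1 / (l * w) * w = 1 / l := by field_simp
        rw [h2, div_mul_eq_mul_div, one_mul, le_div_iff₀ hlw] at h1
        refine mul_le_mul_of_nonneg_right (by rw [hc]; linarith) ?_
        exact mul_nonneg (mul_nonneg (sq_nonneg _) (by linarith)) (exp_pos _).le
      · have h1 := hconv (l * w) (1 / l) hlw.le h
        have h2 : l * w * (1 / l) = w := by field_simp
        rw [h2] at h1
        refine mul_le_mul_of_nonpos_right (by rw [hc]; linarith) ?_
        exact mul_nonpos_of_nonpos_of_nonneg
          (mul_nonpos_of_nonneg_of_nonpos (sq_nonneg _) (by linarith)) (exp_pos _).le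
    simp only [he] at key
    linarith
  have i1 := (integrableOn_smoothKer hl0).const_mul (psiOne L)
  have i2 := (integrableOn_mul_smoothKer hl0).const_mul (ε * P + c)
  have := setIntegral_mono_on (i1.add i2) (integrableOn_psiOne_mul_smoothKer hl L hε)
    measurableSet_Ioi hpt
  refine le_trans ?_ this
  have e3 : ∫ w in Ioi (0 : ℝ), (psiOne L * smoothKer l w + (ε * P + c) * (w * smoothKer l w)) =
      ε * P + c := by
    rw [integral_add i1 i2, integral_const_mul, integral_const_mul, integral_smoothKer hl0,
      integral_mul_smoothKer hl0]
    ring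
  exact (by linarith : ε * P ≤ ε * P + c).trans_eq e3.symm

end PrimeBound

namespace PrimeBound

open Filter Topology MeasureTheory Set Metric
open scoped ComplexConjugate
open scoped ArithmeticFunction.vonMangoldt

lemma continuous_zeroTerm (ρ : XiZero) : Continuous (zeroTerm ρ) := by
  unfold zeroTerm
  fun_prop

lemma continuous_tsum_zeroTerm : Continuous (fun v ↦ ∑' ρ, zeroTerm ρ v) := by
  have h1 : Continuous (fun v : ℝ ↦ ∑' ρ, Complex.exp (-(max v 0 : ℝ)) * zeroTerm ρ v) := by
    refine continuous_tsum (fun ρ ↦ ?_) summable_mult_div_sq_im (fun ρ v ↦ ?_)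
    · exact (by fun_prop : Continuous _).mul (continuous_zeroTerm ρ)
    · rw [norm_mul, ← Complex.ofReal_neg, ← Complex.ofReal_exp, Complex.norm_real,
        Real.norm_of_nonneg (exp_pos _).le]
      calc _ ≤ exp (-max v 0) * (mult ρ / (ρ : ℂ).im ^ 2 * exp (max v 0)) := by
            gcongr; exact norm_zeroTerm_le ρ v
        _ = _ := by rw [mul_left_comm, ← Real.exp_add]; simp
  have h2 : Continuous (fun v : ℝ ↦ Complex.exp ((max v 0 : ℝ)) *
      ∑' ρ, Complex.exp (-(max v 0 : ℝ)) * zeroTerm ρ v) :=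
    (by fun_prop : Continuous _).mul h1
  refine h2.congr fun v ↦ ?_
  rw [tsum_mul_left, ← mul_assoc, ← Complex.exp_add]
  simp

/-- The weight of a zero in the smoothed explicit formula at `exp L`. -/
noncomputable def zeroWeight (l L : ℝ) (ρ : XiZero) : ℝ :=
  mult ρ * exp ((ρ : ℂ).re * L) * l ^ 2 / (|(ρ : ℂ).im| * ((l - 1) ^ 2 + (ρ : ℂ).im ^ 2))

lemma XiZero.one_le_abs_im (ρ : XiZero) : 1 ≤ |(ρ : ℂ).im| := by
  rw [← one_le_sq_iff_one_le_abs]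
  linarith [ρ.sq_im_ge]

lemma zeroWeight_nonneg (l L : ℝ) (ρ : XiZero) : 0 ≤ zeroWeight l L ρ := by
  have := mult_nonneg ρ
  unfold zeroWeight
  positivity

lemma re_mul_le_abs (ρ : XiZero) (L : ℝ) : (ρ : ℂ).re * L ≤ |L| := by
  refine (le_abs_self _).trans ?_
  rw [abs_mul, abs_of_pos ρ.re_pos]
  exact mul_le_of_le_one_left (abs_nonneg _) ρ.re_lt_one.le

lemma summable_zeroWeight (l L : ℝ) : Summable (zeroWeight l L) := by
  refine Summable.of_nonneg_of_le (zeroWeight_nonneg l L) (fun ρ ↦ ?_)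
    (summable_mult_div_sq_im.mul_left (exp |L| * l ^ 2))
  rw [zeroWeight, mul_div_assoc']
  have h1 := ρ.one_le_abs_im
  have h2 := re_mul_le_abs ρ L
  have h3 := ρ.sq_im_pos
  have h4 := mult_nonneg ρ
  refine div_le_div₀ (by positivity) ?_ h3 ?_
  · calc _ ≤ mult ρ * exp |L| * l ^ 2 := by gcongr
      _ = _ := by ring
  · calc (ρ : ℂ).im ^ 2 ≤ 1 * ((l - 1) ^ 2 + (ρ : ℂ).im ^ 2) := by nlinarith [sq_nonneg (l - 1)]
      _ ≤ _ := by gcongr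

section

variable {l ε : ℝ}

lemma exp_max_le (L : ℝ) (hε : |ε| ≤ 1) {w : ℝ} (hw : 0 ≤ w) :
    exp (max (L + ε * w) 0) ≤ exp |L| * exp w := by
  rw [← Real.exp_add]
  refine exp_le_exp.mpr (max_le ?_ (by positivity))
  have := le_abs_self L
  have := (le_abs_self ε).trans hε
  nlinarith

lemma integrableOn_exp_mul_abs_smoothKer (hl : 1 < l) :
    IntegrableOn (fun w ↦ exp w * |smoothKer l w|) (Ioi 0) := by
  have h := (integrableOn_cexp_mul_smoothKer (l := l) (z := 1) (by simpa)).norm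
  refine IntegrableOn.congr_fun h (fun w _ ↦ ?_) measurableSet_Ioi
  rw [norm_mul, Complex.norm_exp, Complex.norm_real, one_mul, Complex.ofReal_re, Real.norm_eq_abs]

lemma continuous_smoothKer : Continuous (smoothKer l) := by
  unfold smoothKer
  fun_prop

lemma norm_zeroTerm_mul_smoothKer_le (L : ℝ) (hε : |ε| ≤ 1) (ρ : XiZero) {w : ℝ} (hw : 0 ≤ w) :
    ‖zeroTerm ρ (L + ε * w) * (smoothKer l w : ℂ)‖ ≤
      mult ρ / (ρ : ℂ).im ^ 2 * (exp |L| * (exp w * |smoothKer l w|)) := by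
  rw [norm_mul, Complex.norm_real, Real.norm_eq_abs, ← mul_assoc (exp |L|), ← mul_assoc]
  refine mul_le_mul_of_nonneg_right ((norm_zeroTerm_le ρ _).trans ?_) (abs_nonneg _)
  have := mult_nonneg ρ
  gcongr
  exact exp_max_le L hε hw

lemma integrableOn_zeroTerm_mul_smoothKer (hl : 1 < l) (L : ℝ) (hε : |ε| ≤ 1) (ρ : XiZero) :
    IntegrableOn (fun w : ℝ ↦ zeroTerm ρ (L + ε * w) * (smoothKer l w : ℂ)) (Ioi 0) := by
  refine Integrable.mono' (((integrableOn_exp_mul_abs_smoothKer hl).const_mul (exp |L|)).const_mul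
    (mult ρ / (ρ : ℂ).im ^ 2)) (Continuous.aestronglyMeasurable ?_) ?_
  · exact ((continuous_zeroTerm ρ).comp (by fun_prop)).mul
      (Complex.continuous_ofReal.comp continuous_smoothKer)
  · filter_upwards [ae_restrict_mem measurableSet_Ioi] with w hw
    exact norm_zeroTerm_mul_smoothKer_le L hε ρ (le_of_lt hw)

lemma integrableOn_tsum_zeroTerm_mul_smoothKer (hl : 1 < l) (L : ℝ) (hε : |ε| ≤ 1) :
    IntegrableOn (fun w : ℝ ↦ (∑' ρ, zeroTerm ρ (L + ε * w)) * (smoothKer l w : ℂ)) (Ioi 0) := by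
  refine Integrable.mono' (((integrableOn_exp_mul_abs_smoothKer hl).const_mul (exp |L|)).const_mul
    (∑' ρ : XiZero, mult ρ / (ρ : ℂ).im ^ 2)) (Continuous.aestronglyMeasurable ?_) ?_
  · exact (continuous_tsum_zeroTerm.comp (by fun_prop : Continuous fun w : ℝ ↦ L + ε * w)).mul
      (Complex.continuous_ofReal.comp continuous_smoothKer)
  · filter_upwards [ae_restrict_mem measurableSet_Ioi] with w hw
    rw [← tsum_mul_right]
    exact tsum_of_norm_bounded (summable_mult_div_sq_im.hasSum.mul_right _)
      fun ρ ↦ norm_zeroTerm_mul_smoothKer_le L hε ρ (le_of_lt hw)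

lemma integral_zeroTerm_mul_smoothKer (hl : 1 < l) (L : ℝ) (hε : |ε| ≤ 1) (ρ : XiZero) :
    ∫ w in Ioi (0 : ℝ), zeroTerm ρ (L + ε * w) * (smoothKer l w : ℂ) =
      mult ρ * (Complex.exp (ρ * L) / (ρ : ℂ) ^ 2) * (l ^ 2 * (ε * ρ) / (l - ε * ρ) ^ 2) := by
  have h := integral_cexp_mul_smoothKer (l := l) (z := ε * ρ) (by
    rw [Complex.re_ofReal_mul]
    have := re_mul_le_abs ρ ε
    linarith)
  rw [← h, ← integral_const_mul]
  refine integral_congr_ae (Eventually.of_forall fun w ↦ ?_)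
  simp only [zeroTerm]
  have : Complex.exp (ρ * ((L + ε * w : ℝ) : ℂ)) =
      Complex.exp (ρ * L) * Complex.exp (ε * ρ * w) := by
    rw [← Complex.exp_add]; congr 1; push_cast; ring
  rw [this]
  ring

lemma norm_integral_zeroTerm_le (hl : 1 < l) (L : ℝ) (hε : |ε| ≤ 1) (hε2 : ε ^ 2 = 1)
    (ρ : XiZero) :
    ‖∫ w in Ioi (0 : ℝ), zeroTerm ρ (L + ε * w) * (smoothKer l w : ℂ)‖ ≤ zeroWeight l L ρ := by
  rw [integral_zeroTerm_mul_smoothKer hl L hε]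
  have h0 := ρ.ne_zero
  have h1 : mult ρ * (Complex.exp (ρ * L) / (ρ : ℂ) ^ 2) * (l ^ 2 * (ε * ρ) / (l - ε * ρ) ^ 2) =
      mult ρ * Complex.exp (ρ * L) * (l ^ 2 * ε) / (ρ * (l - ε * ρ) ^ 2) := by
    field_simp
  have hε1 : |ε| = 1 := by
    rw [← sq_abs] at hε2
    nlinarith [abs_nonneg ε]
  rw [h1, norm_div, norm_mul, norm_mul, norm_mul, norm_mul, norm_pow, norm_pow, Complex.norm_real,
    Complex.norm_real, Complex.norm_real, Real.norm_eq_abs ε, hε1, mul_one,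
    Real.norm_of_nonneg (mult_nonneg ρ), Real.norm_of_nonneg (by linarith : 0 ≤ l),
    Complex.norm_exp, Complex.re_mul_ofReal, zeroWeight]
  have h2 := ρ.one_le_abs_im
  have h3 := mult_nonneg ρ
  have h4 := re_mul_le_abs ρ ε
  refine div_le_div_of_nonneg_left (by positivity) ?_ ?_
  · have := ρ.sq_im_pos
    positivity
  refine mul_le_mul (Complex.abs_im_le_norm _) ?_ (by positivity) (norm_nonneg _)
  rw [← Complex.normSq_eq_norm_sq, Complex.normSq_apply]
  simp only [Complex.sub_re, Complex.sub_im, Complex.ofReal_re, Complex.ofReal_im,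
    Complex.re_ofReal_mul, Complex.im_ofReal_mul]
  have h5 : ε * (ρ : ℂ).re ≤ 1 := by linarith
  have h6 : (0 - ε * (ρ : ℂ).im) * (0 - ε * (ρ : ℂ).im) = (ρ : ℂ).im ^ 2 := by
    calc _ = ε ^ 2 * (ρ : ℂ).im ^ 2 := by ring
      _ = _ := by rw [hε2, one_mul]
  rw [h6]
  nlinarith

/-- Smoothed explicit formula as an inequality for `ψ`. -/
theorem mul_psi_le (hl : 1 < l) (L : ℝ) (hε2 : ε ^ 2 = 1) :
    ε * Chebyshev.psi (exp L) ≤ exp L * (l ^ 2 * ε / (l - ε) ^ 2) + ∑' ρ, zeroWeight l L ρ +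
      (4 * (1 + |L|) * l + 6) := by
  have hl0 : 0 < l := by linarith
  have hε : |ε| ≤ 1 := by
    rw [← sq_abs] at hε2
    nlinarith [abs_nonneg ε]
  refine (mul_psi_le_integral hl L hε).trans ?_
  have hεl : (ε : ℂ).re < l := by simpa using (le_abs_self ε).trans_lt (hε.trans_lt hl)
  have iE : IntegrableOn (fun w : ℝ ↦ exp (L + ε * w) * smoothKer l w) (Ioi 0) := by
    have h := ((integrableOn_cexp_mul_smoothKer hεl).re).const_mul (exp L)
    refine IntegrableOn.congr_fun h (fun w _ ↦ ?_) measurableSet_Ioi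
    simp only [RCLike.re_to_complex]
    rw [Complex.re_mul_ofReal, ← Complex.ofReal_mul, Complex.exp_ofReal_re, Real.exp_add]
    ring
  have vE : ∫ w in Ioi (0 : ℝ), exp (L + ε * w) * smoothKer l w =
      exp L * (l ^ 2 * ε / (l - ε) ^ 2) := by
    have h := integral_cexp_mul_smoothKer hεl
    have e : ∀ w : ℝ, Complex.exp (ε * w) * (smoothKer l w : ℂ) =
        ((exp (ε * w) * smoothKer l w : ℝ) : ℂ) := fun w ↦ by push_cast; ring
    simp only [e] at h
    rw [integral_complex_ofReal] at h
    have h2 : ∫ w in Ioi (0 : ℝ), exp (ε * w) * smoothKer l w = l ^ 2 * ε / (l - ε) ^ 2 := by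
      exact_mod_cast h
    rw [← h2, ← integral_const_mul]
    refine integral_congr_ae (Eventually.of_forall fun w ↦ ?_)
    simp only
    rw [Real.exp_add]; ring
  have iZ := integrableOn_tsum_zeroTerm_mul_smoothKer hl L hε
  have vZ : |∫ w in Ioi (0 : ℝ), ((∑' ρ, zeroTerm ρ (L + ε * w)) * (smoothKer l w : ℂ)).re| ≤
      ∑' ρ, zeroWeight l L ρ := by
    have hs : Summable fun ρ : XiZero ↦
        ∫ w in Ioi (0 : ℝ), ‖zeroTerm ρ (L + ε * w) * (smoothKer l w : ℂ)‖ := by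
      refine Summable.of_nonneg_of_le (fun ρ ↦ integral_nonneg fun _ ↦ norm_nonneg _) (fun ρ ↦ ?_)
        (summable_mult_div_sq_im.mul_right
          (∫ w in Ioi (0 : ℝ), exp |L| * (exp w * |smoothKer l w|)))
      rw [← integral_const_mul]
      exact setIntegral_mono_on (integrableOn_zeroTerm_mul_smoothKer hl L hε ρ).norm
        (((integrableOn_exp_mul_abs_smoothKer hl).const_mul (exp |L|)).const_mul _)
        measurableSet_Ioi fun w hw ↦ norm_zeroTerm_mul_smoothKer_le L hε ρ (le_of_lt hw)
    have h := (hasSum_integral_of_summable_integral_norm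
      (fun ρ ↦ integrableOn_zeroTerm_mul_smoothKer hl L hε ρ) hs).tsum_eq
    simp only [tsum_mul_right] at h
    have h2 : ∫ w in Ioi (0 : ℝ), ((∑' ρ, zeroTerm ρ (L + ε * w)) * (smoothKer l w : ℂ)).re =
        (∫ w in Ioi (0 : ℝ), (∑' ρ, zeroTerm ρ (L + ε * w)) * (smoothKer l w : ℂ)).re :=
      integral_re iZ
    rw [h2, ← h]
    exact (Complex.abs_re_le_norm _).trans (tsum_of_norm_bounded (summable_zeroWeight l L).hasSum
      fun ρ ↦ norm_integral_zeroTerm_le hl L hε hε2 ρ)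
  have iA := (integrableOn_affine_mul_abs_smoothKer hl0 (1 + |L|)).const_mul 2
  have vA := integral_affine_mul_abs_smoothKer_le hl0 (A := 1 + |L|) (by positivity)
  have iEZ : IntegrableOn (fun w : ℝ ↦ exp (L + ε * w) * smoothKer l w -
      ((∑' ρ, zeroTerm ρ (L + ε * w)) * (smoothKer l w : ℂ)).re) (Ioi 0) := iE.sub iZ.re
  have hle : ∫ w in Ioi (0 : ℝ), psiOne (L + ε * w) * smoothKer l w ≤
      ∫ w in Ioi (0 : ℝ), ((exp (L + ε * w) * smoothKer l w -
        ((∑' ρ, zeroTerm ρ (L + ε * w)) * (smoothKer l w : ℂ)).re) +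
        2 * ((1 + |L| + w) * |smoothKer l w|)) := by
    refine setIntegral_mono_on (integrableOn_psiOne_mul_smoothKer hl L hε) (iEZ.add iA)
      measurableSet_Ioi fun w hw ↦ ?_
    have hw' : 0 < w := hw
    have h1 := abs_psiOne_sub_le (L + ε * w)
    have h2 : |L + ε * w| ≤ |L| + w := by
      refine (abs_add_le _ _).trans ?_
      rw [abs_mul, abs_of_pos hw']
      nlinarith
    have h3 : (psiOne (L + ε * w) - (exp (L + ε * w) - (∑' ρ, zeroTerm ρ (L + ε * w)).re)) *
        smoothKer l w ≤ 2 * (1 + |L| + w) * |smoothKer l w| := by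
      refine (le_abs_self _).trans ?_
      rw [abs_mul]
      gcongr
      linarith
    rw [Complex.re_mul_ofReal]
    linarith
  have vR : ∫ w in Ioi (0 : ℝ), ((∑' ρ, zeroTerm ρ (L + ε * w)) * (smoothKer l w : ℂ)).re ≥
      -∑' ρ, zeroWeight l L ρ := (abs_le.mp vZ).1
  have iZr : IntegrableOn (fun w : ℝ ↦
      ((∑' ρ, zeroTerm ρ (L + ε * w)) * (smoothKer l w : ℂ)).re) (Ioi 0) := iZ.re
  rw [integral_add iEZ iA, integral_sub iE iZr, vE, integral_const_mul] at hle
  linarith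

end

end PrimeBound

namespace PrimeBound
open Filter Topology MeasureTheory Set Metric
open scoped ComplexConjugate
open scoped ArithmeticFunction.vonMangoldt

section

variable {l L q : ℝ}

lemma zeroWeight_eq (l L : ℝ) (ρ : XiZero) :
    zeroWeight l L ρ = exp L * (exp (-(1 - (ρ : ℂ).re) * L) / |(ρ : ℂ).im|) *
      (mult ρ * (l ^ 2 / ((l - 1) ^ 2 + (ρ : ℂ).im ^ 2))) := by
  have h : exp ((ρ : ℂ).re * L) = exp L * exp (-(1 - (ρ : ℂ).re) * L) := by
    rw [← Real.exp_add]; ring_nf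
  rw [zeroWeight, h]
  simp only [div_eq_mul_inv, mul_inv]
  ring

lemma sq_div_le_mul_re_one_div_sub (hl : 1 < l) (ρ : XiZero) :
    l ^ 2 / ((l - 1) ^ 2 + (ρ : ℂ).im ^ 2) ≤
      l ^ 3 / (l - 1) ^ 2 * (1 / ((l : ℂ) - ρ)).re := by
  rw [re_one_div_sub, Complex.ofReal_re, Complex.ofReal_im, zero_sub, neg_sq]
  have h0 := ρ.re_pos
  have h1 := ρ.re_lt_one
  set β := (ρ : ℂ).re
  set g := (ρ : ℂ).im ^ 2
  have hg : 0 ≤ g := sq_nonneg _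
  have hl1 : 0 < l - 1 := by linarith
  have hb : 0 < l - β := by linarith
  rw [div_mul_div_comm, div_le_div_iff₀ (by positivity) (by positivity)]
  have e1 : (l - 1) * ((l - β) ^ 2 + g) ≤ (l - β) * (l * (l - 1) + g) := by
    nlinarith [mul_nonneg hg (by linarith : (0 : ℝ) ≤ 1 - β), mul_pos hb hl1,
      mul_pos (mul_pos hb hl1) h0]
  have e2 : (l - 1) * (l * (l - 1) + g) ≤ l * ((l - 1) ^ 2 + g) := by nlinarith
  have e3 : (l - 1) ^ 2 * ((l - β) ^ 2 + g) ≤ l * (l - β) * ((l - 1) ^ 2 + g) := by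
    calc (l - 1) ^ 2 * ((l - β) ^ 2 + g) = (l - 1) * ((l - 1) * ((l - β) ^ 2 + g)) := by ring
      _ ≤ (l - 1) * ((l - β) * (l * (l - 1) + g)) := by gcongr
      _ = (l - β) * ((l - 1) * (l * (l - 1) + g)) := by ring
      _ ≤ (l - β) * (l * ((l - 1) ^ 2 + g)) := by gcongr
      _ = _ := by ring
  calc l ^ 2 * ((l - 1) ^ 2 * ((l - β) ^ 2 + g))
      ≤ l ^ 2 * (l * (l - β) * ((l - 1) ^ 2 + g)) := by gcongr
    _ = _ := by ring

lemma five_le_abs_im (ρ : XiZero) : 5 ≤ |(ρ : ℂ).im| := by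
  have := ρ.sq_im_ge
  rw [← sq_abs] at this
  nlinarith [abs_nonneg (ρ : ℂ).im]

lemma exp_div_abs_im_le_of_le_half (hL : 0 ≤ L) {ρ : XiZero} (h : (ρ : ℂ).re ≤ 1 / 2) :
    exp (-(1 - (ρ : ℂ).re) * L) / |(ρ : ℂ).im| ≤ exp (-L / 2) / 5 := by
  have := five_le_abs_im ρ
  gcongr
  nlinarith

lemma exp_div_abs_im_add_refl_le (hL : 0 ≤ L) (hq0 : 0 ≤ q)
    (hq : ∀ ρ : XiZero, 1 / 2 < (ρ : ℂ).re → exp (-(1 - (ρ : ℂ).re) * L) / |(ρ : ℂ).im| ≤ q)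
    (ρ : XiZero) :
    exp (-(1 - (ρ : ℂ).re) * L) / |(ρ : ℂ).im| +
      exp (-(1 - (reflZero ρ : ℂ).re) * L) / |(reflZero ρ : ℂ).im| ≤ q + 0.4 * exp (-L / 2) := by
  have hr : (reflZero ρ : ℂ).re = 1 - (ρ : ℂ).re := by simp
  have hp := exp_pos (-L / 2)
  rcases lt_or_ge (1 / 2) (ρ : ℂ).re with h | h
  · have h1 := hq ρ h
    have h2 := exp_div_abs_im_le_of_le_half hL (ρ := reflZero ρ) (by rw [hr]; linarith)
    linarith
  · have h1 := exp_div_abs_im_le_of_le_half hL h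
    rcases lt_or_ge (1 / 2) (reflZero ρ : ℂ).re with h' | h'
    · have h2 := hq _ h'
      linarith
    · have h2 := exp_div_abs_im_le_of_le_half hL h'
      linarith

lemma tsum_zeroWeight_le (hl : 1 < l) (hL : 0 ≤ L) (hq0 : 0 ≤ q)
    (hq : ∀ ρ : XiZero, 1 / 2 < (ρ : ℂ).re → exp (-(1 - (ρ : ℂ).re) * L) / |(ρ : ℂ).im| ≤ q) :
    ∑' ρ, zeroWeight l L ρ ≤ exp L * ((q + 0.4 * exp (-L / 2)) / 2 * (l ^ 3 / (l - 1) ^ 2) *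
      (1 / (l - 1) + log ((l + 2) / (2 * π)) / 2)) := by
  have hs := summable_zeroWeight l L
  have hs' : Summable fun ρ ↦ zeroWeight l L (reflZero ρ) := (reflZero.summable_iff).mpr hs
  have hX := hasSum_re_one_div_sub (s := (l : ℂ)) (by simpa using hl.le)
  have hX' := logDeriv_xi_ofReal_re_le hl
  set c := exp L * (q + 0.4 * exp (-L / 2)) * (l ^ 3 / (l - 1) ^ 2) with hc
  have hl1 : 0 < l - 1 := by linarith
  have hc0 : 0 ≤ c := by positivity
  have hpt (ρ : XiZero) : zeroWeight l L ρ + zeroWeight l L (reflZero ρ) ≤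
      c * (mult ρ * (1 / ((l : ℂ) - ρ)).re) := by
    have hm := mult_nonneg ρ
    have h1 := exp_div_abs_im_add_refl_le hL hq0 hq ρ
    have h2 := sq_div_le_mul_re_one_div_sub hl ρ
    have hi : (reflZero ρ : ℂ).im ^ 2 = (ρ : ℂ).im ^ 2 := by simp
    rw [zeroWeight_eq, zeroWeight_eq l L (reflZero ρ), hi, mult_reflZero, ← add_mul, ← mul_add]
    calc _ ≤ exp L * (q + 0.4 * exp (-L / 2)) *
          (mult ρ * (l ^ 3 / (l - 1) ^ 2 * (1 / ((l : ℂ) - ρ)).re)) := by gcongr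
      _ = _ := by rw [hc]; ring
  have h2 : ∑' ρ, zeroWeight l L ρ + ∑' ρ, zeroWeight l L (reflZero ρ) ≤
      c * (logDeriv xi (l : ℂ)).re := by
    rw [← hs.tsum_add hs', ← hX.tsum_eq, ← tsum_mul_left]
    exact (hs.add hs').tsum_le_tsum hpt (hX.summable.mul_left c)
  rw [reflZero.tsum_eq (zeroWeight l L)] at h2
  have h3 : c * (logDeriv xi (l : ℂ)).re ≤ c * (1 / (l - 1) + log ((l + 2) / (2 * π)) / 2) := by
    gcongr
  calc ∑' ρ, zeroWeight l L ρ ≤ c * (1 / (l - 1) + log ((l + 2) / (2 * π)) / 2) / 2 := by linarith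
    _ = _ := by rw [hc]; ring

end

/-- The AM-GM step: the zero-free region turned into a bound on `x ^ (β - 1) / |γ|`. -/
lemma exp_div_abs_im_le (s : ℝ) {ρ : XiZero} (hρ : 1 / 2 < (ρ : ℂ).re) :
    exp (-(1 - (ρ : ℂ).re) * (7.4751 * s ^ 2)) / |(ρ : ℂ).im| ≤
      max (0.0482 * exp (-2 * s)) (0.1155 * exp (-0.1 * (7.4751 * s ^ 2))) := by
  rcases lt_or_ge (ρ : ℂ).re (9 / 10) with h | h
  · refine le_trans ?_ (le_max_right _ _)
    have h1 := ρ.sq_im_ge_of_re_ne (by norm_num; linarith)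
    rw [← sq_abs] at h1
    have h2 : 8.66 ≤ |(ρ : ℂ).im| := by nlinarith [abs_nonneg (ρ : ℂ).im]
    rw [div_le_iff₀ (by linarith)]
    have h3 : exp (-(1 - (ρ : ℂ).re) * (7.4751 * s ^ 2)) ≤ exp (-0.1 * (7.4751 * s ^ 2)) := by
      apply exp_le_exp.mpr
      have : 0 ≤ 7.4751 * s ^ 2 := by positivity
      nlinarith
    nlinarith [exp_pos (-0.1 * (7.4751 * s ^ 2))]
  · refine le_trans ?_ (le_max_left _ _)
    obtain ⟨hγ, hb⟩ : 77 ≤ |(ρ : ℂ).im| ∧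
        1 / (1 - (ρ : ℂ).re) ≤ 7.4751 * log (|(ρ : ℂ).im| / (2 * π)) - 8.94 := by
      rcases lt_or_gt_of_ne ρ.im_ne_zero with h0 | h0
      · have := zero_free (conjZero ρ) (by simpa using h) (by simpa using h0)
        rw [abs_of_neg h0]
        simpa using this
      · rw [abs_of_pos h0]
        exact zero_free ρ h h0
    set b := 1 - (ρ : ℂ).re with hbdef
    have hb0 : 0 < b := by have := ρ.re_lt_one; linarith
    set γ := |(ρ : ℂ).im|
    set ℓ := log (γ / (2 * π)) with hℓ
    have hγ0 : 0 < γ := by linarith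
    have hγe : γ = 2 * π * exp ℓ := by
      rw [hℓ, exp_log (by positivity)]
      field_simp
    have hv : 1 ≤ b * (7.4751 * ℓ - 8.94) := by
      rw [div_le_iff₀ hb0] at hb; linarith
    have key : 2 * s + 1.1959 ≤ b * (7.4751 * s ^ 2) + ℓ := by
      set v := 7.4751 * ℓ - 8.94 with hvd
      have hv0 : 0 < v := by by_contra! hn; nlinarith
      have : 2 * s * 7.4751 ≤ 7.4751 * (b * (7.4751 * s ^ 2)) + v := by
        have h5 : 7.4751 * s ^ 2 * 7.4751 ≤ 7.4751 * (b * (7.4751 * s ^ 2)) * v := by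
          nlinarith [sq_nonneg s]
        by_contra! hn
        nlinarith [sq_nonneg (7.4751 * s - v)]
      linarith
    rw [hγe, div_le_iff₀ (by positivity)]
    have hpi := pi_gt_d4
    have he : 3.3055 ≤ exp 1.1959 := by
      refine le_trans ?_ (Real.sum_le_exp_of_nonneg (by norm_num) 8)
      norm_num [Finset.sum_range_succ, Nat.factorial]
    have h6 : exp (-b * (7.4751 * s ^ 2)) * exp 1.1959 ≤ exp (-2 * s) * exp ℓ := by
      rw [← Real.exp_add, ← Real.exp_add]
      exact exp_le_exp.mpr (by linarith)
    have h7 : 0 < exp (-2 * s) * exp ℓ := by positivity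
    have h8 : exp (-b * (7.4751 * s ^ 2)) * 3.3055 ≤ exp (-2 * s) * exp ℓ :=
      le_trans (by gcongr) h6
    nlinarith

end PrimeBound

namespace PrimeBound
open Filter Topology MeasureTheory Set Metric
open scoped ComplexConjugate
open scoped ArithmeticFunction.vonMangoldt

lemma pow_mul_exp_neg_le (n : ℕ) {c A L : ℝ} (hA : 0 < A) (hL : 0 ≤ L)
    (h : (n - c * A) * (L - A) ≤ 0) : L ^ n * exp (-c * L) ≤ A ^ n * exp (-c * A) := by
  have h1 : L ≤ A * exp (L / A - 1) := by
    have := add_one_le_exp (L / A - 1)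
    have h2 : A * (L / A) = L := by field_simp
    nlinarith
  calc L ^ n * exp (-c * L) ≤ (A * exp (L / A - 1)) ^ n * exp (-c * L) := by gcongr
    _ = A ^ n * exp (n * (L / A - 1) + -c * L) := by
      rw [mul_pow, ← exp_nat_mul, mul_assoc, ← Real.exp_add]
    _ ≤ A ^ n * exp (-c * A) := by
      gcongr
      have h3 : (n * (L / A - 1) + -c * L + c * A) = (n - c * A) * (L - A) / A := by
        field_simp; ring
      have h4 : (n - c * A) * (L - A) / A ≤ 0 := div_nonpos_of_nonpos_of_nonneg h hA.le
      linarith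

lemma exp_neg_le_of_sum (n : ℕ) {x c : ℝ} (hx : 0 ≤ x)
    (h : 1 ≤ c * ∑ i ∈ Finset.range n, x ^ i / i.factorial) : exp (-x) ≤ c := by
  have h1 := Real.sum_le_exp_of_nonneg hx n
  have h2 : 0 ≤ ∑ i ∈ Finset.range n, x ^ i / (i.factorial : ℝ) :=
    Finset.sum_nonneg fun i _ ↦ by positivity
  have hc : 0 < c := by
    by_contra! hn
    nlinarith
  rw [exp_neg, inv_le_comm₀ (exp_pos x) hc]
  rw [← one_div, div_le_iff₀ hc]
  nlinarith

lemma log_le_of_sum (n : ℕ) {y c : ℝ} (hy : 0 < y) (hc : 0 ≤ c)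
    (h : y ≤ ∑ i ∈ Finset.range n, c ^ i / i.factorial) : log y ≤ c := by
  rw [log_le_iff_le_exp hy]
  exact h.trans (Real.sum_le_exp_of_nonneg hc n)

lemma log_le_div_sub_add {y w c : ℝ} (hy : 0 < y) (hw : 0 < w) (hc : log w ≤ c) :
    log y ≤ y / w - 1 + c := by
  have h1 := log_le_sub_one_of_pos (div_pos hy hw)
  rw [log_div hy.ne' hw.ne'] at h1
  linarith

/-- The relative error in the smoothed explicit formula, multiplied by `L ^ 2`. -/
lemma error_le {L q q₀ d r X z : ℝ} (hL : 21 ≤ L) (hq : q + 0.4 * exp (-L / 2) ≤ q₀)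
    (hq0 : 0 ≤ q)
    (hd : L ^ 2 * (2 * (L ^ 2 / 44) - 1) ≤ d * (L ^ 2 / 44 - 1) ^ 2)
    (hr : (L ^ 2 / 44) ^ 2 ≤ r * (L ^ 2 / 44 - 1) ^ 2)
    (hX : 1 / (L ^ 2 / 44 - 1) + log ((L ^ 2 / 44 + 2) / (2 * π)) / 2 ≤ X)
    (hz : L ^ 4 / 88 * q₀ * r * X ≤ z) (hX0 : 0 ≤ X) :
    L ^ 2 * (((L ^ 2 / 44) ^ 2 / (L ^ 2 / 44 - 1) ^ 2 - 1) +
      (q + 0.4 * exp (-L / 2)) / 2 * ((L ^ 2 / 44) ^ 3 / (L ^ 2 / 44 - 1) ^ 2) *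
      (1 / (L ^ 2 / 44 - 1) + log ((L ^ 2 / 44 + 2) / (2 * π)) / 2)) ≤ d + z := by
  set l := L ^ 2 / 44 with hl
  have hl10 : 10 ≤ l := by rw [hl]; nlinarith
  have hl1 : 0 < l - 1 := by linarith
  have hL2 : L ^ 2 = 44 * l := by rw [hl]; ring
  have e1 : L ^ 2 * (l ^ 2 / (l - 1) ^ 2 - 1) ≤ d := by
    have : L ^ 2 * (l ^ 2 / (l - 1) ^ 2 - 1) = L ^ 2 * (2 * l - 1) / (l - 1) ^ 2 := by
      field_simp; ring
    rw [this, div_le_iff₀ (by positivity)]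
    exact hd
  have hq1 : 0 ≤ q + 0.4 * exp (-L / 2) := by positivity
  have hq2 : 0 ≤ q₀ := hq1.trans hq
  have hr' : l ^ 2 / (l - 1) ^ 2 ≤ r := by rw [div_le_iff₀ (by positivity)]; exact hr
  have e2 : L ^ 2 * ((q + 0.4 * exp (-L / 2)) / 2 * (l ^ 3 / (l - 1) ^ 2) *
      (1 / (l - 1) + log ((l + 2) / (2 * π)) / 2)) ≤ z := by
    refine le_trans ?_ hz
    calc _ ≤ L ^ 2 * ((q + 0.4 * exp (-L / 2)) / 2 * (l ^ 3 / (l - 1) ^ 2) * X) := by gcongr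
      _ = L ^ 4 / 88 * (q + 0.4 * exp (-L / 2)) * (l ^ 2 / (l - 1) ^ 2) * X := by
        rw [show L ^ 4 = 44 * l * L ^ 2 by rw [← hL2]; ring]; ring
      _ ≤ _ := by gcongr
  linarith

lemma four_mul_exp_le {L : ℝ} (hL : 21 ≤ L) :
    0.4 * exp (-L / 2) ≤ 0.0001 * exp (-0.1 * L) := by
  have h1 : exp (-L / 2) ≤ exp (-8.4) * exp (-0.1 * L) := by
    rw [← Real.exp_add]; exact exp_le_exp.mpr (by linarith)
  have h2 : exp (-8.4) ≤ 0.00024 := by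
    refine exp_neg_le_of_sum 25 (by norm_num) ?_
    norm_num [Finset.sum_range_succ, Nat.factorial]
  nlinarith [exp_pos (-0.1 * L)]

lemma error_le_of_le {L q A d r Y X : ℝ} (hL : 21 ≤ L) (hLA : L ≤ A) (hA : A ≤ 40)
    (hq0 : 0 ≤ q) (hq : q ≤ 0.1156 * exp (-0.1 * L))
    (hd : L ^ 2 * (2 * (L ^ 2 / 44) - 1) ≤ d * (L ^ 2 / 44 - 1) ^ 2)
    (hr : (L ^ 2 / 44) ^ 2 ≤ r * (L ^ 2 / 44 - 1) ^ 2)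
    (hY : 1 ≤ Y * (L ^ 2 / 44 - 1))
    (hX : (A ^ 2 / 44 + 2) / 6.283 ≤ ∑ i ∈ Finset.range 12, X ^ i / i.factorial) (hX0 : 0 ≤ X)
    (hz : A ^ 4 / 88 * 0.1157 * r * (Y + X / 2) ≤
      (165 - d) * ∑ i ∈ Finset.range 12, (0.1 * A) ^ i / i.factorial) :
    L ^ 2 * (((L ^ 2 / 44) ^ 2 / (L ^ 2 / 44 - 1) ^ 2 - 1) +
      (q + 0.4 * exp (-L / 2)) / 2 * ((L ^ 2 / 44) ^ 3 / (L ^ 2 / 44 - 1) ^ 2) *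
      (1 / (L ^ 2 / 44 - 1) + log ((L ^ 2 / 44 + 2) / (2 * π)) / 2)) ≤ 165 := by
  have hl1 : 0 < L ^ 2 / 44 - 1 := by nlinarith
  have hr0 : 0 ≤ r := by
    by_contra! hn
    nlinarith [sq_nonneg (L ^ 2 / 44), sq_pos_of_pos hl1]
  have hY' : 1 / (L ^ 2 / 44 - 1) ≤ Y := by rwa [div_le_iff₀ hl1]
  have hY0 : 0 ≤ Y := le_trans (by positivity) hY'
  have hpi := pi_gt_d4
  have hlog : log ((L ^ 2 / 44 + 2) / (2 * π)) ≤ X := by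
    refine log_le_of_sum 12 (by positivity) hX0 (le_trans ?_ hX)
    gcongr
    linarith
  have hp := pow_mul_exp_neg_le 4 (c := 0.1) (A := A) (L := L) (by linarith) (by linarith)
    (by push_cast; nlinarith)
  have hq1 := four_mul_exp_le hL
  have hz2 : A ^ 4 / 88 * 0.1157 * r * (Y + X / 2) * exp (-0.1 * A) ≤ 165 - d := by
    have h1 := Real.sum_le_exp_of_nonneg (x := 0.1 * A) (by linarith) 12
    have h2 : 0 ≤ A ^ 4 / 88 * 0.1157 * r * (Y + X / 2) := by positivity
    have h3 : 0 < ∑ i ∈ Finset.range 12, (0.1 * A) ^ i / (i.factorial : ℝ) :=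
      Finset.sum_pos (fun i _ ↦ by have : 0 < A := by linarith
                                   positivity) (by simp)
    have h4 : 0 ≤ 165 - d := by
      by_contra! hn
      nlinarith
    rw [neg_mul, exp_neg, ← div_eq_mul_inv, div_le_iff₀ (exp_pos _)]
    exact hz.trans (by gcongr)
  have := error_le (q₀ := 0.1157 * exp (-0.1 * L)) (d := d) (r := r) (X := Y + X / 2)
    (z := 165 - d) hL (by linarith) hq0 hd hr (by linarith) ?_ (by positivity)
  · linarith
  · calc L ^ 4 / 88 * (0.1157 * exp (-0.1 * L)) * r * (Y + X / 2)
        = L ^ 4 * exp (-0.1 * L) * (0.1157 / 88 * r * (Y + X / 2)) := by ring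
      _ ≤ A ^ 4 * exp (-0.1 * A) * (0.1157 / 88 * r * (Y + X / 2)) := by gcongr
      _ = A ^ 4 / 88 * 0.1157 * r * (Y + X / 2) * exp (-0.1 * A) := by ring
      _ ≤ _ := hz2

lemma error_le_moderate {L q : ℝ} (hL : 21 ≤ L) (hq0 : 0 ≤ q)
    (hq : q ≤ 0.1156 * exp (-0.1 * L)) :
    L ^ 2 * (((L ^ 2 / 44) ^ 2 / (L ^ 2 / 44 - 1) ^ 2 - 1) +
      (q + 0.4 * exp (-L / 2)) / 2 * ((L ^ 2 / 44) ^ 3 / (L ^ 2 / 44 - 1) ^ 2) *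
      (1 / (L ^ 2 / 44 - 1) + log ((L ^ 2 / 44 + 2) / (2 * π)) / 2)) ≤ 165 := by
  rcases le_total L 28 with h28 | h28
  · have hl : 10.02 ≤ L ^ 2 / 44 := by nlinarith
    refine error_le_of_le (A := 28) (d := 104) (r := 1.24) (Y := 0.111) (X := 1.16) hL h28
      (by norm_num) hq0 hq ?_ ?_ ?_ ?_ (by norm_num) ?_
    · have : L ^ 2 = 44 * (L ^ 2 / 44) := by ring
      rw [this]; generalize L ^ 2 / 44 = l at *; nlinarith
    · generalize L ^ 2 / 44 = l at *; nlinarith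
    · linarith
    · norm_num [Finset.sum_range_succ, Nat.factorial]
    · norm_num [Finset.sum_range_succ, Nat.factorial]
  rcases le_total L 40 with h40 | h40
  · have hl : 17.8 ≤ L ^ 2 / 44 := by nlinarith
    refine error_le_of_le (A := 40) (d := 96.1) (r := 1.1228) (Y := 0.0596) (X := 1.82) hL h40
      (by norm_num) hq0 hq ?_ ?_ ?_ ?_ (by norm_num) ?_
    · have : L ^ 2 = 44 * (L ^ 2 / 44) := by ring
      rw [this]; generalize L ^ 2 / 44 = l at *; nlinarith
    · generalize L ^ 2 / 44 = l at *; nlinarith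
    · linarith
    · norm_num [Finset.sum_range_succ, Nat.factorial]
    · norm_num [Finset.sum_range_succ, Nat.factorial]
  have hl : 36.36 ≤ L ^ 2 / 44 := by nlinarith
  have hpi := pi_gt_d4
  have hlog : log ((L ^ 2 / 44 + 2) / (2 * π)) ≤ 2 * (L / 42.68 - 1 + 0.97) := by
    have h1 : (L ^ 2 / 44 + 2) / (2 * π) ≤ (L / 16.18) ^ 2 := by
      rw [div_le_iff₀ (by positivity)]
      have h4 : (L / 16.18) ^ 2 * (2 * 3.1415) ≤ (L / 16.18) ^ 2 * (2 * π) := by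
        gcongr
      have h5 : 40 ^ 2 ≤ L ^ 2 := by gcongr
      refine le_trans ?_ h4
      rw [show (L / 16.18) ^ 2 * (2 * 3.1415) = L ^ 2 * (6.283 / 261.7924) by ring]
      linarith
    have h2 := log_le_div_sub_add (y := L / 16.18) (w := 42.68 / 16.18) (c := 0.97)
      (by positivity) (by norm_num)
      (log_le_of_sum 12 (by norm_num) (by norm_num)
        (by norm_num [Finset.sum_range_succ, Nat.factorial]))
    have h3 := log_le_log (by positivity) h1
    rw [log_pow] at h3
    push_cast at h3
    have h4 : L / 16.18 / (42.68 / 16.18) = L / 42.68 := by field_simp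
    rw [h4] at h2
    linarith
  have hY : 1 / (L ^ 2 / 44 - 1) ≤ 0.0283 := by
    rw [div_le_iff₀ (by linarith)]; linarith
  have hp := pow_mul_exp_neg_le 5 (c := 0.1) (A := 50) (L := L) (by norm_num) (by linarith)
    (by norm_num)
  have hq1 := four_mul_exp_le hL
  have he : exp (-0.1 * 50) ≤ 0.00674 := by
    rw [neg_mul]
    refine exp_neg_le_of_sum 25 (by norm_num) ?_
    norm_num [Finset.sum_range_succ, Nat.factorial]
  have hp' : L ^ 5 * exp (-0.1 * L) ≤ 50 ^ 5 * 0.00674 := hp.trans (by gcongr)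
  have := error_le (q₀ := 0.1157 * exp (-0.1 * L)) (d := 91.8) (r := 1.0576) (X := L / 42.68)
    (z := 73) hL (by linarith) hq0 ?_ ?_ (by linarith) ?_ (by positivity)
  · linarith
  · have : L ^ 2 = 44 * (L ^ 2 / 44) := by ring
    rw [this]; generalize L ^ 2 / 44 = l at *; nlinarith
  · generalize L ^ 2 / 44 = l at *; nlinarith
  · calc L ^ 4 / 88 * (0.1157 * exp (-0.1 * L)) * 1.0576 * (L / 42.68)
        = L ^ 5 * exp (-0.1 * L) * (0.1157 / 88 * 1.0576 / 42.68) := by ring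
      _ ≤ 50 ^ 5 * 0.00674 * (0.1157 / 88 * 1.0576 / 42.68) :=
        mul_le_mul_of_nonneg_right hp' (by norm_num)
      _ ≤ 73 := by norm_num

lemma error_le_large {s q : ℝ} (hs : 3.058 ≤ s) (hq0 : 0 ≤ q)
    (hq : q + 0.4 * exp (-(7.4751 * s ^ 2) / 2) ≤ 0.0483 * exp (-2 * s)) :
    (7.4751 * s ^ 2) ^ 2 * ((((7.4751 * s ^ 2) ^ 2 / 44) ^ 2 /
        ((7.4751 * s ^ 2) ^ 2 / 44 - 1) ^ 2 - 1) +
      (q + 0.4 * exp (-(7.4751 * s ^ 2) / 2)) / 2 * (((7.4751 * s ^ 2) ^ 2 / 44) ^ 3 /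
        ((7.4751 * s ^ 2) ^ 2 / 44 - 1) ^ 2) *
      (1 / ((7.4751 * s ^ 2) ^ 2 / 44 - 1) +
        log (((7.4751 * s ^ 2) ^ 2 / 44 + 2) / (2 * π)) / 2)) ≤ 170.6 := by
  have hs2 : 69.9 ≤ 7.4751 * s ^ 2 := by nlinarith
  have hl : 111 ≤ (7.4751 * s ^ 2) ^ 2 / 44 := by nlinarith
  have hpi := pi_gt_d4
  have hlog : log (((7.4751 * s ^ 2) ^ 2 / 44 + 2) / (2 * π)) ≤
      4 * (0.2491 * s - 1 + 0.9953) := by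
    have h1 : ((7.4751 * s ^ 2) ^ 2 / 44 + 2) / (2 * π) ≤ (0.67365 * s) ^ 4 := by
      have h0 : (7.4751 * s ^ 2) ^ 2 / 44 + 2 ≤ 1.01802 * ((7.4751 * s ^ 2) ^ 2 / 44) := by linarith
      rw [div_le_iff₀ (by positivity)]
      have h4 : (0.67365 * s) ^ 4 * (2 * 3.1415) ≤ (0.67365 * s) ^ 4 * (2 * π) := by gcongr
      have : 0 ≤ s ^ 4 := by positivity
      nlinarith
    have h2 := log_le_div_sub_add (y := 0.67365 * s) (w := 0.67365 / 0.2491) (c := 0.9953)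
      (by positivity) (by norm_num)
      (log_le_of_sum 12 (by norm_num) (by norm_num)
        (by norm_num [Finset.sum_range_succ, Nat.factorial]))
    have h3 := log_le_log (by positivity) h1
    rw [log_pow] at h3
    push_cast at h3
    have h4 : 0.67365 * s / (0.67365 / 0.2491) = 0.2491 * s := by field_simp
    rw [h4] at h2
    linarith
  have hY : 1 / ((7.4751 * s ^ 2) ^ 2 / 44 - 1) ≤ 0.0092 := by
    rw [div_le_iff₀ (by linarith)]; linarith
  have hp := pow_mul_exp_neg_le 9 (c := 2) (A := 4.5) (L := s) (by norm_num) (by linarith)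
    (by norm_num)
  have he : exp (-2 * 4.5) ≤ 0.00012342 := by
    rw [neg_mul]
    refine exp_neg_le_of_sum 35 (by norm_num) ?_
    norm_num [Finset.sum_range_succ, Nat.factorial]
  have hp' : s ^ 9 * exp (-2 * s) ≤ 4.5 ^ 9 * 0.00012342 := hp.trans (by gcongr)
  have := error_le (L := 7.4751 * s ^ 2) (q₀ := 0.0483 * exp (-2 * s)) (d := 89.25)
    (r := 1.0184) (X := 0.4982 * s) (z := 81.3) (by linarith) hq hq0 ?_ ?_ (by linarith) ?_
    (by positivity)
  · linarith
  · have : (7.4751 * s ^ 2) ^ 2 = 44 * ((7.4751 * s ^ 2) ^ 2 / 44) := by ring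
    rw [this]; generalize (7.4751 * s ^ 2) ^ 2 / 44 = l at *; nlinarith
  · generalize (7.4751 * s ^ 2) ^ 2 / 44 = l at *; nlinarith
  · calc (7.4751 * s ^ 2) ^ 4 / 88 * (0.0483 * exp (-2 * s)) * 1.0184 * (0.4982 * s)
        = s ^ 9 * exp (-2 * s) * (7.4751 ^ 4 / 88 * 0.0483 * 1.0184 * 0.4982) := by ring
      _ ≤ 4.5 ^ 9 * 0.00012342 * (7.4751 ^ 4 / 88 * 0.0483 * 1.0184 * 0.4982) :=
        mul_le_mul_of_nonneg_right hp' (by norm_num)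
      _ ≤ 81.3 := by norm_num

end PrimeBound

namespace PrimeBound
open Filter Topology MeasureTheory Set Metric
open scoped ComplexConjugate
open scoped ArithmeticFunction.vonMangoldt

lemma abs_psi_sub_le_of_exp_div_le {l L q : ℝ} (hl : 1 < l) (hL : 0 ≤ L) (hq0 : 0 ≤ q)
    (hq : ∀ ρ : XiZero, 1 / 2 < (ρ : ℂ).re → exp (-(1 - (ρ : ℂ).re) * L) / |(ρ : ℂ).im| ≤ q) :
    |Chebyshev.psi (exp L) - exp L| ≤ exp L * ((l ^ 2 / (l - 1) ^ 2 - 1) +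
      (q + 0.4 * exp (-L / 2)) / 2 * (l ^ 3 / (l - 1) ^ 2) *
        (1 / (l - 1) + log ((l + 2) / (2 * π)) / 2)) + (4 * (1 + L) * l + 6) := by
  have hz := tsum_zeroWeight_le hl hL hq0 hq
  have h1 := mul_psi_le hl L (ε := 1) (by norm_num)
  have h2 := mul_psi_le hl L (ε := -1) (by norm_num)
  rw [abs_of_nonneg hL] at h1 h2
  have hl1 : 0 < l - 1 := by linarith
  have h3 : 1 - l ^ 2 / (l + 1) ^ 2 ≤ l ^ 2 / (l - 1) ^ 2 - 1 := by
    have e1 : 1 ≤ l ^ 2 / (l - 1) ^ 2 * (l ^ 2 / (l + 1) ^ 2) * 1 := by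
      rw [div_mul_div_comm, mul_one, one_le_div (by positivity)]
      nlinarith [sq_nonneg l]
    have e2 : 0 < l ^ 2 / (l - 1) ^ 2 := by positivity
    have e3 : 0 < l ^ 2 / (l + 1) ^ 2 := by positivity
    nlinarith [sq_nonneg (l ^ 2 / (l - 1) ^ 2 - l ^ 2 / (l + 1) ^ 2)]
  have h4 : l ^ 2 * -1 / (l - -1) ^ 2 = -(l ^ 2 / (l + 1) ^ 2) := by
    rw [sub_neg_eq_add]; ring
  rw [h4] at h2
  have hp := exp_pos L
  rw [mul_one, one_mul] at h1
  rw [abs_le]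
  constructor
  · nlinarith
  · nlinarith

lemma sq_mul_abs_psi_sub_le {L : ℝ} (hL : 21 ≤ L) :
    L ^ 2 * |Chebyshev.psi (exp L) - exp L| + 2 * L ^ 3 * exp (L / 2) ≤ 170.8 * exp L := by
  have hl : 1 < L ^ 2 / 44 := by nlinarith
  have hE : exp L * exp (-L / 2) = exp (L / 2) := by rw [← Real.exp_add]; ring_nf
  have hE2 : exp (L / 2) * exp (-L / 2) = 1 := by
    rw [← Real.exp_add, ← exp_zero]; ring_nf
  have reduce {q a A : ℝ} (hq0 : 0 ≤ q) (hA : 21 ≤ A) (hAL : A ≤ L)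
      (hq : ∀ ρ : XiZero, 1 / 2 < (ρ : ℂ).re → exp (-(1 - (ρ : ℂ).re) * L) / |(ρ : ℂ).im| ≤ q)
      (ha : L ^ 2 * (((L ^ 2 / 44) ^ 2 / (L ^ 2 / 44 - 1) ^ 2 - 1) +
        (q + 0.4 * exp (-L / 2)) / 2 * ((L ^ 2 / 44) ^ 3 / (L ^ 2 / 44 - 1) ^ 2) *
        (1 / (L ^ 2 / 44 - 1) + log ((L ^ 2 / 44 + 2) / (2 * π)) / 2)) ≤ a)
      (hs : a + (2 * A ^ 3 * exp (-A / 2) + A ^ 5 * exp (-A)) ≤ 170.8) :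
      L ^ 2 * |Chebyshev.psi (exp L) - exp L| + 2 * L ^ 3 * exp (L / 2) ≤ 170.8 * exp L := by
    have h1 := abs_psi_sub_le_of_exp_div_le hl (by linarith) hq0 hq
    have p3 := pow_mul_exp_neg_le 3 (c := 1 / 2) (A := A) (L := L) (by linarith) (by linarith)
      (by push_cast; nlinarith)
    have p5 := pow_mul_exp_neg_le 5 (c := 1) (A := A) (L := L) (by linarith) (by linarith)
      (by push_cast; nlinarith)
    rw [show -(1 / 2) * L = -L / 2 by ring, show -(1 / 2) * A = -A / 2 by ring] at p3
    rw [neg_one_mul, neg_one_mul] at p5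
    have h2 : L ^ 2 * (4 * (1 + L) * (L ^ 2 / 44) + 6) ≤ L ^ 5 := by
      have e1 : 0 ≤ L ^ 2 := by positivity
      have e2 : 4 * (1 + L) * (L ^ 2 / 44) + 6 ≤ L ^ 3 := by nlinarith [mul_nonneg e1 e1]
      calc _ ≤ L ^ 2 * L ^ 3 := by gcongr
        _ = L ^ 5 := by ring
    have h3 : L ^ 5 ≤ exp L * (A ^ 5 * exp (-A)) := by
      have e0 : exp L * exp (-L) = 1 := by rw [← Real.exp_add, ← exp_zero]; ring_nf
      have e1 : L ^ 5 = exp L * (L ^ 5 * exp (-L)) := by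
        linear_combination -L ^ 5 * e0
      rw [e1]
      gcongr
    have h4 : 2 * L ^ 3 * exp (L / 2) ≤ exp L * (2 * A ^ 3 * exp (-A / 2)) := by
      calc 2 * L ^ 3 * exp (L / 2) = exp L * (2 * (L ^ 3 * exp (-L / 2))) := by rw [← hE]; ring
        _ ≤ exp L * (2 * (A ^ 3 * exp (-A / 2))) := by gcongr
        _ = _ := by ring
    have h5 := mul_le_mul_of_nonneg_left h1 (sq_nonneg L)
    have hp := exp_pos L
    have h6 := mul_le_mul_of_nonneg_left ha hp.le
    have h7 := mul_le_mul_of_nonneg_left hs hp.le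
    linarith
  obtain ⟨s, hs0, hs⟩ : ∃ s : ℝ, 0 ≤ s ∧ 7.4751 * s ^ 2 = L := by
    refine ⟨√(L / 7.4751), sqrt_nonneg _, ?_⟩
    rw [sq_sqrt (by positivity)]
    field_simp
  have hmax := fun (ρ : XiZero) ↦ exp_div_abs_im_le s (ρ := ρ)
  rw [hs] at hmax
  rcases le_total s 3.058 with h | h
  · refine reduce (q := 0.1156 * exp (-0.1 * L)) (a := 165) (A := 21) (by positivity) le_rfl hL
      (fun ρ hρ ↦ (hmax ρ hρ).trans (max_le ?_ ?_))
      (error_le_moderate hL (by positivity) le_rfl) ?_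
    · have e1 : exp (-2 * s) ≤ exp 0.87424 * exp (-0.1 * L) := by
        rw [← Real.exp_add, exp_le_exp, ← hs]
        nlinarith
      have e2 : exp 0.87424 ≤ 2.3982 := by
        have e3 : exp (-0.12576) ≤ 0.8819 := by
          refine exp_neg_le_of_sum 6 (by norm_num) ?_
          norm_num [Finset.sum_range_succ, Nat.factorial]
        have e4 := exp_one_lt_d9
        calc exp 0.87424 = exp 1 * exp (-0.12576) := by rw [← Real.exp_add]; norm_num
          _ ≤ 2.7182818286 * 0.8819 := by gcongr
          _ ≤ 2.3982 := by norm_num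
      nlinarith [exp_pos (-0.1 * L)]
    · nlinarith [exp_pos (-0.1 * L)]
    · have e : exp (-21 / 2) ≤ 0.0000276 := by
        rw [neg_div]
        refine exp_neg_le_of_sum 35 (by norm_num) ?_
        norm_num [Finset.sum_range_succ, Nat.factorial]
      have e' : exp (-21) = exp (-21 / 2) * exp (-21 / 2) := by
        rw [← Real.exp_add]; norm_num
      rw [e']
      nlinarith [exp_pos (-21 / 2)]
  · have hb : exp (-L / 2) ≤ 0.000000001 * exp (-2 * s) := by
      have e1 : exp (-L / 2) ≤ exp (-21) * exp (-2 * s) := by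
        rw [← Real.exp_add, exp_le_exp, ← hs]
        nlinarith
      have e2 : exp (-21) ≤ 0.000000001 := by
        refine exp_neg_le_of_sum 40 (by norm_num) ?_
        norm_num [Finset.sum_range_succ, Nat.factorial]
      nlinarith [exp_pos (-2 * s)]
    have hL' : 60 ≤ L := by nlinarith
    refine reduce (q := 0.0482 * exp (-2 * s)) (a := 170.6) (A := 60) (by positivity)
      (by norm_num) hL' (fun ρ hρ ↦ (hmax ρ hρ).trans (max_le le_rfl ?_)) ?_ ?_
    · have e1 : exp (-0.1 * L) ≤ exp (-0.8742) * exp (-2 * s) := by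
        rw [← Real.exp_add, exp_le_exp, ← hs]
        nlinarith
      have e2 : exp (-0.8742) ≤ 0.4173 := by
        refine exp_neg_le_of_sum 12 (by norm_num) ?_
        norm_num [Finset.sum_range_succ, Nat.factorial]
      nlinarith [exp_pos (-2 * s)]
    · have := error_le_large (s := s) (q := 0.0482 * exp (-2 * s)) h (by positivity)
      rw [hs] at this
      exact this (by linarith [exp_pos (-2 * s)])
    · have e : exp (-60 / 2) ≤ 0.0000000000001 := by
        rw [neg_div]
        refine exp_neg_le_of_sum 70 (by norm_num) ?_
        norm_num [Finset.sum_range_succ, Nat.factorial]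
      have e' : exp (-60) = exp (-60 / 2) * exp (-60 / 2) := by
        rw [← Real.exp_add]; norm_num
      rw [e']
      nlinarith [exp_pos (-60 / 2)]

/-- An explicit form of the prime number theorem for `θ`. -/
theorem abs_theta_sub_le {L : ℝ} (hL : 21 ≤ L) :
    |Chebyshev.theta (exp L) - exp L| ≤ 170.8 * exp L / L ^ 2 := by
  have h1 := sq_mul_abs_psi_sub_le hL
  have h2 := Chebyshev.psi_sub_theta_le (x := exp L) (one_le_exp (by linarith))
  have h3 := Chebyshev.theta_le_psi (exp L)
  have h4 : √(exp L) = exp (L / 2) := by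
    rw [sqrt_eq_iff_mul_self_eq (exp_pos _).le (exp_pos _).le, ← Real.exp_add]; ring_nf
  rw [h4, log_exp] at h2
  rw [le_div_iff₀ (by positivity)]
  have h5 : |Chebyshev.theta (exp L) - exp L| ≤
      |Chebyshev.psi (exp L) - exp L| + 2 * exp (L / 2) * L := by
    rw [abs_le]
    have := abs_le.mp (le_refl |Chebyshev.psi (exp L) - exp L|)
    constructor <;> linarith
  have h6 := mul_le_mul_of_nonneg_left h5 (sq_nonneg L)
  linarith

end PrimeBound

namespace PrimeBound
open Filter Topology MeasureTheory Set Metric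
open scoped ComplexConjugate
open scoped ArithmeticFunction.vonMangoldt

lemma theta_exp_le (L : ℝ) : Chebyshev.theta (exp L) ≤ 1.3863 * exp L := by
  have h := Chebyshev.theta_le_log4_mul_x (exp_pos L).le
  have h2 : log 4 = 2 * log 2 := by rw [← log_rpow (by norm_num)]; norm_num
  have := log_two_lt_d9
  nlinarith [exp_pos L]

lemma sqrt_exp (L : ℝ) : √(exp L) = exp (L / 2) := by
  rw [sqrt_eq_iff_mul_self_eq (exp_pos _).le (exp_pos _).le, ← Real.exp_add]; ring_nf

lemma theta_exp_ge {L A c : ℝ} (hA : 9 ≤ A) (hL : A ≤ L) (hc : A * exp (-A / 2) ≤ c) :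
    (0.6908 - 2 * c) * exp L ≤ Chebyshev.theta (exp L) := by
  have hp := exp_pos L
  have h := Chebyshev.theta_ge' (x := exp L) (one_le_exp (by linarith))
  rw [sqrt_exp, log_exp] at h
  have h1 : L * exp (-L / 2) ≤ c := by
    have := pow_mul_exp_neg_le 1 (c := 1 / 2) (A := A) (L := L) (by linarith) (by linarith)
      (by push_cast; nlinarith)
    rw [pow_one, pow_one, show -(1 / 2) * L = -L / 2 by ring,
      show -(1 / 2) * A = -A / 2 by ring] at this
    exact this.trans hc
  have h2 : L * exp (-L) ≤ 0.00112 := by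
    have := pow_mul_exp_neg_le 1 (c := 1) (A := 9) (L := L) (by norm_num) (by linarith)
      (by push_cast; nlinarith)
    have he : exp (-9) ≤ 0.00012342 := by
      refine exp_neg_le_of_sum 35 (by norm_num) ?_
      norm_num [Finset.sum_range_succ, Nat.factorial]
    rw [pow_one, pow_one, neg_one_mul, neg_one_mul] at this
    linarith
  have e1 : exp L * exp (-L / 2) = exp (L / 2) := by rw [← Real.exp_add]; ring_nf
  have e2 : exp L * exp (-L) = 1 := by rw [← Real.exp_add, ← exp_zero]; ring_nf
  have h3 : log (exp L + 2) ≤ L + 1 := by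
    rw [log_le_iff_le_exp (by positivity), Real.exp_add]
    have := add_one_le_exp L
    have := exp_one_gt_d9
    nlinarith
  have h4 : exp (L / 2) * L ≤ c * exp L := by
    rw [← e1]; nlinarith
  have h5 : L ≤ 0.00112 * exp L := by
    calc L = exp L * (L * exp (-L)) := by linear_combination -L * e2
      _ ≤ exp L * 0.00112 := by gcongr
      _ = _ := by ring
  have h6 := log_two_gt_d9
  have h7 := log_two_lt_d9
  nlinarith

lemma nine_mul_exp_le : 9 * exp (-9 / 2) ≤ 0.1 := by
  have : exp (-9 / 2) ≤ 0.01111 := by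
    rw [neg_div]
    refine exp_neg_le_of_sum 25 (by norm_num) ?_
    norm_num [Finset.sum_range_succ, Nat.factorial]
  linarith

lemma twelve_mul_exp_le : 12 * exp (-12 / 2) ≤ 0.0298 := by
  have : exp (-12 / 2) ≤ 0.00248 := by
    rw [neg_div]
    refine exp_neg_le_of_sum 25 (by norm_num) ?_
    norm_num [Finset.sum_range_succ, Nat.factorial]
  linarith

lemma abs_theta_exp_sub_le {L : ℝ} (hL : 12 ≤ L) :
    |Chebyshev.theta (exp L) - exp L| * L ^ 2 ≤ min (0.3863 * L ^ 2) 170.8 * exp L := by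
  have hp := exp_pos L
  have h1 : |Chebyshev.theta (exp L) - exp L| ≤ 0.3863 * exp L := by
    have := theta_exp_le L
    have := theta_exp_ge (by norm_num) hL twelve_mul_exp_le
    rw [abs_le]
    constructor <;> linarith
  have hL2 : 0 < L ^ 2 := by positivity
  have h2 : |Chebyshev.theta (exp L) - exp L| * L ^ 2 ≤ 0.3863 * L ^ 2 * exp L := by nlinarith
  rcases le_total L 21 with h | h
  · have : 0.3863 * L ^ 2 ≤ 170.8 := by nlinarith
    rwa [min_eq_left this]
  · have h3 := abs_theta_sub_le h
    rw [le_div_iff₀ hL2] at h3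
    rw [min_mul_of_nonneg _ _ hp.le]
    exact le_min h2 h3

lemma abs_theta_exp_sub_le_linear {L : ℝ} (hL : 9 ≤ L) :
    |Chebyshev.theta (exp L) - exp L| * L ^ 2 ≤ (11 * L - 39) * exp L := by
  have hp := exp_pos L
  rcases le_total L 12 with h | h
  · have h1 : |Chebyshev.theta (exp L) - exp L| ≤ 0.6 * exp L := by
      have := theta_exp_le L
      have := theta_exp_ge (by norm_num) hL nine_mul_exp_le
      rw [abs_le]
      constructor <;> linarith
    calc _ ≤ 0.6 * exp L * L ^ 2 := by gcongr
      _ = 0.6 * L ^ 2 * exp L := by ring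
      _ ≤ _ := by
        gcongr
        nlinarith
  · refine (abs_theta_exp_sub_le h).trans ?_
    gcongr
    rcases le_total L 21 with h' | h'
    · exact (min_le_left _ _).trans (by nlinarith)
    · exact (min_le_right _ _).trans (by linarith)

lemma abs_theta_div_sub_le {t : ℝ} (ht : exp 9 ≤ t) :
    |Chebyshev.theta t / (t * log t ^ 2) - 1 / log t ^ 2| ≤ 11 / log t ^ 3 - 39 / log t ^ 4 := by
  have ht0 : 0 < t := (exp_pos 9).trans_le ht
  have hL : 9 ≤ log t := by rwa [le_log_iff_exp_le ht0]
  have h := abs_theta_exp_sub_le_linear hL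
  rw [exp_log ht0] at h
  set L := log t
  have hL0 : 0 < L := by linarith
  have e : Chebyshev.theta t / (t * L ^ 2) - 1 / L ^ 2 = (Chebyshev.theta t - t) / (t * L ^ 2) := by
    field_simp
  rw [e, abs_div, abs_of_pos (show 0 < t * L ^ 2 by positivity), div_le_iff₀ (by positivity)]
  have e2 : (11 / L ^ 3 - 39 / L ^ 4) * (t * L ^ 2) = (11 * L - 39) * t / L ^ 2 := by
    field_simp
  rw [e2, le_div_iff₀ (by positivity)]
  exact h

lemma hasDerivAt_div_log_sq_add (c : ℝ) {t : ℝ} (ht : 1 < t) :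
    HasDerivAt (fun t ↦ t / log t ^ 2 + c * (t / log t ^ 3))
      (1 / log t ^ 2 + ((c - 2) / log t ^ 3 - 3 * c / log t ^ 4)) t := by
  have hL : 0 < log t := log_pos ht
  have ht0 : t ≠ 0 := by linarith
  have hd := hasDerivAt_log ht0
  have h1 := (hasDerivAt_id t).div (hd.pow 2) (pow_ne_zero 2 hL.ne')
  have h2 := ((hasDerivAt_id t).div (hd.pow 3) (pow_ne_zero 3 hL.ne')).const_mul c
  convert! h1.add h2 using 1
  simp only [id, Pi.pow_apply]
  field_simp
  push_cast
  ring

lemma integral_div_log_sq_add (c : ℝ) {x : ℝ} (hx : exp 9 ≤ x) :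
    IntervalIntegrable (fun t ↦ 1 / log t ^ 2 + ((c - 2) / log t ^ 3 - 3 * c / log t ^ 4))
        volume (exp 9) x ∧
      ∫ t in exp 9..x, (1 / log t ^ 2 + ((c - 2) / log t ^ 3 - 3 * c / log t ^ 4)) =
        (x / log x ^ 2 + c * (x / log x ^ 3)) - (exp 9 / 9 ^ 2 + c * (exp 9 / 9 ^ 3)) := by
  have h1 : ∀ t ∈ uIcc (exp 9) x, 1 < t := fun t ht ↦ by
    rw [uIcc_of_le hx] at ht
    exact (one_lt_exp_iff.mpr (by norm_num)).trans_le ht.1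
  have hi : IntervalIntegrable
      (fun t ↦ 1 / log t ^ 2 + ((c - 2) / log t ^ 3 - 3 * c / log t ^ 4)) volume (exp 9) x := by
    refine ContinuousOn.intervalIntegrable fun t ht ↦ ContinuousAt.continuousWithinAt ?_
    have h2 : log t ≠ 0 := (log_pos (h1 t ht)).ne'
    have h3 : t ≠ 0 := by linarith [h1 t ht]
    have h4 := continuousAt_log h3
    exact (continuousAt_const.div (h4.pow 2) (pow_ne_zero 2 h2)).add
      ((continuousAt_const.div (h4.pow 3) (pow_ne_zero 3 h2)).sub
        (continuousAt_const.div (h4.pow 4) (pow_ne_zero 4 h2)))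
  refine ⟨hi, ?_⟩
  rw [intervalIntegral.integral_eq_sub_of_hasDerivAt
    (fun t ht ↦ hasDerivAt_div_log_sq_add c (h1 t ht)) hi, log_exp]

lemma two_le_exp_nine : 2 ≤ exp 9 := by
  have := add_one_le_exp (9 : ℝ)
  linarith

lemma intervalIntegrable_theta {a b : ℝ} (ha : 2 ≤ a) (hab : a ≤ b) :
    IntervalIntegrable (fun t ↦ Chebyshev.theta t / (t * log t ^ 2)) volume a b := by
  rw [intervalIntegrable_iff_integrableOn_Icc_of_le hab]
  exact (Chebyshev.integrableOn_theta_div_id_mul_log_sq b).mono_set (Icc_subset_Icc_left ha)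

lemma primeCounting_floor_exp_nine_le : (Nat.primeCounting ⌊exp 9⌋₊ : ℝ) ≤ 2590 := by
  have h := Chebyshev.pi_le_log4_mul_div (x := exp 9) (by linarith [two_le_exp_nine])
  rw [sqrt_exp, log_exp] at h
  have h2 : log 4 = 2 * log 2 := by rw [← log_rpow (by norm_num)]; norm_num
  have h3 := log_two_lt_d9
  have h5 : exp (9 / 2) ≤ 90.03 := by
    have h4 : exp (-(9 / 2)) * exp (9 / 2) = 1 := by rw [← Real.exp_add, ← exp_zero]; ring_nf
    have e1 := exp_one_lt_d9
    have e2 : exp (-(1 / 2)) ≤ 0.60654 := by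
      refine exp_neg_le_of_sum 12 (by norm_num) ?_
      norm_num [Finset.sum_range_succ, Nat.factorial]
    calc exp (9 / 2) = exp 1 ^ 5 * exp (-(1 / 2)) := by
          rw [← exp_nat_mul, ← Real.exp_add]; norm_num
      _ ≤ 2.7182818286 ^ 5 * 0.60654 := by gcongr
      _ ≤ 90.03 := by norm_num
  have h6 : exp 9 = exp (9 / 2) * exp (9 / 2) := by rw [← Real.exp_add]; norm_num
  have h7 : exp 9 ≤ 8105.5 := by rw [h6]; nlinarith [exp_pos (9 / 2)]
  have h8 : log 4 * exp 9 ≤ 1.38629437 * 8105.5 := by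
    rw [h2]
    gcongr
    linarith
  linarith

/-- The prime counting function in terms of `θ`, after integrating by parts once more. -/
lemma primeCounting_floor_le {x : ℝ} (hx : exp 9 ≤ x) :
    (Nat.primeCounting ⌊x⌋₊ : ℝ) - Chebyshev.theta x / log x - x / log x ^ 2 ≤
        13 * (x / log x ^ 3) + 2350 ∧
      -(13 * (x / log x ^ 3)) ≤
        (Nat.primeCounting ⌊x⌋₊ : ℝ) - Chebyshev.theta x / log x - x / log x ^ 2 := by
  have h2 := two_le_exp_nine
  have h9 : 8100 ≤ exp 9 := by
    have e1 := exp_one_gt_d9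
    calc (8100 : ℝ) ≤ 2.7182818283 ^ 9 := by norm_num
      _ ≤ exp 1 ^ 9 := by gcongr
      _ = exp 9 := by rw [← exp_nat_mul]; norm_num
  have e1 := Chebyshev.primeCounting_eq_theta_div_log_add_integral (h2.trans hx)
  have e2 := Chebyshev.primeCounting_eq_theta_div_log_add_integral h2
  have hi := intervalIntegrable_theta le_rfl h2
  have hi' := intervalIntegrable_theta h2 hx
  have e3 := intervalIntegral.integral_add_adjacent_intervals hi hi'
  have h0 := primeCounting_floor_exp_nine_le
  have ht0 := Chebyshev.theta_nonneg (exp 9)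
  have h3 : Chebyshev.theta (exp 9) / log (exp 9) ≤ (Nat.primeCounting ⌊exp 9⌋₊ : ℝ) := by
    rw [div_le_iff₀ (by rw [log_exp]; norm_num)]
    exact Chebyshev.theta_le_pi_mul_log' _
  have h4 : 0 ≤ Chebyshev.theta (exp 9) / log (exp 9) := by rw [log_exp]; positivity
  obtain ⟨j1, k1⟩ := integral_div_log_sq_add 13 hx
  obtain ⟨j2, k2⟩ := integral_div_log_sq_add (-13) hx
  have u1 := intervalIntegral.integral_mono_on hx hi' j1 fun t ht ↦ by
    have := (abs_le.mp (abs_theta_div_sub_le ht.1)).2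
    norm_num at this ⊢
    linarith
  have u2 := intervalIntegral.integral_mono_on hx j2 hi' fun t ht ↦ by
    have h5 := (abs_le.mp (abs_theta_div_sub_le ht.1)).1
    have h6 : 0 < log t := log_pos (by linarith [ht.1])
    have h7 : -15 / log t ^ 3 ≤ -11 / log t ^ 3 := by gcongr; norm_num
    norm_num [neg_div] at h5 h7 ⊢
    linarith
  constructor <;> linarith

lemma primePi_eq_primeCounting (n : ℕ) : primePi n = Nat.primeCounting n := by
  rw [← Nat.primesLE_card_eq_primeCounting, primePi]
  congr 1
  ext p
  simp only [Finset.mem_filter, Finset.mem_Icc, Nat.mem_primesLE]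
  exact ⟨fun h ↦ ⟨h.1.2, h.2⟩, fun h ↦ ⟨⟨h.2.one_le, h.1⟩, h.2⟩⟩

lemma primeCounting_floor_exp_sub_ge {L : ℝ} (hL : 0 < L) :
    -(184 * (exp L / L ^ 3)) ≤
      (Nat.primeCounting ⌊exp L⌋₊ : ℝ) - exp L / L - exp L / L ^ 2 := by
  have hp := exp_pos L
  set P := (Nat.primeCounting ⌊exp L⌋₊ : ℝ) with hP
  have hP0 : 0 ≤ P := Nat.cast_nonneg _
  have e1 : exp L / L = L ^ 2 * (exp L / L ^ 3) := by field_simp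
  have e2 : exp L / L ^ 2 = L * (exp L / L ^ 3) := by field_simp
  have hy : 0 < exp L / L ^ 3 := by positivity
  rcases le_total L 13 with h | h
  · rw [e1, e2]
    nlinarith [mul_nonneg hy.le (by nlinarith : 0 ≤ 184 - L ^ 2 - L)]
  · have h1 := (primeCounting_floor_le (x := exp L) (exp_le_exp.mpr (by linarith))).2
    rw [log_exp] at h1
    have h2 := abs_theta_exp_sub_le (L := L) (by linarith)
    have h3 := h2.trans (mul_le_mul_of_nonneg_right (min_le_right _ _) hp.le)
    have h4 := neg_abs_le (Chebyshev.theta (exp L) - exp L)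
    have h5 : -(170.8 * (exp L / L ^ 3)) ≤ Chebyshev.theta (exp L) / L - exp L / L := by
      have : Chebyshev.theta (exp L) / L - exp L / L + 170.8 * (exp L / L ^ 3) =
          ((Chebyshev.theta (exp L) - exp L) * L ^ 2 + 170.8 * exp L) / L ^ 3 := by field_simp
      have h6 : 0 ≤ ((Chebyshev.theta (exp L) - exp L) * L ^ 2 + 170.8 * exp L) / L ^ 3 := by
        apply div_nonneg _ (by positivity)
        nlinarith [sq_nonneg L]
      linarith
    linarith

lemma primeCounting_floor_exp_sub_le {L : ℝ} (hL : 1 ≤ L) :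
    (Nat.primeCounting ⌊exp L⌋₊ : ℝ) - exp L / L - exp L / L ^ 2 ≤ 184 * (exp L / L ^ 3) := by
  have hp := exp_pos L
  set P := (Nat.primeCounting ⌊exp L⌋₊ : ℝ) with hP
  have e1 : exp L / L = L ^ 2 * (exp L / L ^ 3) := by field_simp
  have e2 : exp L / L ^ 2 = L * (exp L / L ^ 3) := by field_simp
  have hy : 0 < exp L / L ^ 3 := by positivity
  rcases le_total L 10 with h | h
  · have h1 := Chebyshev.pi_le_log4_mul_div (x := exp L) (one_lt_exp_iff.mpr (by linarith))
    have h2 : log 4 = 2 * log 2 := by rw [← log_rpow (by norm_num)]; norm_num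
    have h3 := log_two_lt_d9
    rw [sqrt_exp, log_exp, ← hP] at h1
    have h4 : log 4 * exp L / (L / 2) ≤ 2.7726 * (exp L / L) := by
      rw [show log 4 * exp L / (L / 2) = 4 * log 2 * (exp L / L) by rw [h2]; field_simp; ring]
      gcongr
      linarith
    have h5 : exp (L / 2) ≤ 11 * (exp L / L ^ 3) := by
      have h6 := pow_mul_exp_neg_le 3 (c := 1 / 2) (A := 6) (L := L) (by norm_num) (by linarith)
        (by norm_num)
      have h7 : exp (-(1 / 2) * 6) ≤ 0.05 := by
        rw [neg_mul]
        refine exp_neg_le_of_sum 12 (by norm_num) ?_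
        norm_num [Finset.sum_range_succ, Nat.factorial]
      have h8 : exp L * exp (-(1 / 2) * L) = exp (L / 2) := by rw [← Real.exp_add]; ring_nf
      rw [← mul_div_assoc, le_div_iff₀ (by positivity), ← h8]
      nlinarith
    rw [e1] at h4
    rw [e1, e2]
    nlinarith [mul_nonneg hy.le (by nlinarith : 0 ≤ 173 - 1.7726 * L ^ 2 + L)]
  · have h1 := (primeCounting_floor_le (x := exp L) (exp_le_exp.mpr (by linarith))).1
    rw [log_exp, ← hP] at h1
    suffices ∃ a A m : ℝ, 10 ≤ A ∧ A ≤ L ∧ 0 ≤ m ∧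
        (Chebyshev.theta (exp L) - exp L) * L ^ 2 ≤ a * exp L ∧
        2350 * A ^ 3 ≤ m * ∑ i ∈ Finset.range 70, A ^ i / i.factorial ∧ a + m ≤ 171 by
      obtain ⟨a, A, m, hA, hAL, hm, ha, hmA, ham⟩ := this
      have h5 : Chebyshev.theta (exp L) / L - exp L / L ≤ a * (exp L / L ^ 3) := by
        have : Chebyshev.theta (exp L) / L - exp L / L =
          (Chebyshev.theta (exp L) - exp L) * L ^ 2 / L ^ 3 := by field_simp
        rw [this, ← mul_div_assoc]
        gcongr
      have h6 : 2350 ≤ m * (exp L / L ^ 3) := by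
        rw [← mul_div_assoc, le_div_iff₀ (by positivity)]
        have h7 := pow_mul_exp_neg_le 3 (c := 1) (A := A) (L := L) (by linarith) (by linarith)
          (by push_cast; nlinarith)
        rw [neg_one_mul, neg_one_mul, exp_neg, exp_neg, ← div_eq_mul_inv, ← div_eq_mul_inv,
          div_le_div_iff₀ hp (exp_pos A)] at h7
        have h8 : 2350 * A ^ 3 ≤ m * exp A :=
          hmA.trans (by gcongr; exact Real.sum_le_exp_of_nonneg (by linarith) 70)
        have h9 := exp_pos A
        have h10 : 2350 * L ^ 3 * exp A ≤ m * exp L * exp A := by nlinarith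
        exact le_of_mul_le_mul_right h10 h9
      nlinarith [mul_le_mul_of_nonneg_right ham hy.le]
    have hL2 : 0 < L ^ 2 := by positivity
    have ht : (Chebyshev.theta (exp L) - exp L) * L ^ 2 ≤ 0.3863 * L ^ 2 * exp L := by
      nlinarith [theta_exp_le L]
    have hsq {B b : ℝ} (hLB : L ≤ B) (hb : 0.3863 * B ^ 2 ≤ b) :
        (Chebyshev.theta (exp L) - exp L) * L ^ 2 ≤ b * exp L := by
      refine ht.trans ?_
      gcongr
      exact le_trans (by gcongr) hb
    rcases le_total L 12 with h12 | h12
    · refine ⟨56, 10, 110, le_rfl, h, by norm_num, hsq h12 (by norm_num), ?_, by norm_num⟩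
      norm_num [Finset.sum_range_succ, Nat.factorial]
    rcases le_total L 19 with h19 | h19
    · refine ⟨140, 12, 30, by norm_num, h12, by norm_num, hsq h19 (by norm_num), ?_, by norm_num⟩
      norm_num [Finset.sum_range_succ, Nat.factorial]
    · refine ⟨170.8, 19, 0.2, by norm_num, h19, by norm_num, ?_, ?_, by norm_num⟩
      · have h2 := abs_theta_exp_sub_le (L := L) (by linarith)
        have h3 := h2.trans (mul_le_mul_of_nonneg_right (min_le_right _ _) hp.le)
        exact le_trans (by gcongr; exact le_abs_self _) h3
      · norm_num [Finset.sum_range_succ, Nat.factorial]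

end PrimeBound

/-- (Trudgian) For every integer `n ≥ 229`,
`|π(n) − n/log n − n/(log n)²| ≤ 184 n/(log n)³`. -/
theorem trudgian_primePi_bound (n : ℕ) (hn : 229 ≤ n) :
    |(primePi n : ℝ) - n / Real.log n - n / (Real.log n) ^ 2|
      ≤ 184 * n / (Real.log n) ^ 3 := by
  have hn0 : (0 : ℝ) < n := by positivity
  have hL : 1 ≤ log n := by
    rw [le_log_iff_exp_le hn0]
    have h1 := exp_one_lt_d9
    have h2 : (229 : ℝ) ≤ n := by exact_mod_cast hn
    linarith
  have h1 := PrimeBound.primeCounting_floor_exp_sub_ge (L := log n) (by linarith)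
  have h2 := PrimeBound.primeCounting_floor_exp_sub_le hL
  rw [exp_log hn0, Nat.floor_natCast] at h1 h2
  rw [PrimeBound.primePi_eq_primeCounting, mul_div_assoc]
  exact abs_le.mpr ⟨h1, h2⟩
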